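/- Let q be an odd prime power. For every real number u with |u| < 1/q, the series ∑_{n=0}^∞ S_n u^n / |Sp(2n,q)| converges, the families of factors (1 + u^i) for i ≥ 1 and (1 - u^i q^{1-2l})^{-1} for pairs (i,l) with i ≥ 1, l ≥ 0 are multipliable in ℝ, and ∑_{n=0}^∞ S_n u^n / |Sp(2n,q)| = ∏_{i ≥ 1} (1 + u^i) · ∏_{i ≥ 1} ∏_{l ≥ 0} (1 - u^i q^{1-2l})^{-1}. -/

import Mathlib

open Matrix

/-- The `2n × 2n` matrix `J = [[0, I],[-I, 0]]` defining the symplectic group. -/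
noncomputable def sympJ (F : Type) [Field F] (n : ℕ) :
    Matrix (Fin n ⊕ Fin n) (Fin n ⊕ Fin n) F :=
  Matrix.fromBlocks 0 1 (-1) 0

/-- `|Sp(2n,q)| = q^{n²} ∏_{i=1}^n (q^{2i} - 1)`, as a real number. -/
noncomputable def spOrder (q n : ℕ) : ℝ :=
  (q : ℝ) ^ (n ^ 2) * ∏ i ∈ Finset.range n, ((q : ℝ) ^ (2 * (i + 1)) - 1)

/-- `S_n`: the number of ordered pairs of commuting elements of the Lie algebra
`sp(2n,q) = {A : A·J = (A·J)ᵀ}`. -/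
noncomputable def spCommPairs (F : Type) [Field F] [Fintype F] (n : ℕ) : ℕ :=
  Nat.card {P : Matrix (Fin n ⊕ Fin n) (Fin n ⊕ Fin n) F ×
      Matrix (Fin n ⊕ Fin n) (Fin n ⊕ Fin n) F //
    P.1 * sympJ F n = (P.1 * sympJ F n)ᵀ ∧ P.2 * sympJ F n = (P.2 * sympJ F n)ᵀ ∧
    P.1 * P.2 = P.2 * P.1}


namespace SpFF
open Module

section basic
variable {F : Type} [Field F]

/-- bilinear forms -/
abbrev Bil (F : Type) [Field F] (V : Type) [AddCommGroup V] [Module F V] : Type :=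
  V →ₗ[F] V →ₗ[F] F

variable {V W : Type} [AddCommGroup V] [Module F V] [AddCommGroup W] [Module F W]

def Typ (o : Option F) (β : Bil F V) : Prop := ∀ ε ∈ o, ∀ x y, β y x = ε * β x y
def ND (β : Bil F V) : Prop := ∀ x, (∀ y, β x y = 0) → x = 0
def Sk (B : End F V) (β : Bil F V) : Prop := ∀ x y, β (B x) y = - β x (B y)

noncomputable def nF (o : Option F) (B : End F V) : ℕ := Nat.card {β : Bil F V // Sk B β ∧ Typ o β}
noncomputable def dF (o : Option F) (B : End F V) : ℕ :=
  Nat.card {β : Bil F V // Sk B β ∧ Typ o β ∧ ND β}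

/-- pull back of forms along an equivalence -/
noncomputable def pb (e : V ≃ₗ[F] W) : Bil F W ≃ Bil F V where
  toFun β := β.compl₁₂ e.toLinearMap e.toLinearMap
  invFun β := β.compl₁₂ e.symm.toLinearMap e.symm.toLinearMap
  left_inv β := by ext; simp
  right_inv β := by ext; simp

@[simp] lemma pb_apply (e : V ≃ₗ[F] W) (β : Bil F W) (x y : V) : pb e β x y = β (e x) (e y) := rfl

lemma pb_typ (e : V ≃ₗ[F] W) (o : Option F) (β : Bil F W) : Typ o (pb e β) ↔ Typ o β := by
  constructor
  · intro h ε hε x y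
    simpa using h ε hε (e.symm x) (e.symm y)
  · intro h ε hε x y
    simpa using h ε hε (e x) (e y)

lemma pb_nd (e : V ≃ₗ[F] W) (β : Bil F W) : ND (pb e β) ↔ ND β := by
  constructor
  · intro h x hx
    have := h (e.symm x) (fun y => by simpa using hx (e y))
    simpa using this
  · intro h x hx
    have := h (e x) (fun y => by simpa using hx (e.symm y))
    simpa using this

lemma pb_sk (e : V ≃ₗ[F] W) (B : End F V) (B' : End F W) (h : ∀ x, e (B x) = B' (e x))
    (β : Bil F W) : Sk B (pb e β) ↔ Sk B' β := by
  constructor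
  · intro hs x y
    have := hs (e.symm x) (e.symm y)
    simpa [h] using this
  · intro hs x y
    simpa [h] using hs (e x) (e y)

lemma nF_congr (e : V ≃ₗ[F] W) (o : Option F) (B : End F V) (B' : End F W)
    (h : ∀ x, e (B x) = B' (e x)) : nF o B = nF o B' := by
  refine (Nat.card_congr ((pb e).subtypeEquiv fun β => ?_)).symm
  rw [pb_sk e B B' h, pb_typ]

lemma dF_congr (e : V ≃ₗ[F] W) (o : Option F) (B : End F V) (B' : End F W)
    (h : ∀ x, e (B x) = B' (e x)) : dF o B = dF o B' := by
  refine (Nat.card_congr ((pb e).subtypeEquiv fun β => ?_)).symm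
  rw [pb_sk e B B' h, pb_typ, pb_nd]

noncomputable def NN (F : Type) [Field F] (o : Option F) (m : ℕ) : ℕ := nF o (0 : End F (Fin m → F))
noncomputable def DD (F : Type) [Field F] (o : Option F) (m : ℕ) : ℕ := dF o (0 : End F (Fin m → F))

lemma nF_zero [FiniteDimensional F V] (o : Option F) : nF o (0 : End F V) = NN F o (finrank F V) := by
  refine nF_congr (finBasis F V).equivFun o _ _ (fun x => by simp)

lemma dF_zero [FiniteDimensional F V] (o : Option F) : dF o (0 : End F V) = DD F o (finrank F V) := by
  refine dF_congr (finBasis F V).equivFun o _ _ (fun x => by simp)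

instance bil_finite [Finite F] [Finite V] : Finite (Bil F V) :=
  Finite.of_injective (fun (β : Bil F V) (x y : V) => β x y) (fun β γ h => by
    ext x y; exact congrFun (congrFun h x) y)

lemma card_fiber {G H : Type} [AddGroup G] [AddGroup H] [Finite G] [Finite H] (f : G →+ H)
    (hf : Function.Surjective f) (S : Set H) :
    Nat.card (f ⁻¹' S) * Nat.card H = Nat.card S * Nat.card G := by
  have key : ∀ T : Set H, Nat.card (f ⁻¹' T) = Nat.card T * Nat.card f.ker := by
    intro T
    rw [← Nat.card_prod]
    let g := Function.surjInv hf
    have hg : ∀ h, f (g h) = h := Function.surjInv_eq hf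
    refine Nat.card_congr ⟨fun x => (⟨f x, x.2⟩, ⟨- g (f x) + x, by simp [AddMonoidHom.mem_ker, hg]⟩),
      fun p => ⟨g p.1 + p.2, ?_⟩, ?_, ?_⟩
    · have : f p.2 = 0 := p.2.2
      simp [hg, this]
    · intro x; ext; simp
    · rintro ⟨⟨t, ht⟩, ⟨k, hk⟩⟩
      have hk' : f k = 0 := hk
      ext <;> simp [hg, hk']
  have h1 := key S
  have h2 := key Set.univ
  simp only [Set.preimage_univ, Nat.card_coe_set_eq, Set.ncard_univ] at h1 h2 ⊢
  rw [h1, h2]; ring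

/-- abstract peel data -/
structure Peel (F : Type) [Field F] (V W U : Type) [AddCommGroup V] [Module F V]
    [AddCommGroup W] [Module F W] [AddCommGroup U] [Module F U] where
  b : V →ₗ[F] W
  i : W →ₗ[F] V
  j : U →ₗ[F] V
  pW : V →ₗ[F] W
  pU : V →ₗ[F] U
  hb : Function.Surjective b
  h1 : ∀ w, pW (i w) = w
  h2 : ∀ w, pU (i w) = 0
  h3 : ∀ u, pU (j u) = u
  h4 : ∀ u, pW (j u) = 0
  h5 : ∀ x, i (pW x) + j (pU x) = x

variable {U : Type} [AddCommGroup U] [Module F U]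

namespace Peel
variable (P : Peel F V W U)

def B : End F V := P.i ∘ₗ P.b
def BW : End F W := P.b ∘ₗ P.i

noncomputable def sec : W →ₗ[F] V := (P.b.exists_rightInverse_of_surjective (LinearMap.range_eq_top.2 P.hb)).choose
lemma b_sec (w : W) : P.b (P.sec w) = w :=
  LinearMap.congr_fun (P.b.exists_rightInverse_of_surjective (LinearMap.range_eq_top.2 P.hb)).choose_spec w

/-- the restricted form -/
noncomputable def down (β : Bil F V) : Bil F W := β.compl₁₂ P.i P.sec

lemma B_apply (x : V) : P.B x = P.i (P.b x) := rfl
lemma BW_apply (x : W) : P.BW x = P.b (P.i x) := rfl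

lemma down_spec {β : Bil F V} (hβ : Sk P.B β) (w : W) (y : V) :
    P.down β w (P.b y) = β (P.i w) y := by
  obtain ⟨x, rfl⟩ := P.hb w
  have h0 : ∀ z, P.b z = 0 → β (P.i (P.b x)) z = 0 := by
    intro z hz
    have := hβ x z
    simpa [B_apply, hz] using this
  have := h0 (P.sec (P.b y) - y) (by simp [b_sec])
  rw [map_sub, sub_eq_zero] at this
  exact this

/-- the extended form -/
noncomputable def up (δ : Bil F W) (γ : Bil F U) : Bil F V :=
  δ.compl₁₂ P.pW P.b - δ.compl₁₂ (P.b ∘ₗ P.j ∘ₗ P.pU) P.pW + γ.compl₁₂ P.pU P.pU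

lemma up_apply (δ : Bil F W) (γ : Bil F U) (x y : V) :
    P.up δ γ x y = δ (P.pW x) (P.b y) - δ (P.b (P.j (P.pU x))) (P.pW y) + γ (P.pU x) (P.pU y) := rfl

lemma up_sk {δ : Bil F W} (hδ : Sk P.BW δ) (γ : Bil F U) : Sk P.B (P.up δ γ) := by
  intro x y
  have e : P.b x = P.b (P.i (P.pW x)) + P.b (P.j (P.pU x)) := by rw [← map_add, P.h5]
  have := hδ (P.pW x) (P.b y)
  simp only [BW_apply] at this
  simp only [up_apply, B_apply, P.h1, P.h2, map_zero, LinearMap.zero_apply]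
  rw [e, map_add, LinearMap.add_apply, this]
  ring

lemma up_typ {o : Option F} {δ : Bil F W} (hδ : Sk P.BW δ) (hδ' : Typ (o.map (fun x => - x)) δ) {γ : Bil F U}
    (hγ : Typ o γ) : Typ o (P.up δ γ) := by
  intro ε hε x y
  have h1 : ∀ x y, δ y x = (-ε) * δ x y := hδ' (-ε) (Option.mem_map.2 ⟨ε, hε, rfl⟩)
  have h2 := hγ ε hε
  have e : ∀ x, P.b x = P.b (P.i (P.pW x)) + P.b (P.j (P.pU x)) := fun x => by rw [← map_add, P.h5]
  simp only [up_apply]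
  rw [h2 (P.pU x), e x, e y, map_add, map_add]
  have a1 := hδ (P.pW x) (P.pW y)
  simp only [BW_apply] at a1
  have b1 := h1 (P.b (P.i (P.pW x))) (P.pW y)
  have b2 := h1 (P.b (P.j (P.pU x))) (P.pW y)
  have b3 := h1 (P.pW x) (P.b (P.j (P.pU y)))
  rw [b1, b2, b3, a1]
  ring

lemma down_sk {β : Bil F V} (hβ : Sk P.B β) : Sk P.BW (P.down β) := by
  intro w w'
  obtain ⟨y, rfl⟩ := P.hb w'
  rw [BW_apply, BW_apply, down_spec P hβ, down_spec P hβ]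
  exact hβ _ _

lemma down_typ {o : Option F} {β : Bil F V} (hβ : Sk P.B β) (h : Typ o β) :
    Typ (o.map (fun x => - x)) (P.down β) := by
  intro ε hε x y
  obtain ⟨ε, he, rfl⟩ : ∃ a ∈ o, -a = ε := by simpa using hε
  obtain ⟨x, rfl⟩ := P.hb x
  obtain ⟨y, rfl⟩ := P.hb y
  rw [down_spec P hβ, down_spec P hβ, ← B_apply, ← B_apply, hβ y x, h ε he]
  ring

lemma up_down {β : Bil F V} (hβ : Sk P.B β) : P.up (P.down β) (β.compl₁₂ P.j P.j) = β := by
  ext x y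
  rw [up_apply, down_spec P hβ]
  simp only [LinearMap.compl₁₂_apply]
  have := hβ (P.j (P.pU x)) (P.sec (P.pW y))
  simp only [B_apply, b_sec] at this
  have h : P.down β (P.b (P.j (P.pU x))) (P.pW y) = β (P.i (P.b (P.j (P.pU x)))) (P.sec (P.pW y)) := rfl
  rw [h, this]
  conv_rhs => rw [← P.h5 x, ← P.h5 y]
  conv_lhs => rw [← P.h5 y]
  simp [P.h1, P.h2, P.h3, P.h4]
  ring

lemma down_up {δ : Bil F W} (hδ : Sk P.BW δ) (γ : Bil F U) : P.down (P.up δ γ) = δ := by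
  ext w w'
  obtain ⟨y, rfl⟩ := P.hb w'
  rw [down_spec P (P.up_sk hδ γ), up_apply]
  simp [P.h1, P.h2]

lemma res_up (δ : Bil F W) (γ : Bil F U) : (P.up δ γ).compl₁₂ P.j P.j = γ := by
  ext u u'
  simp [up_apply, P.h3, P.h4]

lemma n_eq [Finite F] (o : Option F) :
    nF o P.B = nF (o.map (fun x => - x)) P.BW * nF o (0 : End F U) := by
  unfold nF
  rw [← Nat.card_prod]
  refine Nat.card_congr ⟨fun β => (⟨P.down β, P.down_sk β.2.1, P.down_typ β.2.1 β.2.2⟩,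
    ⟨β.1.compl₁₂ P.j P.j, fun x y => by simp, fun ε hε x y => β.2.2 ε hε _ _⟩),
    fun p => ⟨P.up p.1 p.2, P.up_sk p.1.2.1 _, P.up_typ p.1.2.1 p.1.2.2 p.2.2.2⟩, ?_, ?_⟩
  · intro β; ext1; exact P.up_down β.2.1
  · rintro ⟨⟨δ, hδ⟩, ⟨γ, hγ⟩⟩
    simp only [Prod.mk.injEq, Subtype.mk.injEq]
    exact ⟨P.down_up hδ.1 γ, P.res_up δ γ⟩

variable {U1 : Type} [AddCommGroup U1] [Module F U1]

lemma nd_iff [FiniteDimensional F W] (j1 : U1 →ₗ[F] U) (r1 : U →ₗ[F] U1) (hr : ∀ u, r1 (j1 u) = u)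
    (hk : ∀ u, P.b (P.j (j1 u)) = 0)
    (hker : ∀ x, P.b x = 0 → ∃ w u, x = P.i w + P.j (j1 u)) {β : Bil F V} (hβ : Sk P.B β) :
    ND β ↔ ND (P.down β) ∧ ND ((β.compl₁₂ P.j P.j).compl₁₂ j1 j1) := by
  have hleft : ∀ x w, β x (P.i w) = - P.down β (P.b x) w := by
    intro x w
    obtain ⟨z, rfl⟩ := P.hb w
    rw [down_spec P hβ, ← B_apply, ← B_apply, hβ x z, neg_neg]
  have hright : ∀ w y, β (P.i w) y = P.down β w (P.b y) := fun w y => (down_spec P hβ w y).symm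
  constructor
  · intro h
    have hW : ND (P.down β) := by
      intro w hw
      have : P.i w = 0 := h _ fun y => by rw [hright]; exact hw _
      rw [← P.h1 w, this, map_zero]
    refine ⟨hW, ?_⟩
    intro u hu
    simp only [LinearMap.compl₁₂_apply] at hu
    -- functional
    have hinj : Function.Injective (P.down β) := by
      rw [injective_iff_map_eq_zero]
      intro w hw
      exact hW w fun y => by rw [hw]; rfl
    have hsurj : Function.Surjective (P.down β : W →ₗ[F] (Dual F W)) := by
      apply (LinearMap.injective_iff_surjective_of_finrank_eq_finrank _).1 hinj
      exact (Subspace.dual_finrank_eq).symm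
    obtain ⟨w, hw⟩ := hsurj ((β (P.j (j1 u))) ∘ₗ P.sec)
    have hvan : ∀ y, P.b y = 0 → β (P.j (j1 u)) y = 0 := by
      intro y hy
      obtain ⟨w', u', rfl⟩ := hker y hy
      rw [map_add, hu, hleft, hk]
      simp
    have hw' : ∀ y, P.down β w (P.b y) = β (P.j (j1 u)) y := by
      intro y
      rw [hw]
      have := hvan (P.sec (P.b y) - y) (by simp [b_sec])
      rw [map_sub, sub_eq_zero] at this
      exact this
    have hBw : P.b (P.i w) = 0 := by
      apply hW
      intro w'
      obtain ⟨y, rfl⟩ := P.hb w'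
      have := P.down_sk hβ w (P.b y)
      simp only [BW_apply] at this
      rw [this, hw', hleft, hk]
      simp
    have hz : P.j (j1 u) - P.i w = 0 := by
      apply h
      intro y
      rw [map_sub, LinearMap.sub_apply, hright, hw', sub_self]
    have := congrArg P.pU hz
    rw [map_sub, P.h3, P.h2, map_zero, sub_zero] at this
    rw [← hr u, this, map_zero]
  · rintro ⟨hW, hU⟩ x hx
    have hbx : P.b x = 0 := by
      apply hW
      intro w
      have := hleft x w
      rw [hx] at this
      exact neg_eq_zero.1 this.symm
    obtain ⟨w, u, rfl⟩ := hker x hbx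
    have hu : u = 0 := by
      apply hU
      intro u'
      have := hx (P.j (j1 u'))
      rw [map_add, LinearMap.add_apply, hright, hk] at this
      simpa using this
    subst hu
    have hw : w = 0 := by
      apply hW
      intro w'
      obtain ⟨y, rfl⟩ := P.hb w'
      rw [← hright]
      simpa using hx y
    simp [hw]

/-- the additive group of forms of a type -/
def formsG (F : Type) [Field F] (U : Type) [AddCommGroup U] [Module F U] (o : Option F) : AddSubgroup (Bil F U) where
  carrier := {γ | Typ o γ}
  add_mem' := fun {a b} ha hb ε hε x y => by
    simp only [LinearMap.add_apply]; rw [ha ε hε, hb ε hε]; ring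
  zero_mem' := fun ε hε x y => by simp
  neg_mem' := fun {a} ha ε hε x y => by
    simp only [LinearMap.neg_apply]; rw [ha ε hε]; ring

lemma d_eq [Finite F] [Finite U] [Finite U1] [FiniteDimensional F W] (o : Option F)
    (j1 : U1 →ₗ[F] U) (r1 : U →ₗ[F] U1) (hr : ∀ u, r1 (j1 u) = u)
    (hk : ∀ u, P.b (P.j (j1 u)) = 0)
    (hker : ∀ x, P.b x = 0 → ∃ w u, x = P.i w + P.j (j1 u)) :
    dF o P.B * nF o (0 : End F U1) =
      dF (o.map (fun x => - x)) P.BW * (dF o (0 : End F U1) * nF o (0 : End F U)) := by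
  let f : formsG F U o →+ formsG F U1 o :=
    { toFun := fun γ => ⟨γ.1.compl₁₂ j1 j1, fun ε hε x y => γ.2 ε hε _ _⟩
      map_zero' := by ext; simp
      map_add' := fun a b => by ext; simp }
  have hf : Function.Surjective f := by
    intro γ
    refine ⟨⟨γ.1.compl₁₂ r1 r1, fun ε hε x y => γ.2 ε hε _ _⟩, ?_⟩
    ext x y
    simp [f, hr]
  have hc := card_fiber f hf {γ | ND γ.1}
  have e1 : dF o P.B = dF (o.map (fun x => - x)) P.BW * Nat.card (f ⁻¹' {γ | ND γ.1}) := by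
    unfold dF
    rw [← Nat.card_prod]
    refine Nat.card_congr ⟨fun β => (⟨P.down β, P.down_sk β.2.1, P.down_typ β.2.1 β.2.2.1,
        ((P.nd_iff j1 r1 hr hk hker β.2.1).1 β.2.2.2).1⟩,
      ⟨⟨β.1.compl₁₂ P.j P.j, fun ε hε x y => β.2.2.1 ε hε _ _⟩,
        ((P.nd_iff j1 r1 hr hk hker β.2.1).1 β.2.2.2).2⟩),
      fun p => ⟨P.up p.1 p.2.1.1, P.up_sk p.1.2.1 _, P.up_typ p.1.2.1 p.1.2.2.1 p.2.1.2, ?_⟩, ?_, ?_⟩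
    · rw [P.nd_iff j1 r1 hr hk hker (P.up_sk p.1.2.1 _), P.down_up p.1.2.1, P.res_up]
      exact ⟨p.1.2.2.2, p.2.2⟩
    · intro β; ext1; exact P.up_down β.2.1
    · rintro ⟨⟨δ, hδ⟩, ⟨⟨γ, hγ'⟩, hγ⟩⟩
      simp only [Prod.mk.injEq, Subtype.mk.injEq]
      exact ⟨P.down_up hδ.1 γ, Subtype.ext (P.res_up δ γ)⟩
  have e2 : nF o (0 : End F U1) = Nat.card (formsG F U1 o) :=
    Nat.card_congr (Equiv.subtypeEquivRight fun β => ⟨fun h => h.2, fun h => ⟨fun x y => by simp, h⟩⟩)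
  have e3 : nF o (0 : End F U) = Nat.card (formsG F U o) :=
    Nat.card_congr (Equiv.subtypeEquivRight fun β => ⟨fun h => h.2, fun h => ⟨fun x y => by simp, h⟩⟩)
  have e4 : dF o (0 : End F U1) = Nat.card ({γ : formsG F U1 o| ND γ.1} : Set _) :=
    Nat.card_congr ⟨fun β => ⟨⟨β.1, β.2.2.1⟩, β.2.2.2⟩, fun γ => ⟨γ.1.1, fun x y => by simp, γ.1.2, γ.2⟩,
      fun _ => rfl, fun _ => rfl⟩
  rw [e1, e2, e3, e4, mul_assoc, hc]

end Peel
end basic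
end SpFF


namespace SpFF
open Module

section peel
variable {F : Type} [Field F] {V : Type} [AddCommGroup V] [Module F V]

/-- restriction of `B` to its range -/
noncomputable def rB (B : End F V) : End F (LinearMap.range B) :=
  B.rangeRestrict ∘ₗ (LinearMap.range B).subtype

lemma rB_apply (B : End F V) (x : LinearMap.range B) : ((rB B x : LinearMap.range B) : V) = B x := rfl

lemma rB_pow (B : End F V) (j : ℕ) (x : LinearMap.range B) :
    (((rB B ^ j) x : LinearMap.range B) : V) = (B ^ j) x := by
  induction j generalizing x with
  | zero => simp
  | succ j ih => rw [pow_succ, pow_succ, Module.End.mul_apply, Module.End.mul_apply, ih, rB_apply]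

lemma rB_rank [FiniteDimensional F V] (B : End F V) (j : ℕ) :
    finrank F (LinearMap.range (rB B ^ j)) = finrank F (LinearMap.range (B ^ (j + 1))) := by
  have : (LinearMap.range (B ^ (j + 1))) = (LinearMap.range (rB B ^ j)).map (LinearMap.range B).subtype := by
    ext y
    simp only [LinearMap.mem_range, Submodule.mem_map]
    constructor
    · rintro ⟨x, rfl⟩
      refine ⟨_, ⟨⟨B x, x, rfl⟩, rfl⟩, ?_⟩
      simp [rB_pow, pow_succ]
    · rintro ⟨_, ⟨⟨_, x, rfl⟩, rfl⟩, rfl⟩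
      refine ⟨x, ?_⟩
      simp [rB_pow, pow_succ]
  rw [this, Submodule.finrank_map_subtype_eq]

lemma exists_peel [FiniteDimensional F V] (B : End F V) : ∃ (U U1 : Submodule F V)
    (P : Peel F V (LinearMap.range B) U) (j1 : U1 →ₗ[F] U) (r1 : U →ₗ[F] U1), P.B = B ∧ P.BW = rB B ∧
      (∀ u, r1 (j1 u) = u) ∧ (∀ u, P.b (P.j (j1 u)) = 0) ∧
      (∀ x, P.b x = 0 → ∃ w u, x = P.i w + P.j (j1 u)) ∧
      finrank F U + finrank F (LinearMap.range B) = finrank F V ∧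
      finrank F U1 + 2 * finrank F (LinearMap.range B) = finrank F V + finrank F (LinearMap.range (B ^ 2)) := by
  set W := LinearMap.range B with hW
  set K := LinearMap.ker B with hK
  obtain ⟨C, hC⟩ := Submodule.exists_isCompl ((K ⊓ W).comap K.subtype)
  set U1 : Submodule F V := C.map K.subtype with hU1
  have hU1K : U1 ≤ K := Submodule.map_subtype_le K C
  have hsup : ∀ x ∈ K, ∃ w ∈ W, ∃ u ∈ U1, x = w + u := by
    intro x hx
    have : (⟨x, hx⟩ : K) ∈ ((K ⊓ W).comap K.subtype) ⊔ C := by rw [hC.sup_eq_top]; trivial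
    obtain ⟨a, ha, c, hc, h⟩ := Submodule.mem_sup.1 this
    exact ⟨a, ha.2, c, ⟨c, hc, rfl⟩, congrArg Subtype.val h.symm⟩
  have hdis : Disjoint W U1 := by
    rw [Submodule.disjoint_def]
    rintro x hxW ⟨c, hc, rfl⟩
    have : c ∈ ((K ⊓ W).comap K.subtype) ⊓ C := ⟨⟨c.2, hxW⟩, hc⟩
    rw [hC.inf_eq_bot] at this
    rw [(Submodule.mem_bot F).1 this]; simp
  obtain ⟨U, hU, hc⟩ := hdis.symm.exists_isCompl
  have hc' : IsCompl W U := by first | exact hc | exact hc.symm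
  have hle : U1 ≤ U := hU
  obtain ⟨r1, hr1⟩ := (Submodule.inclusion hle).exists_leftInverse_of_injective
    (LinearMap.ker_eq_bot.2 (Submodule.inclusion_injective hle))
  let P : Peel F V W U :=
    { b := B.rangeRestrict
      i := W.subtype
      j := U.subtype
      pW := W.projectionOnto U hc'
      pU := U.projectionOnto W hc'.symm
      hb := B.surjective_rangeRestrict
      h1 := fun w => by simp
      h2 := fun w => by simp
      h3 := fun w => by simp
      h4 := fun w => by simp
      h5 := fun x => Submodule.projection_add_projection_eq_self hc' x }
  refine ⟨U, U1, P, Submodule.inclusion hle, r1, ?_, ?_, LinearMap.congr_fun hr1, ?_, ?_, ?_, ?_⟩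
  · ext x; rfl
  · rfl
  · intro u; ext; exact hU1K u.2
  · intro x hx
    obtain ⟨w, hw, u, hu, rfl⟩ := hsup x (congrArg Subtype.val hx)
    exact ⟨⟨w, hw⟩, ⟨u, hu⟩, rfl⟩
  · rw [add_comm]; exact Submodule.finrank_add_eq_of_isCompl hc'
  · have h1 := Submodule.finrank_add_eq_of_isCompl hC
    have h2 : finrank F U1 = finrank F C :=
      Submodule.finrank_map_subtype_eq _ _
    have h3 : finrank F W + finrank F K = finrank F V := B.finrank_range_add_finrank_ker
    have h4 : finrank F (LinearMap.range (rB B)) + finrank F (LinearMap.ker (rB B)) = finrank F W :=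
      (rB B).finrank_range_add_finrank_ker
    have h5 := rB_rank B 1
    have h6 : finrank F (((K ⊓ W).comap K.subtype)) = finrank F (LinearMap.ker (rB B)) := by
      have a : ((K ⊓ W).comap K.subtype).map K.subtype = (LinearMap.ker (rB B)).map W.subtype := by
        ext x
        simp only [Submodule.mem_map]
        constructor
        · rintro ⟨y, hy, rfl⟩
          exact ⟨⟨y, hy.2⟩, Subtype.ext y.2, rfl⟩
        · rintro ⟨y, hy, rfl⟩
          have : B y = 0 := congrArg Subtype.val hy
          exact ⟨⟨y, this⟩, ⟨this, y.2⟩, rfl⟩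
      have b := congrArg (fun S : Submodule F V => finrank F S) a
      rwa [Submodule.finrank_map_subtype_eq, Submodule.finrank_map_subtype_eq] at b
    rw [pow_one] at h5
    simp only [Nat.reduceAdd] at h5
    change finrank F U1 + 2 * finrank F W = _
    omega

abbrev ngo (o : Option F) : Option F := o.map (fun x => - x)

/-- rank of a power -/
noncomputable def rk (B : End F V) (j : ℕ) : ℕ := finrank F (LinearMap.range (B ^ j))

lemma rk_zero [FiniteDimensional F V] (B : End F V) : rk B 0 = finrank F V := by
  unfold rk; rw [pow_zero, Module.End.one_eq_id, LinearMap.range_id, finrank_top]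
lemma rk_one (B : End F V) : rk B 1 = finrank F (LinearMap.range B) := by
  unfold rk; rw [pow_one]
lemma rk_rB [FiniteDimensional F V] (B : End F V) (j : ℕ) : rk (rB B) j = rk B (j + 1) := rB_rank B j

lemma peel_n [Finite F] [FiniteDimensional F V] (o : Option F) (B : End F V) :
    nF o B = nF (ngo o) (rB B) * NN F o (rk B 0 - rk B 1) := by
  obtain ⟨U, U1, P, j1, r1, h1, h2, h3, h4, h5, h6, h7⟩ := exists_peel B
  have := P.n_eq o
  rw [h1, h2, nF_zero] at this
  rw [this]; congr 2
  rw [rk_zero, rk_one]; omega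

lemma peel_d [Finite F] [FiniteDimensional F V] (o : Option F) (B : End F V) :
    dF o B * NN F o (rk B 0 + rk B 2 - 2 * rk B 1) = dF (ngo o) (rB B) *
      (DD F o (rk B 0 + rk B 2 - 2 * rk B 1) * NN F o (rk B 0 - rk B 1)) := by
  obtain ⟨U, U1, P, j1, r1, h1, h2, h3, h4, h5, h6, h7⟩ := exists_peel B
  have : Finite V := Module.finite_of_finite F
  have := P.d_eq o j1 r1 h3 h4 h5
  rw [h1, h2, nF_zero, nF_zero, dF_zero] at this
  have a : finrank F U1 = rk B 0 + rk B 2 - 2 * rk B 1 := by rw [rk_zero, rk_one, rk]; omega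
  have b : finrank F U = rk B 0 - rk B 1 := by rw [rk_zero, rk_one]; omega
  rwa [a, b] at this

end peel
end SpFF


namespace SpFF
open Module

section forms

lemma card_orbit {G P X : Type} (act : G → P → P) (Φ : P → X)
    (hinj : ∀ p, Function.Injective (fun g => act g p))
    (hΦ : ∀ p p', Φ p = Φ p' ↔ ∃ g, act g p = p') :
    Nat.card P = Nat.card G * Nat.card (Set.range Φ) := by
  rw [mul_comm, ← Nat.card_prod]
  choose p0 hp0 using (fun x : Set.range Φ => x.2)
  symm
  refine Nat.card_congr (Equiv.ofBijective (fun x : Set.range Φ × G => act x.2 (p0 x.1)) ⟨?_, ?_⟩)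
  · rintro ⟨x, g⟩ ⟨x', g'⟩ h
    simp only at h
    have h1 : Φ (p0 x) = Φ (act g (p0 x)) := (hΦ _ _).2 ⟨g, rfl⟩
    have h2 : Φ (p0 x') = Φ (act g' (p0 x')) := (hΦ _ _).2 ⟨g', rfl⟩
    have : x = x' := by
      apply Subtype.ext
      rw [← hp0 x, ← hp0 x', h1, h2, h]
    subst this
    rw [hinj _ h]
  · intro p
    obtain ⟨g, hg⟩ := (hΦ (p0 ⟨Φ p, p, rfl⟩) p).1 (hp0 ⟨Φ p, p, rfl⟩)
    exact ⟨(⟨Φ p, p, rfl⟩, g), hg⟩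

variable {F : Type} [Field F] {V : Type} [AddCommGroup V] [Module F V]

lemma pi_surj_iff [FiniteDimensional F V] {k : ℕ} (s : Fin k → Dual F V) :
    Function.Surjective (LinearMap.pi s) ↔ LinearIndependent F s := by
  rw [← LinearMap.dualMap_injective_iff, Fintype.linearIndependent_iff, injective_iff_map_eq_zero]
  constructor
  · intro h g hg
    have := h (∑ i, g i • LinearMap.proj i) (by
      ext x
      have := LinearMap.congr_fun hg x
      simpa using this)
    intro i
    have := LinearMap.congr_fun this (Pi.single i 1)
    simpa [Pi.single_apply] using this
  · intro h f hf
    have key : ∀ x : Fin k → F, f x = ∑ i, f (Pi.single i 1) * x i := by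
      intro x
      conv_lhs => rw [← Finset.univ_sum_single x]
      rw [map_sum]
      refine Finset.sum_congr rfl fun i _ => ?_
      have : (Pi.single i (x i) : Fin k → F) = x i • Pi.single i 1 := by
        rw [← Pi.single_smul]; simp
      rw [this, map_smul, smul_eq_mul, mul_comm]
    have := h (fun i => f (Pi.single i 1)) (by
      ext x
      have := LinearMap.congr_fun hf x
      simp only [LinearMap.dualMap_apply, LinearMap.zero_apply] at this
      rw [key] at this
      simpa using this)
    ext i
    simpa using this i

/-- the number `∏_{i<k} (q^m - q^i)` -/
def surjN (q m k : ℕ) : ℕ := ∏ i ∈ Finset.range k, (q ^ m - q ^ i)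

lemma card_surj [Fintype F] [FiniteDimensional F V] {k : ℕ} (hk : k ≤ finrank F V) :
    Nat.card {π : V →ₗ[F] (Fin k → F) // Function.Surjective π} =
      surjN (Fintype.card F) (finrank F V) k := by
  have : Finite V := Module.finite_of_finite F
  have : Finite (Dual F V) := Module.finite_of_finite F
  have h := card_linearIndependent (K := F) (V := Dual F V) (k := k)
    (by rw [Subspace.dual_finrank_eq]; exact hk)
  rw [Subspace.dual_finrank_eq] at h
  rw [surjN, ← Fin.prod_univ_eq_prod_range (fun i => Fintype.card F ^ finrank F V - Fintype.card F ^ i), ← h]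
  symm
  refine Nat.card_congr (Equiv.subtypeEquiv (⟨fun s => LinearMap.pi s, fun f i => LinearMap.proj i ∘ₗ f,
    fun _ => rfl, fun _ => rfl⟩ : (Fin k → Dual F V) ≃ (V →ₗ[F] (Fin k → F))) ?_)
  intro s
  exact (pi_surj_iff s).symm

/-- order of the general linear group -/
noncomputable def glc (F : Type) [Field F] (V : Type) [AddCommGroup V] [Module F V] : ℕ :=
  Nat.card (V ≃ₗ[F] V)

lemma glc_congr {W : Type} [AddCommGroup W] [Module F W] (e : V ≃ₗ[F] W) : glc F V = glc F W :=
  Nat.card_congr ⟨fun f => e.symm.trans (f.trans e), fun f => e.trans (f.trans e.symm),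
    fun f => by ext; simp, fun f => by ext; simp⟩

lemma card_equiv_eq {W : Type} [AddCommGroup W] [Module F W] (e : V ≃ₗ[F] W) :
    Nat.card (V ≃ₗ[F] W) = glc F V :=
  Nat.card_congr ⟨fun f => f.trans e.symm, fun f => f.trans e, fun f => by ext; simp, fun f => by ext; simp⟩

lemma glc_eq [Fintype F] [FiniteDimensional F V] :
    glc F V = surjN (Fintype.card F) (finrank F V) (finrank F V) := by
  rw [← card_surj le_rfl, ← card_equiv_eq (finBasis F V).equivFun]
  refine Nat.card_congr ⟨fun f => ⟨f.toLinearMap, f.surjective⟩, fun f => LinearEquiv.ofBijective f.1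
    ⟨(LinearMap.injective_iff_surjective_of_finrank_eq_finrank (by simp)).2 f.2, f.2⟩, ?_, ?_⟩
  · intro f; ext; rfl
  · intro f; ext; rfl

lemma glc_pos [Fintype F] [FiniteDimensional F V] : 0 < glc F V := by
  have : Finite V := Module.finite_of_finite F
  have : Finite (V ≃ₗ[F] V) := Finite.of_injective (fun e : V ≃ₗ[F] V => (e : V → V)) DFunLike.coe_injective
  have : Nonempty (V ≃ₗ[F] V) := ⟨LinearEquiv.refl F V⟩
  exact Nat.card_pos

lemma typ_none (β : Bil F V) : Typ none β := fun ε h => by simp at h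

lemma sk_zero (β : Bil F V) : Sk 0 β := fun x y => by simp

lemma nd_inj (β : Bil F V) : ND β ↔ Function.Injective β := by
  rw [injective_iff_map_eq_zero]
  exact forall_congr' fun x => ⟨fun h hx => h fun y => by rw [hx]; rfl,
    fun h hx => h (by ext y; exact hx y)⟩

lemma DD_none [Fintype F] (m : ℕ) : DD F none m = surjN (Fintype.card F) m m := by
  have h1 := glc_eq (F := F) (V := Fin m → F)
  rw [finrank_fin_fun] at h1
  have e : (Fin m → F) ≃ₗ[F] Dual F (Fin m → F) := LinearEquiv.ofFinrankEq _ _ (by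
    rw [Subspace.dual_finrank_eq])
  rw [← h1, ← card_equiv_eq e]
  refine Nat.card_congr ⟨fun f => LinearEquiv.ofBijective f.1
    ⟨(nd_inj _).1 f.2.2.2, (LinearMap.injective_iff_surjective_of_finrank_eq_finrank (by
      rw [Subspace.dual_finrank_eq])).1 ((nd_inj _).1 f.2.2.2)⟩,
    fun f => ⟨f.toLinearMap, sk_zero _, typ_none _, (nd_inj _).2 f.injective⟩, ?_, ?_⟩
  · intro f; rfl
  · intro f; ext; rfl

lemma NN_eq (o : Option F) (m : ℕ) : NN F o m = Nat.card {β : Bil F (Fin m → F) // Typ o β} :=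
  Nat.card_congr (Equiv.subtypeEquivRight fun β => ⟨fun h => h.2, fun h => ⟨sk_zero _, h⟩⟩)

lemma NN_none [Fintype F] (m : ℕ) : NN F none m = Fintype.card F ^ (m ^ 2) := by
  rw [NN_eq, Nat.card_congr (Equiv.subtypeUnivEquiv (fun β => typ_none β))]
  have : Finite (Bil F (Fin m → F)) := bil_finite
  rw [Module.natCard_eq_pow_finrank (K := F), Nat.card_eq_fintype_card]
  congr 1
  rw [finrank_linearMap, finrank_linearMap]; simp [sq]

lemma NN_one [Fintype F] (m : ℕ) : NN F (some 1) m = Fintype.card F ^ ((m + 1).choose 2) := by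
  have : Nat.card (Sym2 (Fin m) → F) = Fintype.card F ^ ((m + 1).choose 2) := by
    rw [Nat.card_fun, Nat.card_eq_fintype_card, Nat.card_eq_fintype_card, Sym2.card, Fintype.card_fin]
  rw [NN_eq, ← this]
  have tb : ∀ β : Bil F (Fin m → F), Typ (some 1) β ↔ ∀ x y, β y x = β x y := fun β => by simp [Typ]
  refine Nat.card_congr ⟨fun β => Sym2.lift ⟨fun i j => β.1 (Pi.single i 1) (Pi.single j 1),
    fun i j => ((tb _).1 β.2 _ _)⟩, fun f => ⟨Matrix.toLinearMap₂' F (Matrix.of fun i j => f s(i, j)), ?_⟩, ?_, ?_⟩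
  · rw [tb]
    intro x y
    simp only [Matrix.toLinearMap₂'_apply]
    rw [Finset.sum_comm]
    refine Finset.sum_congr rfl fun i _ => Finset.sum_congr rfl fun j _ => ?_
    simp only [Matrix.of_apply, Sym2.eq_swap (a := j), smul_eq_mul, RingHom.id_apply]; ring
  · rintro ⟨β, h⟩
    ext1
    apply (LinearMap.toMatrix₂' F).injective
    ext i j
    rw [LinearMap.toMatrix₂'_apply, LinearMap.toMatrix₂'_apply]; simp [Matrix.toLinearMap₂'_apply, Pi.single_apply]
  · intro f
    ext z
    induction z with
    | _ i j => simp [Matrix.toLinearMap₂'_apply, Pi.single_apply]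

lemma NN_mul [Fintype F] (h2 : (2 : F) ≠ 0) (m : ℕ) :
    NN F (some 1) m * NN F (some (-1)) m = NN F none m := by
  simp only [NN_eq]
  rw [← Nat.card_prod]
  have t1 : ∀ β : Bil F (Fin m → F), Typ (some 1) β ↔ ∀ x y, β y x = β x y := fun β => by simp [Typ]
  have t2 : ∀ β : Bil F (Fin m → F), Typ (some (-1)) β ↔ ∀ x y, β y x = - β x y := fun β => by simp [Typ]
  refine Nat.card_congr ⟨fun p => ⟨p.1.1 + p.2.1, typ_none _⟩,
    fun β => (⟨(2⁻¹ : F) • (β.1 + β.1.flip), ?_⟩, ⟨(2⁻¹ : F) • (β.1 - β.1.flip), ?_⟩), ?_, ?_⟩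
  · rw [t1]; intro x y; simp [add_comm]
  · rw [t2]; intro x y; simp only [LinearMap.smul_apply, LinearMap.sub_apply, LinearMap.flip_apply, smul_eq_mul]; ring
  · rintro ⟨⟨β, hβ⟩, ⟨γ, hγ⟩⟩
    rw [t1] at hβ; rw [t2] at hγ
    simp only [Prod.mk.injEq, Subtype.mk.injEq]
    constructor
    · refine LinearMap.ext fun x => LinearMap.ext fun y => ?_
      simp only [LinearMap.smul_apply, LinearMap.add_apply, LinearMap.flip_apply, smul_eq_mul, hβ x y, hγ x y]
      field_simp; ring
    · refine LinearMap.ext fun x => LinearMap.ext fun y => ?_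
      simp only [LinearMap.smul_apply, LinearMap.sub_apply, LinearMap.add_apply, LinearMap.flip_apply, smul_eq_mul, hβ x y, hγ x y]
      field_simp; ring
  · rintro ⟨β, hβ⟩
    simp only [Subtype.mk.injEq]
    refine LinearMap.ext fun x => LinearMap.ext fun y => ?_
    simp only [LinearMap.smul_apply, LinearMap.sub_apply, LinearMap.add_apply, LinearMap.flip_apply, smul_eq_mul]
    field_simp; ring

lemma NN_neg [Fintype F] (h2 : (2 : F) ≠ 0) (m : ℕ) :
    NN F (some (-1)) m = Fintype.card F ^ (m.choose 2) := by
  have h := NN_mul h2 m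
  rw [NN_one, NN_none] at h
  have e : m ^ 2 = (m + 1).choose 2 + m.choose 2 := by
    have h3 : (m + 1).choose 2 = m.choose 1 + m.choose 2 := Nat.choose_succ_succ m 1
    have h4 : ∀ m : ℕ, m ^ 2 = m + 2 * m.choose 2 := by
      intro m
      induction m with
      | zero => rfl
      | succ m ih =>
        have : (m + 1).choose 2 = m.choose 1 + m.choose 2 := Nat.choose_succ_succ m 1
        rw [this, Nat.choose_one_right]; nlinarith
    rw [h3, Nat.choose_one_right, h4]; ring
  rw [e, pow_add] at h
  exact Nat.eq_of_mul_eq_mul_left (pow_pos Fintype.card_pos _) h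

end forms
end SpFF


namespace SpFF
open Module

section rad
variable {F : Type} [Field F] {V : Type} [AddCommGroup V] [Module F V]

lemma card_rank [Fintype F] [FiniteDimensional F V] (ε : F) (k : ℕ) (hk : k ≤ finrank F V) :
    surjN (Fintype.card F) (finrank F V) k * DD F (some ε) k =
      surjN (Fintype.card F) k k *
        Nat.card {β : Bil F V // Typ (some ε) β ∧ finrank F (LinearMap.range β) = k} := by
  have hg := glc_eq (F := F) (V := Fin k → F)
  rw [finrank_fin_fun] at hg
  rw [← card_surj hk, ← hg, DD, dF, glc, ← Nat.card_prod]
  let Φ : ({π : V →ₗ[F] (Fin k → F) // Function.Surjective π} ×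
    {β : Bil F (Fin k → F) // Sk 0 β ∧ Typ (some ε) β ∧ ND β}) → Bil F V :=
    fun p => p.2.1.compl₁₂ p.1.1 p.1.1
  have hΦa : ∀ p x y, Φ p x y = p.2.1 (p.1.1 x) (p.1.1 y) := fun p x y => rfl
  have hker : ∀ p x, (∀ y, Φ p x y = 0) ↔ p.1.1 x = 0 := by
    intro p x
    constructor
    · intro h
      apply p.2.2.2.2
      intro z
      obtain ⟨y, rfl⟩ := p.1.2 z
      exact h y
    · intro h y
      rw [hΦa, h]; simp
  rw [card_orbit (G := (Fin k → F) ≃ₗ[F] (Fin k → F))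
    (fun g p => (⟨g.toLinearMap ∘ₗ p.1.1, g.surjective.comp p.1.2⟩,
      ⟨pb g.symm p.2.1, sk_zero _, (pb_typ _ _ _).2 p.2.2.2.1, (pb_nd _ _).2 p.2.2.2.2⟩)) Φ ?_ ?_]
  · congr 1
    have hset : Set.range Φ = {β : Bil F V | Typ (some ε) β ∧ finrank F (LinearMap.range β) = k} := by
      ext β
      constructor
      · rintro ⟨p, rfl⟩
        refine ⟨fun e he x y => p.2.2.2.1 e he _ _, ?_⟩
        have h1 : LinearMap.ker (Φ p) = LinearMap.ker p.1.1 := by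
          ext x
          rw [LinearMap.mem_ker, LinearMap.mem_ker, ← hker]
          exact ⟨fun h y => by rw [h]; rfl, fun h => LinearMap.ext h⟩
        have h2 := (Φ p).finrank_range_add_finrank_ker
        have h3 := p.1.1.finrank_range_add_finrank_ker
        rw [LinearMap.range_eq_top.2 p.1.2, finrank_top, finrank_fin_fun] at h3
        rw [h1] at h2
        omega
      · rintro ⟨ht, hr⟩
        have hq := (LinearMap.ker β).finrank_quotient_add_finrank
        have hq2 := β.finrank_range_add_finrank_ker
        let e : (V ⧸ LinearMap.ker β) ≃ₗ[F] (Fin k → F) := LinearEquiv.ofFinrankEq _ _ (by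
          rw [finrank_fin_fun]; omega)
        let π : V →ₗ[F] (Fin k → F) := e.toLinearMap ∘ₗ (LinearMap.ker β).mkQ
        have hπ : Function.Surjective π := e.surjective.comp (Submodule.mkQ_surjective _)
        have hπk : ∀ x, π x = 0 ↔ β x = 0 := by
          intro x
          simp [π]
        obtain ⟨s, hs⟩ := π.exists_rightInverse_of_surjective (LinearMap.range_eq_top.2 hπ)
        have hs' : ∀ z, π (s z) = z := LinearMap.congr_fun hs
        have hk1 : ∀ x, π x = 0 → ∀ y, β x y = 0 := by
          intro x hx y
          rw [(hπk x).1 hx]; rfl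
        have hk2 : ∀ x, π x = 0 → ∀ y, β y x = 0 := by
          intro x hx y
          rw [ht ε rfl x y, hk1 x hx, mul_zero]
        have hd : ∀ x y, β (s (π x)) (s (π y)) = β x y := by
          intro x y
          have a := hk1 (s (π x) - x) (by rw [map_sub, hs', sub_self]) (s (π y))
          have b := hk2 (s (π y) - y) (by rw [map_sub, hs', sub_self]) x
          rw [map_sub, LinearMap.sub_apply, sub_eq_zero] at a
          rw [map_sub, sub_eq_zero] at b
          rw [a, b]
        refine ⟨(⟨π, hπ⟩, ⟨β.compl₁₂ s s, sk_zero _, fun e he x y => ht e he _ _, ?_⟩), ?_⟩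
        · intro z hz
          have h0 : β (s z) = 0 := by
            ext y
            have := hz (π y)
            simp only [LinearMap.compl₁₂_apply] at this
            rw [← hd, hs']
            exact this
          rw [← hs' z]
          exact (hπk _).2 h0
        · ext x y
          exact hd x y
    rw [hset]; rfl
  · intro p g g' h
    have h1 := congrArg (fun x => x.1.1) h
    simp only at h1
    ext1 z
    obtain ⟨x, rfl⟩ := p.1.2 z
    exact LinearMap.congr_fun h1 x
  · intro p p'
    constructor
    · intro h
      obtain ⟨s, hs⟩ := p.1.1.exists_rightInverse_of_surjective (LinearMap.range_eq_top.2 p.1.2)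
      have hs' : ∀ z, p.1.1 (s z) = z := LinearMap.congr_fun hs
      have hkk : ∀ x, p.1.1 x = 0 ↔ p'.1.1 x = 0 := fun x => by rw [← hker, ← hker, h]
      let g0 : (Fin k → F) →ₗ[F] (Fin k → F) := p'.1.1 ∘ₗ s
      have hg0 : Function.Injective g0 := by
        rw [injective_iff_map_eq_zero]
        intro z hz
        have := (hkk (s z)).2 hz
        rwa [hs'] at this
      let g := LinearEquiv.ofInjectiveEndo g0 hg0
      have hgp : ∀ x, g (p.1.1 x) = p'.1.1 x := by
        intro x
        have := (hkk (s (p.1.1 x) - x)).1 (by rw [map_sub, hs', sub_self])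
        rw [map_sub, sub_eq_zero] at this
        exact this
      refine ⟨g, ?_⟩
      refine Prod.ext (Subtype.ext (LinearMap.ext hgp)) (Subtype.ext ?_)
      refine LinearMap.ext fun z => LinearMap.ext fun w => ?_
      obtain ⟨x, rfl⟩ := p'.1.2 z
      obtain ⟨y, rfl⟩ := p'.1.2 w
      rw [← hΦa, ← h, hΦa]
      simp only [pb_apply]
      rw [← hgp, ← hgp, g.symm_apply_apply, g.symm_apply_apply]
    · rintro ⟨g, rfl⟩
      ext x y
      simp [hΦa]

lemma surjN_pos {q m k : ℕ} (hq : 1 < q) (hk : k ≤ m) : 0 < surjN q m k := by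
  refine Finset.prod_pos fun i hi => ?_
  have : i < m := (Finset.mem_range.1 hi).trans_le hk
  exact Nat.sub_pos_of_lt (Nat.pow_lt_pow_right hq this)

lemma NN_rec [Fintype F] (ε : F) (m : ℕ) :
    (NN F (some ε) m : ℝ) = ∑ k ∈ Finset.range (m + 1),
      (surjN (Fintype.card F) m k : ℝ) * DD F (some ε) k / surjN (Fintype.card F) k k := by
  classical
  rw [NN_eq]
  have : Fintype {β : Bil F (Fin m → F) // Typ (some ε) β} := Fintype.ofFinite _
  rw [Nat.card_eq_fintype_card, ← Finset.card_univ, Finset.card_eq_sum_card_fiberwise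
    (f := fun β : {β : Bil F (Fin m → F) // Typ (some ε) β} => finrank F (LinearMap.range β.1)) (t := Finset.range (m + 1))]
  · push_cast
    refine Finset.sum_congr rfl fun k hk => ?_
    have hk : k ≤ m := by simpa [Nat.lt_succ_iff] using hk
    have h := card_rank (F := F) (V := Fin m → F) ε k (by simpa using hk)
    rw [finrank_fin_fun] at h
    have hp := surjN_pos (Fintype.one_lt_card (α := F)) (le_refl k)
    rw [eq_div_iff (by positivity), mul_comm]
    have h' := congrArg (fun n : ℕ => (n : ℝ)) h
    push_cast at h'
    rw [h']
    congr 2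
    rw [← Fintype.card_subtype, ← Nat.card_eq_fintype_card]
    exact Nat.card_congr (Equiv.subtypeSubtypeEquivSubtypeInter (fun β => Typ (some ε) β)
      (fun β : Bil F (Fin m → F) => finrank F (LinearMap.range β) = k))
  · intro β _
    simp only [Finset.coe_range, Set.mem_Iio, Nat.lt_succ_iff]
    have := β.1.finrank_range_le
    simpa using this

end rad
end SpFF


namespace SpFF
open Module PowerSeries

section ser

/-- `|GL_m(q)|` as a real number -/
noncomputable def Gl (q m : ℕ) : ℝ := surjN q m m

lemma Gl_pos {q : ℕ} (hq : 1 < q) (m : ℕ) : 0 < Gl q m := by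
  unfold Gl; exact_mod_cast surjN_pos hq le_rfl

lemma surjN_cast {q m k : ℕ} (hq : 1 < q) (hk : k ≤ m) :
    (surjN q m k : ℝ) = ∏ i ∈ Finset.range k, ((q : ℝ) ^ m - (q : ℝ) ^ i) := by
  unfold surjN
  push_cast
  refine Finset.prod_congr rfl fun i hi => ?_
  have : i < m := (Finset.mem_range.1 hi).trans_le hk
  rw [Nat.cast_sub (Nat.pow_le_pow_right (by omega) this.le)]; push_cast; rfl

lemma Gl_split {q : ℕ} (hq : 1 < q) (k l : ℕ) :
    Gl q (k + l) = surjN q (k + l) k * ((q : ℝ) ^ (k * l) * Gl q l) := by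
  rw [Gl, Gl, surjN_cast hq le_rfl, surjN_cast hq le_rfl, surjN_cast hq (by omega), Finset.prod_range_add]
  congr 1
  have : (q : ℝ) ^ (k * l) = ∏ _i ∈ Finset.range l, (q : ℝ) ^ k := by simp [pow_mul]
  rw [this, ← Finset.prod_mul_distrib]
  refine Finset.prod_congr rfl fun i _ => ?_
  rw [pow_add, pow_add]; ring

/-- `∏_{j=1}^l (q^j-1)` -/
noncomputable def qf (q l : ℕ) : ℝ := ∏ j ∈ Finset.range l, ((q : ℝ) ^ (j + 1) - 1)

lemma qf_pos {q : ℕ} (hq : 1 < q) (l : ℕ) : 0 < qf q l :=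
  Finset.prod_pos fun i _ => by
    have : (1 : ℝ) < q := by exact_mod_cast hq
    have := one_lt_pow₀ this (Nat.succ_ne_zero i)
    simp only [Nat.succ_eq_add_one] at this
    linarith

lemma Gl_eq {q : ℕ} (hq : 1 < q) (l : ℕ) : Gl q l = (q : ℝ) ^ (l.choose 2) * qf q l := by
  induction l with
  | zero => simp [Gl, qf, surjN]
  | succ l ih =>
    have h := Gl_split hq 1 l
    rw [add_comm] at h
    have h2 : (l + 1).choose 2 = l.choose 1 + l.choose 2 := Nat.choose_succ_succ l 1
    have h3 : qf q (l + 1) = qf q l * ((q : ℝ) ^ (l + 1) - 1) := Finset.prod_range_succ _ _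
    rw [h, ih, surjN_cast hq (by omega), h2, h3, Nat.choose_one_right]
    simp [pow_add]; ring

variable {F : Type} [Field F] [Fintype F]


noncomputable def fg (F : Type) [Field F] [Fintype F] : ℝ⟦X⟧ := PowerSeries.mk fun m => ((Fintype.card F) : ℝ) ^ (m ^ 2) / Gl (Fintype.card F) m
noncomputable def fs (F : Type) [Field F] [Fintype F] : ℝ⟦X⟧ :=
  PowerSeries.mk fun m => (DD F (some 1) m : ℝ) * NN F (some (-1)) m / Gl (Fintype.card F) m
noncomputable def fa (F : Type) [Field F] [Fintype F] : ℝ⟦X⟧ :=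
  PowerSeries.mk fun m => (DD F (some (-1)) m : ℝ) * NN F (some 1) m / Gl (Fintype.card F) m

lemma ch_add (k l : ℕ) : (k + l).choose 2 = k.choose 2 + l.choose 2 + k * l := by
  induction k with
  | zero => simp
  | succ k ih =>
    have h1 : (k + l + 1).choose 2 = (k + l).choose 1 + (k + l).choose 2 := Nat.choose_succ_succ _ 1
    have h2 : (k + 1).choose 2 = k.choose 1 + k.choose 2 := Nat.choose_succ_succ _ 1
    rw [show k + 1 + l = k + l + 1 by ring, h1, h2, ih, Nat.choose_one_right, Nat.choose_one_right]; ring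

lemma ch_succ (k : ℕ) : (k + 1).choose 2 = k + k.choose 2 := by
  have h2 : (k + 1).choose 2 = k.choose 1 + k.choose 2 := Nat.choose_succ_succ _ 1
  rw [h2, Nat.choose_one_right]

lemma fg_eq (ε : F) (c : ℕ → ℕ) (hc : ∀ k l, c (k + l) = c k + c l + k * l)
    (hN : ∀ m, NN F (some ε) m * (Fintype.card F) ^ c m = (Fintype.card F) ^ (m ^ 2)) :
    fg F = PowerSeries.mk (fun m => (DD F (some ε) m : ℝ) * ((Fintype.card F) : ℝ) ^ c m / Gl (Fintype.card F) m) *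
      PowerSeries.mk (fun l => ((Fintype.card F) : ℝ) ^ c l / Gl (Fintype.card F) l) := by
  have hq : 1 < (Fintype.card F) := Fintype.one_lt_card
  have hq0 : (0 : ℝ) < (Fintype.card F) := by exact_mod_cast (by omega : 0 < (Fintype.card F))
  ext m
  rw [coeff_mul, fg, coeff_mk]
  have h := hN m
  have h' : (NN F (some ε) m : ℝ) * ((Fintype.card F) : ℝ) ^ c m = ((Fintype.card F) : ℝ) ^ (m ^ 2) := by exact_mod_cast h
  rw [← h', NN_rec, Finset.sum_mul, Finset.sum_div, Finset.Nat.sum_antidiagonal_eq_sum_range_succ_mk]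
  refine Finset.sum_congr rfl fun k hk => ?_
  have hk : k ≤ m := by simpa [Nat.lt_succ_iff] using hk
  obtain ⟨l, rfl⟩ := Nat.exists_eq_add_of_le hk
  simp only [coeff_mk, Nat.add_sub_cancel_left]
  have e1 := Gl_pos hq k
  have e2 := Gl_pos hq l
  have e3 := surjN_pos hq hk
  have e3' : (0 : ℝ) < surjN (Fintype.card F) (k + l) k := by exact_mod_cast e3
  change _ * _ / Gl (Fintype.card F) k * _ / _ = _
  rw [Gl_split hq k l, hc, pow_add, pow_add]
  field_simp

noncomputable def Es (F : Type) [Field F] [Fintype F] : ℝ⟦X⟧ := PowerSeries.mk fun l => 1 / qf (Fintype.card F) l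

lemma char_ne {F : Type} [Field F] [Fintype F] (hodd : Odd (Fintype.card F)) : (2 : F) ≠ 0 := by
  intro h
  have : ringChar F = 2 := by
    have h2 : ((2 : ℕ) : F) = 0 := by exact_mod_cast h
    have := (ringChar.spec F 2).1 h2
    rcases (Nat.dvd_prime Nat.prime_two).1 this with h1 | h1
    · exact absurd h1 (CharP.ringChar_ne_one)
    · exact h1
  exact (Nat.not_even_iff_odd.2 hodd) (FiniteField.even_card_of_char_two this |> Nat.even_iff.2)

lemma fg_s (h2 : (2 : F) ≠ 0) : fg F = fs F * Es F := by
  have hq : 1 < (Fintype.card F) := Fintype.one_lt_card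
  rw [fg_eq (1 : F) (fun m => m.choose 2) ch_add]
  · congr 1
    · ext m; simp only [fs, coeff_mk, NN_neg h2]; push_cast; rfl
    · ext m; simp only [Es, coeff_mk]; rw [Gl_eq hq]
      have : (0:ℝ) < ((Fintype.card F) : ℝ) ^ (m.choose 2) := by positivity
      have := qf_pos hq m
      field_simp
  · intro m
    rw [← NN_neg h2, NN_mul h2, NN_none]

lemma fg_a (h2 : (2 : F) ≠ 0) : fg F = fa F * rescale ((Fintype.card F) : ℝ) (Es F) := by
  have hq : 1 < (Fintype.card F) := Fintype.one_lt_card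
  rw [fg_eq (-1 : F) (fun m => (m + 1).choose 2)]
  · congr 1
    · ext m; simp only [fa, coeff_mk, NN_one]; push_cast; rfl
    · ext m; simp only [Es, coeff_mk, coeff_rescale]; rw [Gl_eq hq, ch_succ, pow_add]
      have : (0:ℝ) < ((Fintype.card F) : ℝ) ^ (m.choose 2) := by positivity
      have := qf_pos hq m
      field_simp
  · intro k l
    rw [show k + l + 1 = k + (l + 1) by ring, ch_add, ch_succ k]; ring
  · intro m
    rw [← NN_one, mul_comm, NN_mul h2, NN_none]

lemma Es_rescale : rescale ((Fintype.card F) : ℝ) (Es F) = (1 + X) * Es F := by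
  have hq : 1 < (Fintype.card F) := Fintype.one_lt_card
  ext m
  rw [add_mul, one_mul, map_add]
  cases m with
  | zero => simp
  | succ m =>
    rw [coeff_succ_X_mul, coeff_rescale]
    simp only [Es, coeff_mk]
    have h1 := qf_pos hq m
    have h2 := qf_pos hq (m + 1)
    rw [qf, Finset.prod_range_succ] at h2 ⊢
    change 0 < qf (Fintype.card F) m * _ at h2
    change _ * (1 / (qf (Fintype.card F) m * _)) = 1 / (qf (Fintype.card F) m * _) + _
    have h3 : ((Fintype.card F) : ℝ) ^ (m + 1) - 1 ≠ 0 := fun h => by rw [h] at h2; simp at h2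
    field_simp
    ring

lemma Es_ne : Es F ≠ 0 := by
  intro h
  have := congrArg (coeff 0) h
  simp [Es, qf] at this

lemma fs_eq (h2 : (2 : F) ≠ 0) : fs F = (1 + X) * fa F := by
  have h := fg_s h2
  rw [fg_a h2, Es_rescale] at h
  apply mul_right_cancel₀ Es_ne (b := Es F)
  rw [← h]; ring

/-- the series `h` -/
noncomputable def hc (r k : ℕ) : ℝ := 1 / ∏ j ∈ Finset.range k, (1 - ((r : ℝ)⁻¹) ^ (2 * (j + 1)))
noncomputable def hs (r : ℕ) : ℝ⟦X⟧ := PowerSeries.mk (hc r)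

lemma p_pow {r : ℕ} (hr : 1 < r) (n : ℕ) : ((r : ℝ)⁻¹) ^ (n + 1) < 1 := by
  have : (1 : ℝ) < r := by exact_mod_cast hr
  exact pow_lt_one₀ (by positivity) (inv_lt_one_of_one_lt₀ this) (by omega)

lemma hc_succ {r : ℕ} (hr : 1 < r) (k : ℕ) : hc r (k + 1) * (1 - ((r : ℝ)⁻¹) ^ (2 * (k + 1))) = hc r k := by
  have h : (1 - ((r : ℝ)⁻¹) ^ (2 * (k + 1))) ≠ 0 := by
    have := p_pow hr (2 * k + 1)
    rw [show 2 * (k + 1) = 2 * k + 1 + 1 by ring]; linarith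
  rw [hc, hc, Finset.prod_range_succ, one_div, one_div, mul_inv, mul_assoc, inv_mul_cancel₀ h, mul_one]

lemma hc_pos {r : ℕ} (hr : 1 < r) (k : ℕ) : 0 < hc r k := by
  unfold hc
  refine one_div_pos.2 (Finset.prod_pos fun j _ => ?_)
  have := p_pow hr (2 * j + 1)
  rw [show 2 * (j + 1) = 2 * j + 1 + 1 by ring]; linarith

lemma hs_fun {r : ℕ} (hr : 1 < r) : (1 - X) * hs r = rescale (((r : ℝ)⁻¹) ^ 2) (hs r) := by
  ext m
  rw [sub_mul, one_mul, map_sub, coeff_rescale]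
  cases m with
  | zero => simp
  | succ m =>
    rw [coeff_succ_X_mul]
    simp only [hs, coeff_mk]
    rw [← hc_succ hr m, ← pow_mul]; ring

lemma uniq {a : ℝ} (ha : ∀ n : ℕ, a ^ (n + 1) ≠ 1) {A B : ℝ⟦X⟧}
    (hA : (1 - X) * A = rescale a A) (hB : (1 - X) * B = rescale a B)
    (h0 : coeff 0 A = coeff 0 B) : A = B := by
  ext m
  induction m with
  | zero => exact h0
  | succ m ih =>
    have a1 := congrArg (coeff (m + 1)) hA
    have b1 := congrArg (coeff (m + 1)) hB
    rw [sub_mul, one_mul, map_sub, coeff_succ_X_mul, coeff_rescale] at a1 b1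
    rw [ih] at a1
    have : (1 - a ^ (m + 1)) * coeff (m + 1) A = (1 - a ^ (m + 1)) * coeff (m + 1) B := by linarith
    exact mul_left_cancel₀ (sub_ne_zero.2 (ha m).symm) this

lemma fg_fun : (1 - X) * fg F = rescale (((Fintype.card F) : ℝ)⁻¹) (fg F) := by
  have hq : 1 < (Fintype.card F) := Fintype.one_lt_card
  ext m
  rw [sub_mul, one_mul, map_sub, coeff_rescale]
  cases m with
  | zero => simp
  | succ m =>
    rw [coeff_succ_X_mul]
    simp only [fg, coeff_mk]
    have h := Gl_split hq m 1
    have h0 := Gl_pos hq m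
    have h1 := qf_pos hq m
    have h2 := qf_pos hq (m + 1)
    have hq0 : (0 : ℝ) < (Fintype.card F) := by exact_mod_cast (by omega : 0 < (Fintype.card F))
    rw [Gl_eq hq, Gl_eq hq, ch_succ]
    rw [qf, Finset.prod_range_succ] at h2 ⊢
    change 0 < qf (Fintype.card F) m * _ at h2
    change _ / (_ * (qf (Fintype.card F) m * _)) - _ / (_ * qf (Fintype.card F) m) = _ * (_ / (_ * (qf (Fintype.card F) m * _)))
    have h3 : ((Fintype.card F) : ℝ) ^ (m + 1) - 1 ≠ 0 := fun h => by rw [h] at h2; simp at h2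
    have e : ((Fintype.card F) : ℝ) ^ ((m + 1) ^ 2) = ((Fintype.card F) : ℝ) ^ (m ^ 2) * ((Fintype.card F) : ℝ) ^ m * ((Fintype.card F) : ℝ) ^ (m + 1) := by
      rw [← pow_add, ← pow_add]; congr 1; ring
    rw [e, inv_pow, pow_add ((Fintype.card F) : ℝ) m (m.choose 2)]
    field_simp
    ring

lemma pn {r : ℕ} (hr : 1 < r) (n : ℕ) : ((r : ℝ)⁻¹) ^ (n + 1) ≠ 1 := (p_pow hr n).ne

lemma hs_zero (r : ℕ) : coeff 0 (hs r) = 1 := by simp [hs, hc]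

lemma fg_zero : coeff 0 (fg F) = 1 := by simp [fg, Gl, surjN]

lemma cc_rescale (a : ℝ) (f : ℝ⟦X⟧) : constantCoeff (rescale a f) = constantCoeff f := by
  rw [← coeff_zero_eq_constantCoeff_apply, coeff_rescale]; simp

lemma fg_h : fg F = hs (Fintype.card F) * rescale (((Fintype.card F) : ℝ)⁻¹) (hs (Fintype.card F)) := by
  have hq : 1 < (Fintype.card F) := Fintype.one_lt_card
  refine uniq (pn hq) fg_fun ?_ ?_
  · rw [← mul_assoc, hs_fun hq, map_mul, mul_comm, rescale_rescale, sq]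
  · rw [fg_zero]; simp [cc_rescale, hs, hc]

lemma hs_q : (1 - C ((Fintype.card F) : ℝ) * X) * rescale ((Fintype.card F) : ℝ) (hs (Fintype.card F)) = rescale (((Fintype.card F) : ℝ)⁻¹) (hs (Fintype.card F)) := by
  have hq : 1 < (Fintype.card F) := Fintype.one_lt_card
  have hq0 : ((Fintype.card F) : ℝ) ≠ 0 := by positivity
  have h := congrArg (rescale ((Fintype.card F) : ℝ)) (hs_fun hq)
  rw [map_mul, rescale_rescale, map_sub, map_one, rescale_X] at h
  rw [h]; congr 2; field_simp

/-- `h(X^2)` -/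
noncomputable def h2s (r : ℕ) : ℝ⟦X⟧ := PowerSeries.mk fun m => if Even m then hc r (m / 2) else 0

lemma h2s_fun {r : ℕ} (hr : 1 < r) : (1 - X ^ 2) * h2s r = rescale ((r : ℝ)⁻¹) (h2s r) := by
  ext m
  rw [sub_mul, one_mul, map_sub, coeff_rescale]
  match m with
  | 0 => simp [coeff_X_pow_mul']
  | 1 => simp [coeff_X_pow_mul', h2s]
  | m + 2 =>
    rw [coeff_X_pow_mul]
    simp only [h2s, coeff_mk]
    by_cases h : Even m
    · have h' : Even (m + 2) := by simp [parity_simps, h]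
      obtain ⟨k, rfl⟩ := h
      rw [if_pos h', if_pos ⟨k, rfl⟩, show (k + k + 2) / 2 = k + 1 by omega, show (k + k) / 2 = k by omega,
        ← hc_succ hr k, show k + k + 2 = 2 * (k + 1) by ring]; ring
    · have h' : ¬ Even (m + 2) := by simpa [parity_simps] using h
      rw [if_neg h', if_neg h]; simp

lemma fa_eq (h2 : (2 : F) ≠ 0) : fa F = h2s (Fintype.card F) := by
  have hq : 1 < (Fintype.card F) := Fintype.one_lt_card
  have hq0 : ((Fintype.card F) : ℝ) ≠ 0 := by positivity
  have hE : rescale ((Fintype.card F) : ℝ) (Es F) ≠ 0 := by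
    intro h
    have := congrArg (coeff 0) h
    simp [Es, qf] at this
  apply mul_right_cancel₀ hE
  rw [← fg_a h2]
  refine uniq (pn hq) fg_fun ?_ ?_
  · have e : rescale (((Fintype.card F) : ℝ)⁻¹) (rescale ((Fintype.card F) : ℝ) (Es F)) = Es F := by
      rw [rescale_rescale, mul_inv_cancel₀ hq0, rescale_one]; rfl
    rw [map_mul, ← h2s_fun hq, e, Es_rescale]
    ring
  · rw [fg_zero]; simp [cc_rescale, h2s, hc, Es, qf]

end ser
end SpFF


set_option linter.all false
namespace SpFF
open Module PowerSeries

section nilp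
variable {F : Type} [Field F] [Fintype F]

noncomputable def mu {V : Type} [AddCommGroup V] [Module F V] (B : End F V) (i : ℕ) : ℕ :=
  rk B i + rk B (i + 2) - 2 * rk B (i + 1)

lemma mu_rB {V : Type} [AddCommGroup V] [Module F V] [FiniteDimensional F V] (B : End F V) (i : ℕ) :
    mu (rB B) i = mu B (i + 1) := by
  unfold mu; rw [rk_rB, rk_rB, rk_rB]

noncomputable def kap (ε : F) (m : ℕ) : ℝ := (DD F (some ε) m : ℝ) * NN F (some (-ε)) m / Gl (Fintype.card F) m

lemma card_sub_one {V : Type} [AddCommGroup V] [Module F V] [Subsingleton V] (P : Bil F V → Prop) (h : P 0) :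
    Nat.card {β : Bil F V // P β} = 1 := by
  have : Subsingleton (Bil F V) := ⟨fun a b => LinearMap.ext fun x => by
    rw [Subsingleton.elim x 0, map_zero, map_zero]⟩
  rw [Nat.card_eq_one_iff_unique]
  exact ⟨inferInstance, ⟨0, h⟩⟩

lemma rB_nil {V : Type} [AddCommGroup V] [Module F V] {B : End F V} {K : ℕ} (h : B ^ (K + 1) = 0) :
    rB B ^ K = 0 := by
  ext ⟨_, y, rfl⟩
  rw [rB_pow]
  have := LinearMap.congr_fun h y
  rw [pow_succ] at this
  simpa using this

lemma pos_NN (h2 : (2 : F) ≠ 0) {ε : F} (hε : ε = 1 ∨ ε = -1) (m : ℕ) : 0 < NN F (some ε) m := by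
  rcases hε with rfl | rfl
  · rw [NN_one]; exact pow_pos Fintype.card_pos _
  · rw [NN_neg h2]; exact pow_pos Fintype.card_pos _

lemma NN_mul' (h2 : (2 : F) ≠ 0) {ε : F} (hε : ε = 1 ∨ ε = -1) (m : ℕ) :
    NN F (some ε) m * NN F (some (-ε)) m = NN F none m := by
  rcases hε with rfl | rfl
  · exact NN_mul h2 m
  · rw [neg_neg, mul_comm]; exact NN_mul h2 m

lemma DDn (m : ℕ) : (DD F none m : ℝ) = Gl (Fintype.card F) m := by rw [DD_none]; rfl

lemma sub_of_pow_zero {V : Type} [AddCommGroup V] [Module F V] {B : End F V} (h : B ^ 0 = 0) : Subsingleton V :=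
  ⟨fun x y => by
    have e : ∀ x : V, x = 0 := fun x => by simpa using LinearMap.congr_fun h x
    rw [e x, e y]⟩

lemma sub_pred (V : Type) [AddCommGroup V] [Module F V] [Subsingleton V] (o : Option F) (B : End F V) :
    dF o B = 1 ∧ nF o B = 1 := by
  constructor
  · exact card_sub_one _ ⟨fun x y => by simp, fun ε hε x y => by simp, fun x _ => Subsingleton.elim _ _⟩
  · exact card_sub_one _ ⟨fun x y => by simp, fun ε hε x y => by simp⟩

theorem nil_prod (h2 : (2 : F) ≠ 0) (K : ℕ) : ∀ (ε : F), ε = 1 ∨ ε = -1 →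
    ∀ (V : Type) [AddCommGroup V] [Module F V] [FiniteDimensional F V] (B : End F V), B ^ K = 0 →
    (dF (some ε) B : ℝ) * nF (some (-ε)) B =
      dF none B * ∏ i ∈ Finset.range K, kap (ε * (-1) ^ i) (mu B i) := by
  induction K with
  | zero =>
    intro ε hε V _ _ _ B hB
    have := sub_of_pow_zero hB
    simp [sub_pred V]
  | succ K ih =>
    intro ε hε V _ _ _ B hB
    have hIH := ih (-ε) (by rcases hε with rfl | rfl <;> simp) (LinearMap.range B) (rB B) (rB_nil hB)
    have p1 := peel_d (some ε) B
    have p2 := peel_n (some (-ε)) B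
    have p3 := peel_d none B
    simp only [ngo, Option.map_some, Option.map_none, neg_neg] at p1 p2 p3
    change _ * NN F _ (mu B 0) = _ * (DD F _ (mu B 0) * _) at p1
    change _ * NN F _ (mu B 0) = _ * (DD F _ (mu B 0) * _) at p3
    have q1 : (dF (some ε) B : ℝ) * NN F (some ε) (mu B 0) = dF (some (-ε)) (rB B) * (DD F (some ε) (mu B 0) * NN F (some ε) (rk B 0 - rk B 1)) := by exact_mod_cast p1
    have q2 : (nF (some (-ε)) B : ℝ) = nF (some ε) (rB B) * NN F (some (-ε)) (rk B 0 - rk B 1) := by exact_mod_cast p2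
    have q3 : (dF none B : ℝ) * NN F none (mu B 0) = dF none (rB B) * (DD F none (mu B 0) * NN F none (rk B 0 - rk B 1)) := by exact_mod_cast p3
    have r1 := NN_mul' h2 hε (mu B 0)
    have r2 := NN_mul' h2 hε (rk B 0 - rk B 1)
    rw [← r1, ← r2] at q3
    push_cast at q3
    rw [neg_neg] at hIH
    rw [Finset.prod_range_succ', pow_zero, mul_one]
    have e : ∏ i ∈ Finset.range K, kap (ε * (-1) ^ (i + 1)) (mu B (i + 1)) =
        ∏ i ∈ Finset.range K, kap (-ε * (-1) ^ i) (mu (rB B) i) := by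
      refine Finset.prod_congr rfl fun i _ => ?_
      rw [mu_rB, pow_succ]; congr 1; ring
    rw [e]
    set Pi := ∏ i ∈ Finset.range K, kap (-ε * (-1) ^ i) (mu (rB B) i)
    have g := Gl_pos (Fintype.one_lt_card (α := F)) (mu B 0)
    rw [DDn] at q3
    have n1 : (0 : ℝ) < NN F (some ε) (mu B 0) := by exact_mod_cast pos_NN h2 hε _
    have n2 : (0 : ℝ) < NN F (some (-ε)) (mu B 0) := by
      exact_mod_cast pos_NN h2 (by rcases hε with rfl | rfl <;> simp) _
    apply mul_right_cancel₀ (mul_pos n1 n2).ne'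
    rw [q2, kap]
    set a := (dF (some ε) B : ℝ)
    set d := (dF none B : ℝ)
    set a' := (dF (some (-ε)) (rB B) : ℝ)
    set b' := (nF (some ε) (rB B) : ℝ)
    set d' := (dF none (rB B) : ℝ)
    set x := (NN F (some ε) (mu B 0) : ℝ)
    set y := (NN F (some (-ε)) (mu B 0) : ℝ)
    set D := (DD F (some ε) (mu B 0) : ℝ)
    set s := (NN F (some ε) (rk B 0 - rk B 1) : ℝ)
    set t := (NN F (some (-ε)) (rk B 0 - rk B 1) : ℝ)
    set G := Gl (Fintype.card F) (mu B 0)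
    calc a * (b' * t) * (x * y) = (a * x) * (b' * t * y) := by ring
      _ = (a' * b') * (D * s * t * y) := by rw [q1]; ring
      _ = (d' * (G * (s * t))) * (Pi * (D * y / G)) := by rw [hIH]; field_simp
      _ = _ := by rw [← q3]; ring

theorem nil_none (K : ℕ) :
    ∀ (V : Type) [AddCommGroup V] [Module F V] [FiniteDimensional F V] (B : End F V), B ^ K = 0 →
    (0 : ℝ) < dF none B ∧ (nF none B : ℝ) = dF none B *
      ∏ i ∈ Finset.range K, ((Fintype.card F : ℝ) ^ (mu B i ^ 2) / Gl (Fintype.card F) (mu B i)) := by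
  induction K with
  | zero =>
    intro V _ _ _ B hB
    have := sub_of_pow_zero hB
    simp [sub_pred V]
  | succ K ih =>
    intro V _ _ _ B hB
    obtain ⟨hp, hIH⟩ := ih (LinearMap.range B) (rB B) (rB_nil hB)
    have p2 := peel_n none B
    have p3 := peel_d none B
    simp only [ngo, Option.map_none] at p2 p3
    change _ * NN F _ (mu B 0) = _ * (DD F _ (mu B 0) * _) at p3
    have q2 : (nF none B : ℝ) = nF none (rB B) * NN F none (rk B 0 - rk B 1) := by exact_mod_cast p2
    have q3 : (dF none B : ℝ) * NN F none (mu B 0) = dF none (rB B) * (DD F none (mu B 0) * NN F none (rk B 0 - rk B 1)) := by exact_mod_cast p3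
    have g := Gl_pos (Fintype.one_lt_card (α := F)) (mu B 0)
    rw [DDn] at q3
    have n0 : ∀ m, (0 : ℝ) < NN F none m := fun m => by
      rw [NN_none]; exact_mod_cast pow_pos Fintype.card_pos _
    have n1 := n0 (mu B 0)
    have n2 := n0 (rk B 0 - rk B 1)
    constructor
    · refine pos_of_mul_pos_left (b := (NN F none (mu B 0) : ℝ)) ?_ n1.le
      rw [q3]; positivity
    · rw [Finset.prod_range_succ']
      have e : ∏ i ∈ Finset.range K, ((Fintype.card F : ℝ) ^ (mu B (i + 1) ^ 2) / Gl (Fintype.card F) (mu B (i + 1))) =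
          ∏ i ∈ Finset.range K, ((Fintype.card F : ℝ) ^ (mu (rB B) i ^ 2) / Gl (Fintype.card F) (mu (rB B) i)) := by
        refine Finset.prod_congr rfl fun i _ => ?_
        rw [mu_rB]
      have e2 : ((Fintype.card F : ℝ) ^ (mu B 0 ^ 2)) = NN F none (mu B 0) := by rw [NN_none]; push_cast; rfl
      rw [e, e2, q2, hIH]
      set Pi := ∏ i ∈ Finset.range K, ((Fintype.card F : ℝ) ^ (mu (rB B) i ^ 2) / Gl (Fintype.card F) (mu (rB B) i))
      calc _ = (dF none (rB B) * (Gl (Fintype.card F) (mu B 0) * (NN F none (rk B 0 - rk B 1) : ℝ))) * (Pi * (1 / Gl (Fintype.card F) (mu B 0))) := by field_simp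
        _ = _ := by rw [← q3]; ring

end nilp
end SpFF


set_option linter.all false
namespace SpFF
open Module Polynomial

section types
variable {F : Type} [Field F]

abbrev Qm (p : F[X]) (e : ℕ) : Type := F[X] ⧸ Ideal.span {p ^ e}

lemma finrank_Qm (p : F[X]) (hp : p.Monic) (e : ℕ) : finrank F (Qm p e) = e * p.natDegree := by
  have := (AdjoinRoot.powerBasis' (hp.pow e)).finrank
  rw [AdjoinRoot.powerBasis'_dim, natDegree_pow] at this
  exact this

lemma fin_Qm (p : F[X]) (hp : p.Monic) (e : ℕ) : FiniteDimensional F (Qm p e) :=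
  (AdjoinRoot.powerBasis' (hp.pow e)).finite

lemma tor_Qm (p φ : F[X]) (hp : p.Monic) (hφ : φ.Monic) (ip : Irreducible p) (iφ : Irreducible φ) (e j : ℕ) [DecidableEq F[X]] :
    finrank F (Submodule.torsionBy F[X] (Qm p e) (φ ^ j)) = if p = φ then min e j * φ.natDegree else 0 := by
  haveI := fin_Qm p hp e
  split_ifs with h
  · subst h
    rcases le_total e j with hj | hj
    · have : Submodule.torsionBy F[X] (Qm p e) (p ^ j) = ⊤ := by
        rw [eq_top_iff]
        rintro x -
        rw [Submodule.mem_torsionBy_iff]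
        obtain ⟨a, rfl⟩ := Ideal.Quotient.mk_surjective x
        change Ideal.Quotient.mk _ (p ^ j * a) = 0
        rw [Ideal.Quotient.eq_zero_iff_mem, Ideal.mem_span_singleton]
        exact (pow_dvd_pow p hj).mul_right a
      rw [this, min_eq_left hj, ← finrank_Qm p hp e]
      exact LinearEquiv.finrank_eq (Submodule.topEquiv (R := F[X]) (M := Qm p e) |>.restrictScalars F)
    · haveI := fin_Qm p hp j
      have hle : Ideal.span {p ^ e} ≤ Ideal.span {p ^ j} := by
        rw [Ideal.span_singleton_le_span_singleton]; exact pow_dvd_pow p hj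
      let g : Qm p e →ₐ[F] Qm p j := Ideal.Quotient.factorₐ F hle
      have hg : Function.Surjective g := Ideal.Quotient.factor_surjective hle
      let m : Qm p e →ₗ[F] Qm p e := (Algebra.lsmul F F (Qm p e) (p ^ j : F[X]))
      have hm : ∀ x, m x = (p ^ j : F[X]) • x := fun x => rfl
      have h1 := LinearMap.finrank_range_add_finrank_ker m
      have h2 := LinearMap.finrank_range_add_finrank_ker g.toLinearMap
      rw [LinearMap.range_eq_top.2 hg, finrank_top] at h2
      have h3 : LinearMap.range m = LinearMap.ker g.toLinearMap := by
        ext x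
        constructor
        · rintro ⟨y, rfl⟩
          obtain ⟨a, rfl⟩ := Ideal.Quotient.mk_surjective y
          rw [hm]
          change Ideal.Quotient.mk _ (p ^ j * a) = 0
          rw [Ideal.Quotient.eq_zero_iff_mem, Ideal.mem_span_singleton]
          exact dvd_mul_right _ _
        · intro hx
          obtain ⟨a, rfl⟩ := Ideal.Quotient.mk_surjective x
          have hx' : Ideal.Quotient.mk (Ideal.span {p ^ j}) a = 0 := hx
          rw [Ideal.Quotient.eq_zero_iff_mem, Ideal.mem_span_singleton] at hx'
          obtain ⟨b, rfl⟩ := hx'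
          exact ⟨Ideal.Quotient.mk _ b, rfl⟩
      have h4 : finrank F (LinearMap.ker m) = finrank F (Submodule.torsionBy F[X] (Qm p e) (p ^ j)) := by
        apply LinearEquiv.finrank_eq
        exact { toFun := fun x => ⟨x.1, x.2⟩, invFun := fun x => ⟨x.1, x.2⟩,
                map_add' := fun _ _ => rfl, map_smul' := fun _ _ => rfl,
                left_inv := fun _ => rfl, right_inv := fun _ => rfl }
      rw [← h4, min_eq_right hj]
      rw [h3] at h1
      have e2 := finrank_Qm p hp j
      have e1 := finrank_Qm p hp e
      omega
  · have hb : Submodule.torsionBy F[X] (Qm p e) (φ ^ j) = ⊥ := by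
      rw [eq_bot_iff]
      intro x hx
      rw [Submodule.mem_torsionBy_iff] at hx
      obtain ⟨a, rfl⟩ := Ideal.Quotient.mk_surjective x
      have hx' : Ideal.Quotient.mk (Ideal.span {p ^ e}) (φ ^ j * a) = 0 := hx
      rw [Ideal.Quotient.eq_zero_iff_mem, Ideal.mem_span_singleton] at hx'
      have hc : IsCoprime p φ := by
        refine (or_iff_not_imp_right.2 (fun hd => (ip.coprime_iff_not_dvd (n := φ)).2 hd)).resolve_right fun hd => h ?_
        exact eq_of_monic_of_associated hp hφ (ip.associated_of_dvd iφ hd)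
      have := (hc.pow (m := e) (n := j)).dvd_of_dvd_mul_left hx'
      rw [Submodule.mem_bot, Ideal.Quotient.eq_zero_iff_mem, Ideal.mem_span_singleton]
      exact this
    rw [hb]
    have := finrank_bot F (Qm p e)
    exact (LinearEquiv.finrank_eq (M := (⊥ : Submodule F[X] (Qm p e))) (N := (⊥ : Submodule F (Qm p e)))
      { toFun := fun x => ⟨x.1, x.2⟩, invFun := fun x => ⟨x.1, x.2⟩,
                map_add' := fun _ _ => rfl, map_smul' := fun _ _ => rfl,
                left_inv := fun _ => rfl, right_inv := fun _ => rfl }).trans this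

variable {V W : Type} [AddCommGroup V] [Module F V] [AddCommGroup W] [Module F W]

/-- presentation of an endomorphism as a sum of cyclic primary modules -/
structure Pres (A : End F V) (ι : Type) [Fintype ι] (p : ι → F[X]) (e : ι → ℕ) : Prop where
  monic : ∀ k, (p k).Monic
  irr : ∀ k, Irreducible (p k)
  iso : Nonempty (AEval' A ≃ₗ[F[X]] ((k : ι) → Qm (p k) (e k + 1)))

def IsType (A : End F V) (n : F[X] × ℕ →₀ ℕ) : Prop :=
  ∃ (ι : Type) (_ : Fintype ι) (p : ι → F[X]) (e : ι → ℕ), Pres A ι p e ∧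
    ∀ x, n x = Nat.card {k // (p k, e k) = x}

noncomputable def kd (A : End F V) (g : F[X]) : ℕ := finrank F (LinearMap.ker (aeval A g))

lemma kd_tor (A : End F V) (g : F[X]) :
    kd A g = finrank F (Submodule.torsionBy F[X] (AEval' A) g) := by
  apply LinearEquiv.finrank_eq
  exact { toFun := fun x => ⟨AEval'.of A x.1, by
            rw [Submodule.mem_torsionBy_iff, ← AEval.of_aeval_smul]
            have : (aeval A g) x.1 = 0 := x.2
            rw [End.smul_def, this, map_zero]⟩
          invFun := fun x => ⟨(AEval'.of A).symm x.1, by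
            have := x.2
            rw [Submodule.mem_torsionBy_iff] at this
            rw [LinearMap.mem_ker, ← End.smul_def, ← AEval.of_symm_smul, this, map_zero]⟩
          map_add' := fun _ _ => rfl, map_smul' := fun _ _ => rfl
          left_inv := fun _ => rfl, right_inv := fun _ => rfl }

lemma tor_congr {M N : Type} [AddCommGroup M] [AddCommGroup N] [Module F[X] M] [Module F[X] N] [Module F M] [Module F N]
    [IsScalarTower F F[X] M] [IsScalarTower F F[X] N] (f : M ≃ₗ[F[X]] N) (g : F[X]) :
    finrank F (Submodule.torsionBy F[X] M g) = finrank F (Submodule.torsionBy F[X] N g) := by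
  apply LinearEquiv.finrank_eq
  let f' := f.restrictScalars F
  exact { toFun := fun x => ⟨f' x.1, by
            have := x.2
            rw [Submodule.mem_torsionBy_iff] at this ⊢
            change g • f x.1 = 0
            rw [← map_smul, this, map_zero]⟩
          invFun := fun x => ⟨f'.symm x.1, by
            have := x.2
            rw [Submodule.mem_torsionBy_iff] at this ⊢
            change g • f.symm x.1 = 0
            rw [← map_smul, this, map_zero]⟩
          map_add' := fun _ _ => by ext; simp
          map_smul' := fun _ _ => by ext; simp
          left_inv := fun _ => by ext; simp
          right_inv := fun _ => by ext; simp }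

lemma tor_pi {ι : Type} [Fintype ι] (M : ι → Type) [∀ i, AddCommGroup (M i)] [∀ i, Module F[X] (M i)]
    [∀ i, Module F (M i)] [∀ i, IsScalarTower F F[X] (M i)] [∀ i, FiniteDimensional F (M i)] (g : F[X]) :
    finrank F (Submodule.torsionBy F[X] ((i : ι) → M i) g) =
      ∑ i, finrank F (Submodule.torsionBy F[X] (M i) g) := by
  haveI : ∀ i, FiniteDimensional F (Submodule.torsionBy F[X] (M i) g) := fun i =>
    FiniteDimensional.of_injective ((Submodule.torsionBy F[X] (M i) g).subtype.restrictScalars F)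
      Subtype.val_injective
  rw [← finrank_pi_fintype F]
  apply LinearEquiv.finrank_eq
  exact { toFun := fun x i => ⟨x.1 i, by
            have := x.2
            rw [Submodule.mem_torsionBy_iff] at this ⊢
            exact congrFun this i⟩
          invFun := fun x => ⟨fun i => (x i).1, by
            rw [Submodule.mem_torsionBy_iff]
            ext i
            exact (x i).2⟩
          map_add' := fun _ _ => rfl
          map_smul' := fun _ _ => rfl
          left_inv := fun _ => rfl
          right_inv := fun _ => rfl }

lemma Pres.kd_eq {A : End F V} {ι : Type} [Fintype ι] {p : ι → F[X]} {e : ι → ℕ} (h : Pres A ι p e)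
    {φ : F[X]} (hφ : φ.Monic) (iφ : Irreducible φ) (j : ℕ) [DecidableEq F[X]] :
    kd A (φ ^ j) = ∑ k, if p k = φ then min (e k + 1) j * φ.natDegree else 0 := by
  obtain ⟨f⟩ := h.iso
  haveI := fun k => fin_Qm (p k) (h.monic k) (e k + 1)
  rw [kd_tor, tor_congr f, tor_pi]
  refine Finset.sum_congr rfl fun k _ => ?_
  rw [tor_Qm _ _ (h.monic k) hφ (h.irr k) iφ]

lemma Pres.finrank_eq {A : End F V} {ι : Type} [Fintype ι] {p : ι → F[X]} {e : ι → ℕ} (h : Pres A ι p e) :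
    finrank F V = ∑ k, (e k + 1) * (p k).natDegree := by
  obtain ⟨f⟩ := h.iso
  haveI := fun k => fin_Qm (p k) (h.monic k) (e k + 1)
  rw [((AEval'.of A).trans (f.restrictScalars F)).finrank_eq, finrank_pi_fintype F]
  exact Finset.sum_congr rfl fun k _ => finrank_Qm _ (h.monic k) _

lemma IsType.count {A : End F V} {n : F[X] × ℕ →₀ ℕ} (h : IsType A n) {φ : F[X]} (hφ : φ.Monic)
    (iφ : Irreducible φ) (i : ℕ) :
    2 * kd A (φ ^ (i + 1)) = kd A (φ ^ i) + kd A (φ ^ (i + 2)) + n (φ, i) * φ.natDegree := by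
  classical
  obtain ⟨ι, _, p, e, hp, hn⟩ := h
  rw [hp.kd_eq hφ iφ, hp.kd_eq hφ iφ, hp.kd_eq hφ iφ, hn, Nat.card_eq_fintype_card, Fintype.card_subtype,
    Finset.card_filter, Finset.mul_sum, ← Finset.sum_add_distrib, Finset.sum_mul, ← Finset.sum_add_distrib]
  refine Finset.sum_congr rfl fun k _ => ?_
  by_cases hk : p k = φ
  · simp only [hk, if_true, Prod.mk.injEq, true_and]
    rcases lt_trichotomy (e k) i with hh | hh | hh
    · rw [if_neg hh.ne, min_eq_left (by omega), min_eq_left (by omega), min_eq_left (by omega)]; ring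
    · rw [if_pos hh, hh, min_eq_left (by omega), min_eq_right (by omega), min_eq_left (by omega)]; ring
    · rw [if_neg hh.ne', min_eq_right (by omega), min_eq_right (by omega), min_eq_right (by omega)]; ring
  · simp [hk]

lemma IsType.supp {A : End F V} {n : F[X] × ℕ →₀ ℕ} (h : IsType A n) {x : F[X] × ℕ} (hx : n x ≠ 0) :
    x.1.Monic ∧ Irreducible x.1 := by
  obtain ⟨ι, _, p, e, hp, hn⟩ := h
  rw [hn] at hx
  have := (Nat.card_ne_zero.1 hx).1
  obtain ⟨k, rfl⟩ := this
  exact ⟨hp.monic k, hp.irr k⟩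

/-- total dimension of a type -/
noncomputable def wt (n : F[X] × ℕ →₀ ℕ) : ℕ := n.sum fun x m => m * ((x.2 + 1) * x.1.natDegree)

lemma IsType.wt_eq {A : End F V} {n : F[X] × ℕ →₀ ℕ} (h : IsType A n) : wt n = finrank F V := by
  classical
  obtain ⟨ι, _, p, e, hp, hn⟩ := h
  rw [hp.finrank_eq]
  have : ∀ k, (p k, e k) ∈ n.support := fun k => by
    rw [Finsupp.mem_support_iff, hn]
    exact Nat.card_ne_zero.2 ⟨⟨⟨k, rfl⟩⟩, inferInstance⟩
  rw [wt, Finsupp.sum, ← Finset.sum_fiberwise_of_maps_to (s := Finset.univ) (t := n.support)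
    (g := fun k => (p k, e k)) (fun k _ => this k)]
  refine Finset.sum_congr rfl fun x _ => ?_
  rw [Finset.sum_congr rfl (g := fun _ => (x.2 + 1) * x.1.natDegree), Finset.sum_const, hn,
    Nat.card_eq_fintype_card, Fintype.card_subtype, smul_eq_mul]
  intro k hk
  rw [Finset.mem_filter] at hk
  rw [← hk.2]

/-- valid types -/
def Vt (n : F[X] × ℕ →₀ ℕ) : Prop := ∀ x, n x ≠ 0 → x.1.Monic ∧ Irreducible x.1

lemma ext_of_kd {A : End F V} {A' : End F W} {n n' : F[X] × ℕ →₀ ℕ} (h : IsType A n) (h' : IsType A' n')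
    (hk : ∀ φ : F[X], φ.Monic → Irreducible φ → ∀ j, kd A (φ ^ j) = kd A' (φ ^ j)) : n = n' := by
  ext x
  by_cases hx : x.1.Monic ∧ Irreducible x.1
  · have h1 := h.count hx.1 hx.2 x.2
    have h2 := h'.count hx.1 hx.2 x.2
    rw [hk _ hx.1 hx.2, hk _ hx.1 hx.2, hk _ hx.1 hx.2] at h1
    have h0 := hx.2.natDegree_pos
    exact Nat.eq_of_mul_eq_mul_right h0 (by simp only [Prod.mk.eta] at h1 h2; omega)
  · rw [not_ne_iff.1 (fun hh => hx (h.supp hh)), not_ne_iff.1 (fun hh => hx (h'.supp hh))]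

lemma kd_conj (f : V ≃ₗ[F] W) {A : End F V} {A' : End F W} (h : ∀ x, f (A x) = A' (f x)) (g : F[X]) :
    kd A g = kd A' g := by
  have : ∀ x, f (aeval A g x) = aeval A' g (f x) := by
    intro x
    have : A' = f.conjAlgEquiv F A := by
      ext y; simp [h, LinearEquiv.conjAlgEquiv_apply]
    rw [this, ← AlgEquiv.coe_toAlgHom, aeval_algHom_apply]
    simp [LinearEquiv.conjAlgEquiv_apply]
  apply LinearEquiv.finrank_eq
  exact { toFun := fun x => ⟨f x.1, by
            have := this x.1
            rw [LinearMap.mem_ker.1 x.2] at this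
            rw [LinearMap.mem_ker, ← this, map_zero]⟩
          invFun := fun x => ⟨f.symm x.1, by
            have := this (f.symm x.1)
            rw [LinearEquiv.apply_symm_apply, LinearMap.mem_ker.1 x.2] at this
            rw [LinearMap.mem_ker]
            simpa using this⟩
          map_add' := fun _ _ => by ext; simp
          map_smul' := fun _ _ => by ext; simp
          left_inv := fun _ => by ext; simp
          right_inv := fun _ => by ext; simp }

lemma conj_of_iso {A : End F V} {A' : End F W} (f : AEval' A ≃ₗ[F[X]] AEval' A') :
    ∃ g : V ≃ₗ[F] W, ∀ x, g (A x) = A' (g x) := by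
  refine ⟨((AEval'.of A).trans (f.restrictScalars F)).trans (AEval'.of A').symm, fun x => ?_⟩
  have : AEval'.of A (A x) = X • AEval'.of A x := (AEval'.X_smul_of A x).symm
  simp only [LinearEquiv.trans_apply, this, LinearEquiv.restrictScalars_apply, map_smul]
  rw [AEval.of_symm_X_smul]; rfl

lemma iso_of_conj {A : End F V} {A' : End F W} (f : V ≃ₗ[F] W) (h : ∀ x, f (A x) = A' (f x)) :
    Nonempty (AEval' A ≃ₗ[F[X]] AEval' A') :=
  ⟨LinearEquiv.ofAEval A (f.trans (AEval'.of A')) (fun m => by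
    rw [LinearEquiv.trans_apply, LinearEquiv.trans_apply, End.smul_def, h, AEval'.X_smul_of])⟩

lemma IsType.of_conj {A : End F V} {A' : End F W} (f : V ≃ₗ[F] W) (h : ∀ x, f (A x) = A' (f x))
    {n : F[X] × ℕ →₀ ℕ} (hn : IsType A' n) : IsType A n := by
  obtain ⟨ι, i1, p, e, hp, hn⟩ := hn
  obtain ⟨g⟩ := hp.iso
  obtain ⟨f'⟩ := iso_of_conj f h
  exact ⟨ι, i1, p, e, ⟨hp.monic, hp.irr, ⟨f'.trans g⟩⟩, hn⟩

lemma IsType.conj {A : End F V} {A' : End F W} {n : F[X] × ℕ →₀ ℕ} (h : IsType A n) (h' : IsType A' n) :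
    ∃ g : V ≃ₗ[F] W, ∀ x, g (A x) = A' (g x) := by
  obtain ⟨ι, i1, p, e, hp, hn⟩ := h
  obtain ⟨ι', i1', p', e', hp', hn'⟩ := h'
  have hs : ∀ x, Nonempty ({k // (p k, e k) = x} ≃ {k // (p' k, e' k) = x}) := fun x =>
    Finite.card_eq.1 ((hn x).symm.trans (hn' x))
  let σ : ι ≃ ι' := Equiv.ofFiberEquiv (f := fun k => (p k, e k)) (g := fun k => (p' k, e' k))
    (fun x => (hs x).some)
  have hσ : ∀ k, (p' (σ k), e' (σ k)) = (p k, e k) := fun k =>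
    Equiv.ofFiberEquiv_map (f := fun k => (p k, e k)) (g := fun k => (p' k, e' k)) (fun x => (hs x).some) k
  obtain ⟨f⟩ := hp.iso
  obtain ⟨f'⟩ := hp'.iso
  have h1 : ∀ k, p' (σ k) = p k := fun k => congrArg Prod.fst (hσ k)
  have h2 : ∀ k, e' (σ k) = e k := fun k => congrArg Prod.snd (hσ k)
  let c : ((k : ι) → Qm (p k) (e k + 1)) ≃ₗ[F[X]] ((k : ι) → Qm (p' (σ k)) (e' (σ k) + 1)) :=
    LinearEquiv.piCongrRight fun k => Submodule.quotEquivOfEq _ _ (by rw [h1, h2])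
  let d := LinearEquiv.piCongrLeft F[X] (fun k => Qm (p' k) (e' k + 1)) σ
  exact conj_of_iso (((f.trans c).trans d).trans f'.symm)

lemma exists_type [FiniteDimensional F V] (A : End F V) : ∃ n, IsType A n := by
  classical
  have ht : Module.IsTorsion F[X] (AEval' A) := by
    intro x
    have h0 : minpoly F A ≠ 0 := minpoly.ne_zero (Algebra.IsIntegral.isIntegral A)
    refine ⟨⟨minpoly F A, mem_nonZeroDivisors_of_ne_zero h0⟩, ?_⟩
    change minpoly F A • x = 0
    obtain ⟨y, rfl⟩ := (AEval'.of A).surjective x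
    rw [← AEval.of_aeval_smul, minpoly.aeval, zero_smul, map_zero]
  obtain ⟨ι, i1, p, hp, e, ⟨f⟩⟩ := Module.equiv_directSum_of_isTorsion ht
  let g := f.trans (DirectSum.linearEquivFunOnFintype F[X] ι (fun i => F[X] ⧸ F[X] ∙ p i ^ e i))
  let r : ((k : ι) → F[X] ⧸ F[X] ∙ p k ^ e k) →ₗ[F[X]] ((k : {k // e k ≠ 0}) → F[X] ⧸ F[X] ∙ p k.1 ^ e k.1) :=
    LinearMap.pi fun k => LinearMap.proj k.1
  have hr : Function.Bijective r := by
    constructor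
    · rw [← LinearMap.ker_eq_bot, eq_bot_iff]
      intro x hx
      rw [Submodule.mem_bot]
      ext k
      by_cases hk : e k = 0
      · have : (F[X] ∙ p k ^ e k) = ⊤ := by
          rw [hk, pow_zero]; exact Ideal.span_singleton_one
        obtain ⟨a, ha⟩ := Submodule.mkQ_surjective _ (x k)
        rw [← ha, Pi.zero_apply, Submodule.mkQ_apply, Submodule.Quotient.mk_eq_zero, this]
        trivial
      · exact congrFun (LinearMap.mem_ker.1 hx) ⟨k, hk⟩
    · intro y
      refine ⟨fun k => if hk : e k ≠ 0 then y ⟨k, hk⟩ else 0, ?_⟩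
      ext k
      simp [r, k.2]
  let c : ((k : {k // e k ≠ 0}) → F[X] ⧸ F[X] ∙ p k.1 ^ e k.1) ≃ₗ[F[X]]
      ((k : {k // e k ≠ 0}) → Qm (normalize (p k.1)) ((e k.1 - 1) + 1)) :=
    LinearEquiv.piCongrRight fun k => Submodule.quotEquivOfEq _ _ (by
      rw [Nat.sub_add_cancel (Nat.pos_of_ne_zero k.2)]
      exact Ideal.span_singleton_eq_span_singleton.2 ((associated_normalize (p k.1)).pow_pow))
  have hP : Pres A {k // e k ≠ 0} (fun k => normalize (p k.1)) (fun k => e k.1 - 1) :=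
    ⟨fun k => monic_normalize (hp k.1).ne_zero, fun k => (associated_normalize (p k.1)).irreducible (hp k.1),
      ⟨(g.trans (LinearEquiv.ofBijective r hr)).trans c⟩⟩
  refine ⟨Finsupp.onFinset (Finset.univ.image fun k : {k // e k ≠ 0} => (normalize (p k.1), e k.1 - 1))
    (fun x => Nat.card {k : {k // e k ≠ 0} // (normalize (p k.1), e k.1 - 1) = x}) ?_,
    _, _, _, _, hP, fun x => rfl⟩
  intro x hx
  obtain ⟨⟨k, hk⟩⟩ := (Nat.card_ne_zero.1 hx).1
  exact Finset.mem_image.2 ⟨k, Finset.mem_univ _, hk⟩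

lemma realise [FiniteDimensional F V] (n : F[X] × ℕ →₀ ℕ) (hn : Vt n) (hw : wt n = finrank F V) :
    ∃ A : End F V, IsType A n := by
  classical
  let ι := Σ x : n.support, Fin (n x.1)
  let p : ι → F[X] := fun k => k.1.1.1
  let e : ι → ℕ := fun k => k.1.1.2
  have hm : ∀ k, (p k).Monic := fun k => (hn _ (Finsupp.mem_support_iff.1 k.1.2)).1
  have hi : ∀ k, Irreducible (p k) := fun k => (hn _ (Finsupp.mem_support_iff.1 k.1.2)).2
  let M := (k : ι) → Qm (p k) (e k + 1)
  haveI := fun k => fin_Qm (p k) (hm k) (e k + 1)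
  have hM : finrank F V = finrank F M := by
    rw [finrank_pi_fintype F, ← hw, Fintype.sum_sigma, wt, Finsupp.sum, ← Finset.sum_coe_sort]
    refine Finset.sum_congr rfl fun x _ => ?_
    rw [Finset.sum_congr rfl (g := fun _ => (x.1.2 + 1) * x.1.1.natDegree), Finset.sum_const, Finset.card_univ,
      Fintype.card_fin, smul_eq_mul]
    intro k _
    exact finrank_Qm _ (hm ⟨x, k⟩) _
  let f : V ≃ₗ[F] M := LinearEquiv.ofFinrankEq _ _ hM
  let T : End F M := Algebra.lsmul F F M (X : F[X])
  let A : End F V := f.symm.conj T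
  refine ⟨A, ι, inferInstance, p, e, ⟨hm, hi, ⟨LinearEquiv.ofAEval A f (fun m => ?_)⟩⟩, fun x => ?_⟩
  · simp [A, LinearEquiv.conj_apply, T]
  · by_cases hx : x ∈ n.support
    · rw [← Nat.card_fin (n x)]
      refine Nat.card_congr ?_
      exact
      { toFun := fun k => ⟨⟨⟨x, hx⟩, k⟩, rfl⟩
        invFun := fun k => Fin.cast (congrArg n k.2) k.1.2
        left_inv := fun k => rfl
        right_inv := by
          rintro ⟨⟨⟨y, hy⟩, k⟩, hk⟩
          have : y = x := hk
          subst this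
          rfl }
    · rw [Finsupp.notMem_support_iff.1 hx, eq_comm]
      refine (Nat.card_eq_zero.2 (Or.inl ⟨fun k => hx ?_⟩))
      rw [← k.2]
      exact k.1.1.2

lemma IsType.vt {A : End F V} {n : F[X] × ℕ →₀ ℕ} (h : IsType A n) : Vt n := fun _ hx => h.supp hx

lemma IsType.unique {A : End F V} {n n' : F[X] × ℕ →₀ ℕ} (h : IsType A n) (h' : IsType A n') : n = n' :=
  ext_of_kd h h' fun _ _ _ _ => rfl

end types
end SpFF


set_option linter.all false
namespace SpFF
open Module Polynomial

section orbits
variable {F : Type} [Field F] {V : Type} [AddCommGroup V] [Module F V]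

noncomputable def cent (A : End F V) : ℕ := Nat.card {g : V ≃ₗ[F] V // ∀ x, g (A x) = A (g x)}

noncomputable def tp [FiniteDimensional F V] (A : End F V) : F[X] × ℕ →₀ ℕ := (exists_type A).choose

lemma tp_spec [FiniteDimensional F V] (A : End F V) : IsType A (tp A) := (exists_type A).choose_spec

lemma tp_eq [FiniteDimensional F V] {A : End F V} {n : F[X] × ℕ →₀ ℕ} (h : IsType A n) : tp A = n :=
  (tp_spec A).unique h

lemma orbit_card [FiniteDimensional F V] (A : End F V) :
    glc F V = cent A * Nat.card {A' : End F V // tp A' = tp A} := by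
  have := card_orbit (G := {g : V ≃ₗ[F] V // ∀ x, g (A x) = A (g x)}) (P := V ≃ₗ[F] V) (X := End F V)
    (fun c g => c.1.trans g) (fun g => g.conj A)
    (fun p c c' h => by
      apply Subtype.ext; ext x
      have := congrArg (fun e : V ≃ₗ[F] V => e x) h
      simpa using this)
    (fun p p' => by
      constructor
      · intro h
        refine ⟨⟨p'.trans p.symm, fun x => ?_⟩, ?_⟩
        · have := congrArg (fun e : End F V => p.symm (e (p' x))) h
          simp only [LinearEquiv.conj_apply_apply, LinearEquiv.symm_apply_apply] at this
          simp [this]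
        · ext x; simp
      · rintro ⟨c, rfl⟩
        ext x
        have := c.2 (c.1.symm (p.symm x))
        simp only [LinearEquiv.conj_apply_apply, LinearEquiv.trans_apply, LinearEquiv.symm_trans_apply]
        rw [this]; simp)
  rw [glc, this, cent]
  congr 1
  refine Nat.card_congr (Equiv.subtypeEquivRight fun A' => ?_)
  constructor
  · rintro ⟨g, rfl⟩
    exact tp_eq (IsType.of_conj g.symm (fun x => by simp [LinearEquiv.conj_apply_apply]) (tp_spec A))
  · intro h
    have h1 := tp_spec A'
    rw [h] at h1
    obtain ⟨g, hg⟩ := (tp_spec A).conj h1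
    refine ⟨g, ?_⟩
    ext x
    simp [LinearEquiv.conj_apply_apply, hg]

noncomputable def TY (V : Type) [AddCommGroup V] [Module F V] [FiniteDimensional F V] [Fintype (End F V)] :
    Finset (F[X] × ℕ →₀ ℕ) := by
  classical exact Finset.univ.image (fun A : End F V => tp A)

lemma mem_TY [FiniteDimensional F V] [Fintype (End F V)] (n : F[X] × ℕ →₀ ℕ) :
    n ∈ TY (F := F) V ↔ Vt n ∧ wt n = finrank F V := by
  classical
  rw [TY, Finset.mem_image]
  constructor
  · rintro ⟨A, -, rfl⟩
    exact ⟨(tp_spec A).vt, (tp_spec A).wt_eq⟩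
  · rintro ⟨h1, h2⟩
    obtain ⟨A, hA⟩ := realise (V := V) n h1 h2
    exact ⟨A, Finset.mem_univ _, tp_eq hA⟩

lemma sum_types [FiniteDimensional F V] [Fintype (End F V)] (w : (F[X] × ℕ →₀ ℕ) → ℝ) :
    ∑ A : End F V, (cent A : ℝ) * w (tp A) = glc F V * ∑ n ∈ TY (F := F) V, w n := by
  classical
  rw [← Finset.sum_fiberwise_of_maps_to (s := Finset.univ) (t := TY (F := F) V) (g := fun A : End F V => tp A)
    (fun A _ => (mem_TY _).2 ⟨(tp_spec A).vt, (tp_spec A).wt_eq⟩), Finset.mul_sum]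
  refine Finset.sum_congr rfl fun n hn => ?_
  obtain ⟨A, hA⟩ := realise (V := V) n ((mem_TY n).1 hn).1 ((mem_TY n).1 hn).2
  have hA' := tp_eq hA
  rw [Finset.sum_congr rfl (g := fun _ => (cent A : ℝ) * w n), Finset.sum_const, orbit_card A,
    Nat.card_eq_fintype_card, Fintype.card_subtype, hA', nsmul_eq_mul]
  · push_cast; ring
  · intro B hB
    rw [Finset.mem_filter] at hB
    rw [hB.2]
    congr 2
    have e := tp_spec B
    rw [hB.2] at e
    obtain ⟨g, hg⟩ := hA.conj e
    refine (Nat.card_congr ?_).symm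
    exact { toFun := fun c => ⟨(g.symm.trans c.1).trans g, fun x => by
              have h1 : g.symm (B x) = A (g.symm x) := by
                rw [LinearEquiv.symm_apply_eq, hg]; simp
              simp [h1, c.2, hg]⟩
            invFun := fun c => ⟨(g.trans c.1).trans g.symm, fun x => by
              have h1 : ∀ x, g.symm (B x) = A (g.symm x) := fun x => by
                rw [LinearEquiv.symm_apply_eq, hg]; simp
              simp [h1, c.2, hg]⟩
            left_inv := fun c => by apply Subtype.ext; ext; simp
            right_inv := fun c => by apply Subtype.ext; ext; simp }

/-- a non-degenerate invariant form identifies all of them with the centraliser -/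
lemma dF_cent [FiniteDimensional F V] (A : End F V) (h : 0 < dF none A) : dF none A = cent A := by
  obtain ⟨β, hs, -, hn⟩ := (Nat.card_pos_iff.1 h).1
  let b : V ≃ₗ[F] Dual F V := LinearEquiv.ofBijective β ⟨(nd_inj β).1 hn, by
    refine (LinearMap.injective_iff_surjective_of_finrank_eq_finrank ?_).1 ((nd_inj β).1 hn)
    rw [Subspace.dual_finrank_eq]⟩
  have hb : ∀ x, b x = β x := fun x => rfl
  refine Nat.card_congr ?_
  refine Equiv.symm (Equiv.ofBijective (fun g => ⟨(b.toLinearMap.comp g.1.toLinearMap : V →ₗ[F] Dual F V), ?_, typ_none _, ?_⟩) ⟨?_, ?_⟩)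
  · intro x y
    change b (g.1 (A x)) y = - b (g.1 x) (A y)
    rw [g.2, hb, hb, hs]
  · rw [nd_inj]
    exact b.injective.comp g.1.injective
  · intro g g' e
    apply Subtype.ext; ext x
    have := congrArg (fun e => e.1 x) e
    exact b.injective this
  · rintro ⟨γ, hγ, -, hγn⟩
    let c : V ≃ₗ[F] Dual F V := LinearEquiv.ofBijective γ ⟨(nd_inj γ).1 hγn, by
      refine (LinearMap.injective_iff_surjective_of_finrank_eq_finrank ?_).1 ((nd_inj γ).1 hγn)
      rw [Subspace.dual_finrank_eq]⟩
    have hc : ∀ x, c x = γ x := fun x => rfl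
    refine ⟨⟨c.trans b.symm, fun x => ?_⟩, ?_⟩
    · rw [LinearEquiv.trans_apply, LinearEquiv.symm_apply_eq]
      ext y
      rw [hb, hs, ← hb, hc, hγ, LinearEquiv.trans_apply, LinearEquiv.apply_symm_apply, hc]
    · apply Subtype.ext
      ext x y
      simp [hc]

/-- reflected polynomial -/
noncomputable def ng (φ : F[X]) : F[X] := C ((-1) ^ φ.natDegree) * φ.comp (-X)

lemma ng_natDegree (φ : F[X]) : (ng φ).natDegree = φ.natDegree := by
  rw [ng, natDegree_C_mul (pow_ne_zero _ (by simp)), natDegree_comp, natDegree_neg, natDegree_X, mul_one]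

lemma ng_coeff (φ : F[X]) (k : ℕ) : (ng φ).coeff k = (-1) ^ (φ.natDegree + k) * φ.coeff k := by
  rw [ng, coeff_C_mul]
  have : (-X : F[X]) = C (-1) * X := by simp
  rw [this, comp_C_mul_X_coeff, pow_add]; ring

lemma ng_ng (φ : F[X]) : ng (ng φ) = φ := by
  ext k
  rw [ng_coeff, ng_coeff, ng_natDegree, ← mul_assoc, ← mul_pow]; simp

lemma ng_monic {φ : F[X]} (h : φ.Monic) : (ng φ).Monic := by
  rw [Monic, leadingCoeff, ng_natDegree, ng_coeff, ← two_mul, pow_mul]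
  simp [h.leadingCoeff]

lemma ng_mul (φ ψ : F[X]) : ng (φ * ψ) = ng φ * ng ψ := by
  by_cases h1 : φ = 0
  · subst h1; simp [ng]
  by_cases h2 : ψ = 0
  · subst h2; simp [ng]
  rw [ng, ng, ng, natDegree_mul h1 h2, mul_comp, pow_add, C_mul]; ring

lemma ng_one : ng (1 : F[X]) = 1 := by simp [ng]

lemma ng_unit {φ : F[X]} (h : IsUnit φ) : IsUnit (ng φ) := by
  obtain ⟨u, rfl⟩ := h
  exact IsUnit.of_mul_eq_one (ng (u⁻¹ : F[X]ˣ)) (by rw [← ng_mul]; simp [ng_one])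

lemma ng_irr {φ : F[X]} (h : Irreducible φ) : Irreducible (ng φ) := by
  constructor
  · intro hu
    have := ng_unit hu
    rw [ng_ng] at this
    exact h.not_isUnit this
  · intro a b hab
    have : φ = ng a * ng b := by rw [← ng_mul, ← hab, ng_ng]
    rcases h.isUnit_or_isUnit this with h | h
    · left; have := ng_unit h; rwa [ng_ng] at this
    · right; have := ng_unit h; rwa [ng_ng] at this

lemma ng_pow (φ : F[X]) (j : ℕ) : ng (φ ^ j) = ng φ ^ j := by
  induction j with
  | zero => simp [ng_one]
  | succ j ih => rw [pow_succ, ng_mul, ih, pow_succ]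

lemma aeval_dual (A : End F V) (g : F[X]) :
    aeval (-A.dualMap : End F (Dual F V)) g = (aeval A (g.comp (-X))).dualMap := by
  induction g using Polynomial.induction_on' with
  | add p q hp hq => rw [map_add, hp, hq, add_comp, map_add]; ext; simp
  | monomial n a =>
    rw [aeval_monomial, monomial_comp, map_mul, map_pow, map_neg, aeval_X, aeval_C]
    ext f x
    have : ∀ (n : ℕ) (f : Dual F V) (x : V), ((-A.dualMap : End F (Dual F V)) ^ n) f x = f (((-A) ^ n) x) := by
      intro n
      induction n with
      | zero => intro f x; simp
      | succ n ih =>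
        intro f x
        rw [pow_succ, End.mul_apply, ih, pow_succ', End.mul_apply]
        simp
    simp [Algebra.algebraMap_eq_smul_one, this]

lemma kd_dual [FiniteDimensional F V] (A : End F V) (g : F[X]) :
    kd (-A.dualMap : End F (Dual F V)) g = kd A (ng g) := by
  rw [kd, aeval_dual]
  have h1 := LinearMap.finrank_range_add_finrank_ker (aeval A (g.comp (-X))).dualMap
  rw [LinearMap.finrank_range_dualMap_eq_finrank_range, Subspace.dual_finrank_eq] at h1
  have h2 := LinearMap.finrank_range_add_finrank_ker (aeval A (g.comp (-X)))
  have h3 : LinearMap.ker (aeval A (ng g)) = LinearMap.ker (aeval A (g.comp (-X))) := by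
    ext x
    have h0 : ((-1 : F) ^ g.natDegree) ≠ 0 := pow_ne_zero _ (by simp)
    rw [LinearMap.mem_ker, LinearMap.mem_ker, ng, map_mul, aeval_C, End.mul_apply,
      Module.algebraMap_end_apply, smul_eq_zero]
    simp [h0]
  rw [kd, h3]
  omega

/-- symmetric types -/
def Sy (n : F[X] × ℕ →₀ ℕ) : Prop := ∀ φ : F[X], φ.Monic → Irreducible φ → ∀ i, n (ng φ, i) = n (φ, i)

lemma sy_iff [FiniteDimensional F V] (A : End F V) : Sy (tp A) ↔ tp A = tp (-A.dualMap : End F (Dual F V)) := by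
  have key : ∀ φ : F[X], φ.Monic → Irreducible φ → ∀ i, tp (-A.dualMap : End F (Dual F V)) (φ, i) = tp A (ng φ, i) := by
    intro φ h1 h2 i
    have e1 := (tp_spec (-A.dualMap : End F (Dual F V))).count h1 h2 i
    have e2 := (tp_spec A).count (ng_monic h1) (ng_irr h2) i
    rw [kd_dual, kd_dual, kd_dual, ng_pow, ng_pow, ng_pow] at e1
    rw [ng_natDegree] at e2
    exact Nat.eq_of_mul_eq_mul_right h2.natDegree_pos (by omega)
  constructor
  · intro h
    ext x
    by_cases hx : x.1.Monic ∧ Irreducible x.1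
    · rw [← Prod.mk.eta (p := x), key _ hx.1 hx.2, h _ hx.1 hx.2]
    · rw [not_ne_iff.1 (fun hh => hx ((tp_spec A).supp hh)), not_ne_iff.1 (fun hh => hx ((tp_spec (-A.dualMap : End F (Dual F V))).supp hh))]
  · intro h φ h1 h2 i
    rw [← key φ h1 h2, ← h]

lemma dF_sy [FiniteDimensional F V] [Finite F] (A : End F V) [Decidable (Sy (tp A))] :
    dF none A = if Sy (tp A) then cent A else 0 := by
  haveI : Finite V := Module.finite_of_finite F
  have key : 0 < dF none A ↔ Sy (tp A) := by
    rw [sy_iff]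
    constructor
    · intro h
      obtain ⟨β, hs, -, hn⟩ := (Nat.card_pos_iff.1 h).1
      let b : V ≃ₗ[F] Dual F V := LinearEquiv.ofBijective β ⟨(nd_inj β).1 hn, by
        refine (LinearMap.injective_iff_surjective_of_finrank_eq_finrank ?_).1 ((nd_inj β).1 hn)
        rw [Subspace.dual_finrank_eq]⟩
      have hb : ∀ x, b x = β x := fun x => rfl
      apply tp_eq
      refine IsType.of_conj b (fun x => ?_) (tp_spec _)
      ext y
      rw [hb, hs]; simp [hb]
    · intro h
      have e := tp_spec (-A.dualMap : End F (Dual F V))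
      rw [← h] at e
      obtain ⟨b, hb⟩ := (tp_spec A).conj e
      refine Nat.card_pos_iff.2 ⟨⟨⟨(b.toLinearMap : V →ₗ[F] Dual F V), fun x y => ?_, typ_none _, ?_⟩⟩, inferInstance⟩
      · change b (A x) y = - b x (A y)
        rw [hb]; simp
      · rw [nd_inj]; exact b.injective
  split_ifs with h
  · exact dF_cent A (key.2 h)
  · exact Nat.eq_zero_of_not_pos (fun h' => h (key.1 h'))

lemma sum_dF [FiniteDimensional F V] [Finite F] [Fintype (End F V)] [DecidablePred (Sy (F := F))] :
    ∑ A : End F V, (dF none A : ℝ) = glc F V * ((TY (F := F) V).filter Sy).card := by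
  have := sum_types (V := V) (F := F) (fun n => if Sy n then 1 else 0)
  rw [Finset.sum_boole] at this
  rw [← this]
  refine Finset.sum_congr rfl fun A _ => ?_
  rw [dF_sy]
  split_ifs <;> simp

end orbits
end SpFF


set_option linter.all false
namespace SpFF
open Module Polynomial

section parts

lemma part_pos {N : ℕ} (p : N.Partition) {i : ℕ} (hi : i ∈ p.parts) : 1 ≤ i ∧ i ≤ N := by
  refine ⟨p.parts_pos hi, ?_⟩
  have := Multiset.le_sum_of_mem hi
  rwa [p.parts_sum] at this

lemma part_sub {N : ℕ} (p : N.Partition) : p.parts.toFinset ⊆ (Finset.range N).image (· + 1) := by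
  intro i hi
  have := part_pos p (Multiset.mem_toFinset.1 hi)
  rw [Finset.mem_image]
  exact ⟨i - 1, by rw [Finset.mem_range]; omega, by omega⟩

lemma part_prod {N : ℕ} (p : N.Partition) (f : ℕ → ℕ → ℝ) (hf : ∀ i, f i 0 = 1) :
    p.parts.toFinsupp.prod f = ∏ i ∈ Finset.range N, f (i + 1) (p.parts.count (i + 1)) := by
  rw [Finsupp.prod_of_support_subset (s := (Finset.range N).image (· + 1)) _ (by
    rw [Multiset.toFinsupp_support]; exact part_sub p) _ (fun i _ => hf i), Finset.prod_image (by
      intro a _ b _ h; simpa using h)]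
  rfl

lemma part_sum {N : ℕ} (p : N.Partition) :
    ∑ i ∈ Finset.range N, (i + 1) * p.parts.count (i + 1) = N := by
  conv_rhs => rw [← p.parts_sum, Finset.sum_multiset_count_of_subset _ _ (part_sub p), Finset.sum_image (by
      intro a _ b _ h; simpa using h)]
  exact Finset.sum_congr rfl fun i _ => by rw [smul_eq_mul, mul_comm]

lemma part_ext {N : ℕ} (p p' : N.Partition) (h : ∀ i < N, p.parts.count (i + 1) = p'.parts.count (i + 1)) : p = p' := by
  apply Nat.Partition.ext
  ext i
  by_cases hi : 1 ≤ i ∧ i ≤ N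
  · have := h (i - 1) (by omega)
    rwa [Nat.sub_add_cancel hi.1] at this
  · rw [Multiset.count_eq_zero_of_notMem (fun h => hi (part_pos p h)), Multiset.count_eq_zero_of_notMem (fun h => hi (part_pos p' h))]

lemma exists_part {N : ℕ} (d : ℕ → ℕ) (h : ∑ i ∈ Finset.range N, (i + 1) * d i = N) :
    ∃ p : N.Partition, ∀ i < N, p.parts.count (i + 1) = d i := by
  refine ⟨⟨∑ i ∈ Finset.range N, Multiset.replicate (d i) (i + 1), ?_, ?_⟩, ?_⟩
  · intro i hi
    rw [Multiset.mem_sum] at hi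
    obtain ⟨j, -, hj⟩ := hi
    rw [Multiset.eq_of_mem_replicate hj]; omega
  · rw [Multiset.sum_sum]
    conv_rhs => rw [← h]
    exact Finset.sum_congr rfl fun i _ => by rw [Multiset.sum_replicate, smul_eq_mul, mul_comm]
  · intro i hi
    change Multiset.count (i + 1) (∑ i ∈ Finset.range N, Multiset.replicate (d i) (i + 1)) = d i
    rw [Multiset.count_sum', Finset.sum_eq_single i]
    · simp
    · intro b _ hb
      rw [Multiset.count_replicate, if_neg (by omega)]
    · intro h; exact absurd (Finset.mem_range.2 hi) h

end parts

section build
variable {F : Type} [Field F]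

/-- type built from multisets of polynomials -/
noncomputable def Psi [DecidableEq F] (N : ℕ) (s : ℕ → Multiset F[X]) : F[X] × ℕ →₀ ℕ :=
  Multiset.toFinsupp (∑ i ∈ Finset.range N, (s i).map (fun φ => (φ, i)))

lemma Psi_apply [DecidableEq F] (N : ℕ) (s : ℕ → Multiset F[X]) (φ : F[X]) (j : ℕ) :
    Psi N s (φ, j) = if j < N then (s j).count φ else 0 := by
  rw [Psi, Multiset.toFinsupp_apply, Multiset.count_sum']
  split_ifs with h
  · rw [Finset.sum_eq_single j]
    · have hi : Function.Injective (fun φ : F[X] => (φ, j)) := fun a b h => congrArg Prod.fst h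
      have := Multiset.count_map_eq_count' _ (s j) hi φ
      convert this
    · intro b _ hb
      apply Multiset.count_eq_zero_of_notMem
      intro hm
      obtain ⟨a, -, ha⟩ := Multiset.mem_map.1 hm
      exact hb (congrArg Prod.snd ha)
    · intro h'; exact absurd (Finset.mem_range.2 h) h'
  · apply Finset.sum_eq_zero
    intro b hb
    apply Multiset.count_eq_zero_of_notMem
    intro hm
    obtain ⟨a, -, ha⟩ := Multiset.mem_map.1 hm
    have := congrArg Prod.snd ha
    simp only at this
    exact h (this ▸ Finset.mem_range.1 hb)

lemma wt_Psi [DecidableEq F] (N : ℕ) (s : ℕ → Multiset F[X]) :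
    wt (Psi N s) = ∑ i ∈ Finset.range N, (i + 1) * ((s i).map natDegree).sum := by
  have : ∀ M : Multiset (F[X] × ℕ), wt (Multiset.toFinsupp M) = (M.map fun x => (x.2 + 1) * x.1.natDegree).sum := by
    intro M
    rw [Finset.sum_multiset_map_count, wt, Finsupp.sum, Multiset.toFinsupp_support]
    rfl
  rw [Psi, this, ← Multiset.coe_mapAddMonoidHom, map_sum, Multiset.sum_sum]
  refine Finset.sum_congr rfl fun i _ => ?_
  rw [Multiset.coe_mapAddMonoidHom, Multiset.map_map, ← Multiset.sum_map_mul_left]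
  rfl

/-- slices of a type -/
noncomputable def mm (n : F[X] × ℕ →₀ ℕ) (i : ℕ) : Multiset F[X] :=
  Finsupp.toMultiset (n.comapDomain (fun φ => (φ, i)) (fun a _ b _ h => congrArg Prod.fst h))

lemma count_mm [DecidableEq F] (n : F[X] × ℕ →₀ ℕ) (i : ℕ) (φ : F[X]) : (mm n i).count φ = n (φ, i) := by
  rw [mm, Finsupp.count_toMultiset]; rfl

lemma mem_mm (n : F[X] × ℕ →₀ ℕ) (i : ℕ) (φ : F[X]) : φ ∈ mm n i ↔ n (φ, i) ≠ 0 := by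
  classical
  rw [← count_mm, Multiset.count_ne_zero]

lemma Psi_mm [DecidableEq F] (N : ℕ) (n : F[X] × ℕ →₀ ℕ) (hv : Vt n) (hw : wt n = N) : Psi N (mm n) = n := by
  ext ⟨φ, j⟩
  rw [Psi_apply, count_mm]
  split_ifs with h
  · rfl
  · by_contra h0
    have h1 := (hv _ (Ne.symm h0)).2.natDegree_pos
    have h2 : n (φ, j) * ((j + 1) * φ.natDegree) ≤ wt n := by
      rw [wt, Finsupp.sum]
      exact Finset.single_le_sum (f := fun x : F[X] × ℕ => n x * ((x.2 + 1) * x.1.natDegree)) (fun _ _ => Nat.zero_le _) (Finsupp.mem_support_iff.2 (Ne.symm h0))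
    have h3 : 1 ≤ n (φ, j) := Nat.one_le_iff_ne_zero.2 (Ne.symm h0)
    have h4 : (j + 1) * 1 ≤ (j + 1) * φ.natDegree := Nat.mul_le_mul_left _ h1
    have h5 := Nat.mul_le_mul h3 h4
    omega

lemma Psi_vt [DecidableEq F] (N : ℕ) (s : ℕ → Multiset F[X]) (h : ∀ i < N, ∀ φ ∈ s i, φ.Monic ∧ Irreducible φ) : Vt (Psi N s) := by
  rintro ⟨φ, j⟩ hx
  rw [Psi_apply] at hx
  split_ifs at hx with h'
  · exact h j h' φ (Multiset.count_ne_zero.1 hx)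
  · exact absurd rfl hx

open UniqueFactorizationMonoid in
lemma nf_prod [DecidableEq F] {f : F[X]} (h : f.Monic) : (normalizedFactors f).prod = f := by
  rw [prod_normalizedFactors_eq h.ne_zero, h.normalize_eq_self]

open UniqueFactorizationMonoid in
lemma nf_mem [DecidableEq F] {f : F[X]} (h : f.Monic) {φ : F[X]} (hφ : φ ∈ normalizedFactors f) : φ.Monic ∧ Irreducible φ := by
  have h1 := irreducible_of_normalized_factor _ hφ
  have h2 := normalize_normalized_factor _ hφ
  exact ⟨h2 ▸ monic_normalize h1.ne_zero, h1⟩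

open UniqueFactorizationMonoid in
lemma nf_of_prod [DecidableEq F] (s : Multiset F[X]) (hs : ∀ φ ∈ s, φ.Monic ∧ Irreducible φ) : normalizedFactors s.prod = s := by
  have h0 : s.prod.Monic := by
    have := monic_multiset_prod_of_monic s id (fun i hi => (hs i hi).1)
    rwa [Multiset.map_id] at this
  have := factors_unique (f := normalizedFactors s.prod) (g := s) (fun x hx => (nf_mem h0 hx).2) (fun x hx => (hs x hx).2)
    (Associated.of_eq (nf_prod h0))
  exact Multiset.rel_eq.1 (this.mono fun a ha b hb h => eq_of_monic_of_associated (nf_mem h0 ha).1 (hs b hb).1 h)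

open UniqueFactorizationMonoid in
lemma nf_ng [DecidableEq F] {f : F[X]} (h : f.Monic) : normalizedFactors (ng f) = (normalizedFactors f).map ng := by
  have : ng f = ((normalizedFactors f).map ng).prod := by
    conv_lhs => rw [← nf_prod h]
    exact map_multiset_prod (⟨⟨ng, ng_one⟩, ng_mul⟩ : F[X] →* F[X]) _
  rw [this]
  apply nf_of_prod
  intro φ hφ
  obtain ⟨ψ, hψ, rfl⟩ := Multiset.mem_map.1 hφ
  exact ⟨ng_monic (nf_mem h hψ).1, ng_irr (nf_mem h hψ).2⟩

lemma ng_inj : Function.Injective (ng (F := F)) := fun a b h => by rw [← ng_ng a, h, ng_ng]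

open UniqueFactorizationMonoid in
lemma ng_fix_iff [DecidableEq F] {f : F[X]} (h : f.Monic) :
    ng f = f ↔ ∀ φ, φ.Monic → Irreducible φ → (normalizedFactors f).count (ng φ) = (normalizedFactors f).count φ := by
  constructor
  · intro e φ _ _
    conv_lhs => rw [← e, nf_ng h]
    rw [Multiset.count_map_eq_count' _ _ ng_inj]
  · intro H
    rw [← nf_prod (ng_monic h), ← nf_prod h]
    congr 1
    rw [nf_prod h, nf_ng h]
    ext φ
    by_cases hφ : φ.Monic ∧ Irreducible φ
    · rw [← H _ hφ.1 hφ.2]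
      conv_lhs => rw [← ng_ng φ]
      rw [Multiset.count_map_eq_count' _ _ ng_inj]
    · rw [Multiset.count_eq_zero_of_notMem, Multiset.count_eq_zero_of_notMem]
      · exact fun hh => hφ (nf_mem h hh)
      · intro hh
        obtain ⟨ψ, hψ, rfl⟩ := Multiset.mem_map.1 hh
        exact hφ ⟨ng_monic (nf_mem h hψ).1, ng_irr (nf_mem h hψ).2⟩

/-- symmetric monic polynomials of degree `d` -/
def Ms (F : Type) [Field F] (d : ℕ) : Type := {f : F[X] // f.Monic ∧ f.natDegree = d ∧ ng f = f}

lemma card_Ms [Fintype F] (h2 : (2 : F) ≠ 0) (d : ℕ) : Nat.card (Ms F d) = Fintype.card F ^ (d / 2) := by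
  have : Fintype.card F ^ (d / 2) = Nat.card (Fin (d / 2) → F) := by simp
  rw [this]
  have h11 : (1 : F) ≠ -1 := fun h => h2 (by linear_combination h)
  refine Nat.card_congr (Equiv.ofBijective (fun f j => f.1.coeff (d - 2 * (j + 1))) ⟨?_, ?_⟩)
  · rintro ⟨f, hf, hd, hn⟩ ⟨g, hg, hd', hn'⟩ e
    apply Subtype.ext
    change f = g
    ext k
    rcases lt_trichotomy k d with hk | hk | hk
    · by_cases hp : Even (d - k)
      · obtain ⟨j, hj⟩ := hp
        have := congrFun e ⟨j - 1, by omega⟩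
        simp only at this
        rwa [show d - 2 * (j - 1 + 1) = k by omega] at this
      · have : ∀ f : F[X], f.natDegree = d → ng f = f → f.coeff k = 0 := by
          intro f hd hn
          have h3 := congrArg (fun f => f.coeff k) hn
          change (ng f).coeff k = f.coeff k at h3
          rw [ng_coeff, hd, Odd.neg_one_pow (by rcases Nat.not_even_iff_odd.1 hp with ⟨a, ha⟩; exact ⟨a + k, by omega⟩)] at h3
          have h4 : 2 * f.coeff k = 0 := by linear_combination -h3
          exact (mul_eq_zero.1 h4).resolve_left h2
        rw [this f hd hn, this g hd' hn']
    · subst hk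
      have a := hf.coeff_natDegree
      have b := hg.coeff_natDegree
      rw [hd] at a; rw [hd'] at b
      rw [a, b]
    · rw [coeff_eq_zero_of_natDegree_lt (by omega), coeff_eq_zero_of_natDegree_lt (by omega)]
  · intro c
    let g : F[X] := ∑ j : Fin (d / 2), C (c j) * X ^ (d - 2 * (j.1 + 1))
    have hgc : ∀ k, g.coeff k = ∑ j : Fin (d / 2), if k = d - 2 * (j.1 + 1) then c j else 0 := by
      intro k
      rw [finset_sum_coeff]
      exact Finset.sum_congr rfl fun j _ => by rw [coeff_C_mul_X_pow]
    have hdeg : g.degree < d := by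
      refine lt_of_le_of_lt (degree_sum_le _ _) ?_
      rw [Finset.sup_lt_iff (by exact WithBot.bot_lt_coe d)]
      intro j _
      refine lt_of_le_of_lt (degree_C_mul_X_pow_le _ _) ?_
      exact_mod_cast (show d - 2 * (j.1 + 1) < d by have := j.2; omega)
    have hm : (X ^ d + g).Monic := monic_X_pow_add hdeg
    have hnd : (X ^ d + g).natDegree = d := by
      rw [natDegree_add_eq_left_of_degree_lt (by rwa [degree_X_pow]), natDegree_X_pow]
    refine ⟨⟨X ^ d + g, hm, hnd, ?_⟩, ?_⟩
    · ext k
      rw [ng_coeff, hnd, coeff_add, coeff_X_pow, hgc]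
      by_cases hp : Even (d + k)
      · rw [hp.neg_one_pow, one_mul]
      · rw [if_neg (fun h => hp (by subst h; exact ⟨k, rfl⟩)), Finset.sum_eq_zero]
        · simp
        · intro j _
          rw [if_neg]
          intro h
          exact hp (by have := j.2; exact ⟨d - (j + 1), by omega⟩)
    · ext i
      simp only
      rw [coeff_add, coeff_X_pow, if_neg (by have := i.2; omega), zero_add, hgc, Finset.sum_eq_single i]
      · simp
      · intro b _ hb
        rw [if_neg]
        intro h
        exact hb (Fin.ext (by have := i.2; have := b.2; omega))
      · simp

end build

section cnt
variable {F : Type} [Field F] [Fintype F] {V : Type} [AddCommGroup V] [Module F V] [FiniteDimensional F V]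

open UniqueFactorizationMonoid in
lemma card_sy (h2 : (2 : F) ≠ 0) [Fintype (End F V)] [DecidablePred (Sy (F := F))] :
    (((TY (F := F) V).filter Sy).card : ℝ) =
      (Nat.Partition.genFun (fun _ c => (Fintype.card F : ℝ) ^ (c / 2))).coeff (finrank F V) := by
  classical
  set N := finrank F V with hN
  have key : Nat.card ((TY (F := F) V).filter Sy) =
      Nat.card (Σ p : N.Partition, (i : Fin N) → Ms F (p.parts.count (i.1 + 1))) := by
    symm
    let ff : (Σ p : N.Partition, (i : Fin N) → Ms F (p.parts.count (i.1 + 1))) → ℕ → F[X] :=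
      fun x i => if h : i < N then (x.2 ⟨i, h⟩).1 else 1
    have ffv : ∀ x i (h : i < N), ff x i = (x.2 ⟨i, h⟩).1 := fun x i h => dif_pos h
    have ffm : ∀ x i, (ff x i).Monic := by
      intro x i
      by_cases h : i < N
      · rw [ffv x i h]; exact (x.2 ⟨i, h⟩).2.1
      · simp only [ff, dif_neg h]; exact monic_one
    have ffd : ∀ x i, i < N → (ff x i).natDegree = x.1.parts.count (i + 1) := fun x i h => by
      rw [ffv x i h]; exact (x.2 ⟨i, h⟩).2.2.1
    have ffs : ∀ x i, i < N → ng (ff x i) = ff x i := fun x i h => by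
      rw [ffv x i h]; exact (x.2 ⟨i, h⟩).2.2.2
    have hdm : ∀ f : F[X], f.Monic → ((normalizedFactors f).map natDegree).sum = f.natDegree := by
      intro f hf
      rw [← natDegree_multiset_prod_of_monic _ (fun φ hφ => (nf_mem hf hφ).1), nf_prod hf]
    refine Nat.card_congr (Equiv.ofBijective (fun x => ⟨Psi N (fun i => normalizedFactors (ff x i)), ?_⟩) ⟨?_, ?_⟩)
    · rw [Finset.mem_filter, mem_TY]
      refine ⟨⟨Psi_vt _ _ fun i _ φ hφ => nf_mem (ffm x i) hφ, ?_⟩, ?_⟩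
      · rw [wt_Psi, ← hN]
        conv_rhs => rw [← part_sum x.1]
        refine Finset.sum_congr rfl fun i hi => ?_
        rw [hdm _ (ffm x i), ffd x i (Finset.mem_range.1 hi)]
      · intro φ h1 h2 i
        rw [Psi_apply, Psi_apply]
        split_ifs with h
        · exact (ng_fix_iff (ffm x i)).1 (ffs x i h) φ h1 h2
        · rfl
    · intro x y hxy
      have hxy' : Psi N (fun i => normalizedFactors (ff x i)) = Psi N (fun i => normalizedFactors (ff y i)) :=
        congrArg Subtype.val hxy
      have e : ∀ i < N, ff x i = ff y i := by
        intro i hi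
        rw [← nf_prod (ffm x i), ← nf_prod (ffm y i)]
        congr 1
        ext φ
        have := congrArg (fun n => n (φ, i)) hxy'
        change Psi N _ (φ, i) = Psi N _ (φ, i) at this
        rwa [Psi_apply, Psi_apply, if_pos hi, if_pos hi] at this
      have e1 : x.1 = y.1 := part_ext _ _ fun i hi => by rw [← ffd x i hi, ← ffd y i hi, e i hi]
      obtain ⟨p, f⟩ := x
      obtain ⟨p', f'⟩ := y
      simp only at e1
      subst e1
      congr 1
      funext i
      apply Subtype.ext
      have := e i.1 i.2
      rwa [ffv _ _ i.2, ffv _ _ i.2] at this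
    · rintro ⟨n, hn⟩
      rw [Finset.mem_filter, mem_TY] at hn
      obtain ⟨⟨hv, hw⟩, hs⟩ := hn
      have hm : ∀ i, ∀ φ ∈ mm n i, φ.Monic ∧ Irreducible φ := fun i φ hφ => hv _ ((mem_mm n i φ).1 hφ)
      have hnf : ∀ i, normalizedFactors (mm n i).prod = mm n i := fun i => nf_of_prod _ (hm i)
      have hmon : ∀ i, (mm n i).prod.Monic := fun i => by
        have := monic_multiset_prod_of_monic (mm n i) id (fun φ hφ => (hm i φ hφ).1)
        rwa [Multiset.map_id] at this
      have hw' : ∑ i ∈ Finset.range N, (i + 1) * (mm n i).prod.natDegree = N := by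
        conv_rhs => rw [hN, ← hw, ← Psi_mm N n hv hw, wt_Psi]
        refine Finset.sum_congr rfl fun i _ => ?_
        rw [natDegree_multiset_prod_of_monic _ (fun φ hφ => (hm i φ hφ).1)]
      obtain ⟨p, hp⟩ := exists_part (fun i => (mm n i).prod.natDegree) hw'
      refine ⟨⟨p, fun i => ⟨(mm n i).prod, hmon i, (hp i i.2).symm, ?_⟩⟩, ?_⟩
      · rw [ng_fix_iff (hmon i)]
        intro φ h1 h2
        rw [hnf, count_mm, count_mm, hs φ h1 h2]
      · apply Subtype.ext
        simp only
        conv_rhs => rw [← Psi_mm N n hv hw]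
        ext ⟨φ, j⟩
        rw [Psi_apply, Psi_apply]
        split_ifs with h
        · rw [ffv _ _ h]
          simp only
          rw [hnf]
        · rfl
  have fin : ∀ d, Finite (Ms F d) := fun d => Nat.finite_of_card_ne_zero (by
    rw [card_Ms h2]; exact pow_ne_zero _ Fintype.card_ne_zero)
  rw [Nat.card_eq_fintype_card, Fintype.card_coe] at key
  rw [key, Nat.card_sigma, Nat.Partition.coeff_genFun, Nat.cast_sum]
  refine Finset.sum_congr rfl fun p _ => ?_
  rw [part_prod _ _ (by simp), Nat.card_pi, Finset.prod_range, Nat.cast_prod]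
  refine Finset.prod_congr rfl fun i _ => ?_
  rw [card_Ms h2]; push_cast; rfl

/-- the number of pairs (endomorphism, non-degenerate skew form) -/
lemma R_eq (h2 : (2 : F) ≠ 0) [Fintype (End F V)] :
    ∑ A : End F V, (dF none A : ℝ) = glc F V *
      (Nat.Partition.genFun (fun _ c => (Fintype.card F : ℝ) ^ (c / 2))).coeff (finrank F V) := by
  classical
  rw [sum_dF, card_sy h2]

end cnt
end SpFF


set_option linter.all false
namespace SpFF
open Module Polynomial

section nilsum
variable {F : Type} [Field F] [Fintype F] {V : Type} [AddCommGroup V] [Module F V] [FiniteDimensional F V]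

lemma kd_X (A : End F V) (j : ℕ) : kd A (X ^ j) + rk A j = finrank F V := by
  have := LinearMap.finrank_range_add_finrank_ker (A ^ j)
  rw [kd, rk, map_pow, aeval_X]; omega

lemma mu_tp (A : End F V) (i : ℕ) : mu A i = tp A (X, i) := by
  have h := (tp_spec A).count monic_X irreducible_X i
  have h0 := kd_X A i
  have h1 := kd_X A (i + 1)
  have h2 := kd_X A (i + 2)
  rw [natDegree_X] at h
  rw [mu]; omega

lemma nil_iff (A : End F V) : A ^ finrank F V = 0 ↔ ∀ x, tp A x ≠ 0 → x.1 = X := by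
  classical
  constructor
  · intro h x hx
    by_contra hne
    obtain ⟨h1, h2⟩ := (tp_spec A).supp hx
    have hc : IsCoprime x.1 (X ^ finrank F V) := by
      apply IsCoprime.pow_right
      rw [h2.coprime_iff_not_dvd]
      intro hd
      exact hne (eq_of_monic_of_associated h1 monic_X (h2.associated_of_dvd irreducible_X hd))
    have hz : ∀ j, kd A (x.1 ^ j) = 0 := by
      intro j
      obtain ⟨a, b, hab⟩ := hc.pow_left (m := j)
      rw [kd, Submodule.finrank_eq_zero, eq_bot_iff]
      intro v hv
      have := congrArg (fun f => aeval A f v) hab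
      simp only [map_add, map_mul, map_one, End.one_apply, LinearMap.add_apply, End.mul_apply, LinearMap.mem_ker.1 hv,
        map_zero, map_pow, aeval_X, h, LinearMap.zero_apply, zero_add] at this
      have hv' : (aeval A x.1 ^ j) v = 0 := by rw [← map_pow]; exact hv
      rw [hv', map_zero, zero_add] at this
      rw [Submodule.mem_bot, ← this]
    have := (tp_spec A).count h1 h2 x.2
    rw [hz, hz, hz] at this
    have h3 := h2.natDegree_pos
    simp only [Prod.mk.eta, mul_zero, zero_add] at this
    rcases Nat.mul_eq_zero.1 this.symm with h | h
    · exact hx h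
    · omega
  · intro h
    obtain ⟨ι, _, p, e, hp, hn⟩ := tp_spec A
    have hX : ∀ k, p k = X := fun k => h (p k, e k) (by
      rw [hn]; exact Nat.card_ne_zero.2 ⟨⟨⟨k, rfl⟩⟩, inferInstance⟩)
    have h1 := hp.finrank_eq
    have h2 := hp.kd_eq monic_X irreducible_X (finrank F V)
    have h3 : kd A (X ^ finrank F V) = finrank F V := by
      rw [h2]
      conv_rhs => rw [h1]
      refine Finset.sum_congr rfl fun k _ => ?_
      rw [if_pos (hX k), hX k, natDegree_X]
      rw [min_eq_left]
      rw [h1]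
      have := Finset.single_le_sum (f := fun k => (e k + 1) * (p k).natDegree) (fun _ _ => Nat.zero_le _) (Finset.mem_univ k)
      simpa [hX k] using this
    have h4 : LinearMap.ker (A ^ finrank F V) = ⊤ := by
      apply Submodule.eq_top_of_finrank_eq
      rw [kd, map_pow, aeval_X] at h3
      exact h3
    exact LinearMap.ker_eq_top.1 h4

lemma nil_sum (g : ℕ → ℕ → ℝ) (hg : ∀ i, g i 0 = 1) [Fintype (End F V)] [DecidableEq (End F V)] :
    ∑ A : End F V, (if A ^ finrank F V = 0 then (cent A : ℝ) * ∏ i ∈ Finset.range (finrank F V), g (i + 1) (mu A i) else 0) =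
      glc F V * (Nat.Partition.genFun g).coeff (finrank F V) := by
  classical
  set N := finrank F V with hN
  have := sum_types (F := F) (V := V) (fun n => if (∀ x, n x ≠ 0 → x.1 = X) then ∏ i ∈ Finset.range N, g (i + 1) (n (X, i)) else 0)
  rw [← Finset.sum_filter] at this
  have e : ∑ n ∈ (TY (F := F) V).filter (fun n => ∀ x, n x ≠ 0 → x.1 = X), ∏ i ∈ Finset.range N, g (i + 1) (n (X, i)) =
      (Nat.Partition.genFun g).coeff N := by
    rw [Nat.Partition.coeff_genFun]
    symm
    let Q : N.Partition → (F[X] × ℕ →₀ ℕ) := fun p => Psi N (fun i => Multiset.replicate (p.parts.count (i + 1)) X)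
    have hQ : ∀ p i, i < N → Q p (X, i) = p.parts.count (i + 1) := fun p i hi => by
      simp only [Q]; rw [Psi_apply, if_pos hi, Multiset.count_replicate_self]
    refine Finset.sum_bij (fun p _ => Q p) ?_ ?_ ?_ ?_
    · intro p _
      rw [Finset.mem_filter, mem_TY]
      refine ⟨⟨Psi_vt _ _ fun i _ φ hφ => ?_, ?_⟩, ?_⟩
      · rw [Multiset.eq_of_mem_replicate hφ]; exact ⟨monic_X, irreducible_X⟩
      · simp only [Q]; rw [wt_Psi, ← hN]
        conv_rhs => rw [← part_sum p]
        refine Finset.sum_congr rfl fun i _ => by simp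
      · rintro ⟨φ, j⟩ hx
        simp only [Q] at hx
        rw [Psi_apply] at hx
        split_ifs at hx with h
        · exact Multiset.eq_of_mem_replicate (Multiset.count_ne_zero.1 hx)
        · exact absurd rfl hx
    · intro p _ p' _ h
      refine part_ext _ _ fun i hi => ?_
      rw [← hQ p i hi, ← hQ p' i hi, h]
    · intro n hn
      rw [Finset.mem_filter, mem_TY] at hn
      obtain ⟨⟨hv, hw⟩, hX⟩ := hn
      have hmm : ∀ i, mm n i = Multiset.replicate (n (X, i)) X := by
        intro i
        rw [Multiset.eq_replicate]
        have h1 : ∀ φ ∈ mm n i, φ = X := fun φ hφ => hX _ ((mem_mm n i φ).1 hφ)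
        refine ⟨?_, h1⟩
        rw [← count_mm, Multiset.count_eq_card.2 (fun x hx => (h1 x hx).symm)]
      have hw' : ∑ i ∈ Finset.range N, (i + 1) * n (X, i) = N := by
        conv_rhs => rw [hN, ← hw, ← Psi_mm N n hv hw, wt_Psi]
        exact Finset.sum_congr rfl fun i _ => by rw [hmm]; simp
      obtain ⟨p, hp⟩ := exists_part _ hw'
      refine ⟨p, Finset.mem_univ _, ?_⟩
      conv_rhs => rw [← Psi_mm N n hv hw]
      ext ⟨φ, j⟩
      simp only [Q]
      rw [Psi_apply, Psi_apply]
      split_ifs with h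
      · rw [hmm, hp j h]
      · rfl
    · intro p _
      rw [part_prod p g hg]
      exact Finset.prod_congr rfl fun i hi => by rw [hQ p i (Finset.mem_range.1 hi)]
  rw [e] at this
  rw [← this]
  refine Finset.sum_congr rfl fun A _ => ?_
  by_cases h : A ^ N = 0
  · rw [if_pos h, if_pos ((nil_iff A).1 h)]
    simp only [mu_tp]
  · rw [if_neg h, if_neg (fun h' => h ((nil_iff A).2 h')), mul_zero]

/-- commuting forms versus commuting endomorphisms -/
lemma nF_comm (B : End F V) (h : 0 < dF none B) : nF none B = Nat.card {A : End F V // A * B = B * A} := by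
  obtain ⟨β, hs, -, hn⟩ := (Nat.card_pos_iff.1 h).1
  let b : V ≃ₗ[F] Dual F V := LinearEquiv.ofBijective β ⟨(nd_inj β).1 hn, by
    refine (LinearMap.injective_iff_surjective_of_finrank_eq_finrank ?_).1 ((nd_inj β).1 hn)
    rw [Subspace.dual_finrank_eq]⟩
  have hb : ∀ x, b x = β x := fun x => rfl
  refine (Nat.card_congr (Equiv.ofBijective (fun A : {A : End F V // A * B = B * A} => (⟨(b.toLinearMap.comp A.1 : V →ₗ[F] Dual F V), ?_, typ_none _⟩ : {β : Bil F V // Sk B β ∧ Typ none β})) ⟨?_, ?_⟩)).symm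
  · intro x y
    have := LinearMap.congr_fun A.2 x
    change b (A.1 (B x)) y = - b (A.1 x) (B y)
    rw [hb, hb, ← hs]
    congr 2
  · intro A A' e
    apply Subtype.ext; ext x
    exact b.injective (congrArg (fun e => e.1 x) e)
  · rintro ⟨γ, hγ, -⟩
    refine ⟨⟨b.symm.toLinearMap.comp (γ : V →ₗ[F] Dual F V), ?_⟩, ?_⟩
    · ext x
      change b.symm (γ (B x)) = B (b.symm (γ x))
      rw [LinearEquiv.symm_apply_eq]
      ext y
      rw [hb, hs, ← hb, LinearEquiv.apply_symm_apply, hγ]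
    · apply Subtype.ext
      ext x y
      simp

/-- pairs of commuting endomorphisms, the second nilpotent -/
noncomputable def Pc (F V : Type) [Field F] [AddCommGroup V] [Module F V] : ℕ :=
  Nat.card {P : End F V × End F V // P.1 * P.2 = P.2 * P.1 ∧ IsNilpotent P.2}

lemma nilp_iff (A : End F V) : IsNilpotent A ↔ A ^ finrank F V = 0 := by
  constructor
  · rintro ⟨k, hk⟩
    have h1 := LinearMap.charpoly_eq_X_pow_iff (φ := A) |>.2 ?_
    · have := LinearMap.aeval_self_charpoly A
      rwa [h1, map_pow, aeval_X] at this
    · intro m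
      exact ⟨k, by rw [hk]; rfl⟩
  · exact fun h => ⟨_, h⟩

lemma Pc_eq : (Pc F V : ℝ) = glc F V *
    (Nat.Partition.genFun (fun _ c => (fg F).coeff c)).coeff (finrank F V) := by
  classical
  haveI : Finite V := Module.finite_of_finite F
  haveI : Finite (End F V) := Finite.of_injective (fun f : End F V => (f : V → V)) DFunLike.coe_injective
  haveI := Fintype.ofFinite (End F V)
  have hfg : ∀ c, (fg F).coeff c = (Fintype.card F : ℝ) ^ (c ^ 2) / Gl (Fintype.card F) c := fun c => by
    simp [fg]
  rw [← nil_sum _ (fun i => by rw [hfg]; simp [Gl, surjN])]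
  have h1 : Pc F V = ∑ B : End F V, if B ^ finrank F V = 0 then Nat.card {A : End F V // A * B = B * A} else 0 := by
    have : Pc F V = Nat.card (Σ B : End F V, {A : End F V // A * B = B * A ∧ IsNilpotent B}) := by
      refine Nat.card_congr ?_
      exact { toFun := fun P => ⟨P.1.2, P.1.1, P.2⟩, invFun := fun P => ⟨(P.2.1, P.1), P.2.2⟩
              left_inv := fun _ => rfl, right_inv := fun _ => rfl }
    rw [this, Nat.card_sigma]
    refine Finset.sum_congr rfl fun B _ => ?_
    split_ifs with h
    · refine Nat.card_congr (Equiv.subtypeEquivRight fun A => ?_)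
      rw [nilp_iff]; tauto
    · refine Nat.card_eq_zero.2 (Or.inl ⟨fun A => h ((nilp_iff _).1 A.2.2)⟩)
  rw [h1, Nat.cast_sum]
  refine Finset.sum_congr rfl fun B _ => ?_
  split_ifs with h
  · obtain ⟨h2, h3⟩ := nil_none (finrank F V) V B h
    have h2 : 0 < dF none B := by exact_mod_cast h2
    rw [← nF_comm B h2, h3, dF_cent B h2]
    simp only [hfg]
  · simp

end nilsum
end SpFF


set_option linter.all false
namespace SpFF
open Module Polynomial

section ycount
variable {F : Type} [Field F]
variable {V : Type} [AddCommGroup V] [Module F V]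

/-- commuting pairs in the Lie algebra of a nondegenerate `ε`-symmetric form -/
def LP (ε : F) (A B : End F V) (γ : Bil F V) : Prop :=
  A * B = B * A ∧ ND γ ∧ Typ (some ε) γ ∧ Sk A γ ∧ Sk B γ

def RP (A C : End F V) (β : Bil F V) : Prop :=
  A * C = C * A ∧ ND β ∧ Sk A β ∧ ∀ x y, β x y = β y (C x)

/-- generic structures: two endomorphisms and a form -/
abbrev Tr (F V : Type) [Field F] [AddCommGroup V] [Module F V] : Type := End F V × End F V × Bil F V

noncomputable def Yc (F V : Type) [Field F] [AddCommGroup V] [Module F V] : ℕ :=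
  Nat.card {t : Tr F V // LP 1 t.1 t.2.1 t.2.2 ∧ IsNilpotent t.2.1}

lemma end_finite [Finite F] [Finite V] : Finite (End F V) :=
  Finite.of_injective (fun f : End F V => (f : V → V)) DFunLike.coe_injective

noncomputable def bEq [FiniteDimensional F V] (β : Bil F V) (h : ND β) : V ≃ₗ[F] Dual F V :=
  LinearEquiv.ofBijective β ⟨(nd_inj β).1 h, by
    refine (LinearMap.injective_iff_surjective_of_finrank_eq_finrank ?_).1 ((nd_inj β).1 h)
    rw [Subspace.dual_finrank_eq]⟩

@[simp] lemma bEq_apply [FiniteDimensional F V] (β : Bil F V) (h : ND β) (x : V) : bEq β h x = β x := rfl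

lemma card_A [FiniteDimensional F V] (B : End F V) (γ : Bil F V) (hs : Sk B γ) (ht : Typ (some 1) γ)
    (hn : ND γ) : Nat.card {A : End F V // A * B = B * A ∧ Sk A γ} = nF (some (-1)) B := by
  have ht' : ∀ x y, γ y x = γ x y := fun x y => by simpa using ht 1 rfl x y
  refine Nat.card_congr (Equiv.ofBijective (fun A => (⟨γ.comp A.1, ?_, ?_⟩ : {β : Bil F V // Sk B β ∧ Typ (some (-1)) β})) ⟨?_, ?_⟩)
  · intro x y
    have := LinearMap.congr_fun A.2.1 x
    simp only [Module.End.mul_apply] at this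
    simp only [LinearMap.comp_apply]
    rw [this, hs]
  · intro ε hε x y
    obtain rfl : -1 = ε := by simpa using hε
    simp only [LinearMap.comp_apply]
    rw [A.2.2, ht']; ring
  · intro A A' e
    apply Subtype.ext; ext x
    exact (nd_inj γ).1 hn (congrArg (fun e => e.1 x) e)
  · rintro ⟨α, hα, hα2⟩
    have hα2 : ∀ x y, α y x = - α x y := fun x y => by simpa using hα2 (-1) rfl x y
    have key : ∀ x y, γ ((bEq γ hn).symm (α x)) y = α x y := fun x y => by
      rw [← bEq_apply γ hn, LinearEquiv.apply_symm_apply]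
    refine ⟨⟨(bEq γ hn).symm.toLinearMap.comp (α : V →ₗ[F] Dual F V), ?_, ?_⟩, ?_⟩
    · ext x
      change (bEq γ hn).symm (α (B x)) = B ((bEq γ hn).symm (α x))
      rw [LinearEquiv.symm_apply_eq]
      ext y
      rw [bEq_apply, hs, key, hα]
    · intro x y
      change γ ((bEq γ hn).symm (α x)) y = - γ x ((bEq γ hn).symm (α y))
      rw [key, ht', key, hα2]; 
    · apply Subtype.ext
      ext x y
      exact key x y

variable [Fintype F] [FiniteDimensional F V]

lemma Yc_eq (h2 : (2 : F) ≠ 0) : (Yc F V : ℝ) = glc F V *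
    (Nat.Partition.genFun (fun i c => if Odd i then (fs F).coeff c else (fa F).coeff c)).coeff (finrank F V) := by
  classical
  haveI : Finite V := Module.finite_of_finite F
  haveI : Finite (End F V) := end_finite
  haveI := Fintype.ofFinite (End F V)
  haveI := Fintype.ofFinite (Bil F V)
  have hfs : ∀ c, (fs F).coeff c = kap (1 : F) c := fun c => by
    simp [fs, kap]
  have hfa : ∀ c, (fa F).coeff c = kap (-1 : F) c := fun c => by
    simp [fa, kap]
  rw [← nil_sum _ (fun i => by
    split_ifs
    · rw [fs_eq h2, fa_eq h2]; simp [h2s, hc]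
    · rw [fa_eq h2]; simp [h2s, hc])]
  have h1 : Yc F V = ∑ B : End F V, if B ^ finrank F V = 0 then dF (some 1) B * nF (some (-1)) B else 0 := by
    have : Yc F V = Nat.card (Σ B : End F V, Σ γ : {γ : Bil F V // Sk B γ ∧ Typ (some 1) γ ∧ ND γ}, {A : End F V // (A * B = B * A ∧ Sk A γ.1) ∧ IsNilpotent B}) := by
      refine Nat.card_congr ?_
      exact { toFun := fun P => ⟨P.1.2.1, ⟨P.1.2.2, P.2.1.2.2.2.2, P.2.1.2.2.1, P.2.1.2.1⟩, P.1.1, ⟨P.2.1.1, P.2.1.2.2.2.1⟩, P.2.2⟩, invFun := fun P => ⟨(P.2.2.1, P.1, P.2.1.1), ⟨P.2.2.2.1.1, P.2.1.2.2.2, P.2.1.2.2.1, P.2.2.2.1.2, P.2.1.2.1⟩, P.2.2.2.2⟩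
              left_inv := fun _ => rfl, right_inv := fun _ => rfl }
    rw [this, Nat.card_sigma]
    refine Finset.sum_congr rfl fun B _ => ?_
    split_ifs with h
    · rw [Nat.card_sigma, Finset.sum_congr rfl (g := fun _ => nF (some (-1)) B), Finset.sum_const, Finset.card_univ, smul_eq_mul, ← Nat.card_eq_fintype_card]
      · rfl
      · intro γ _
        rw [← card_A B γ.1 γ.2.1 γ.2.2.1 γ.2.2.2]
        refine Nat.card_congr (Equiv.subtypeEquivRight fun A => ?_)
        rw [nilp_iff]; tauto
    · refine Nat.card_eq_zero.2 (Or.inl ⟨fun A => h ((nilp_iff _).1 A.2.2.2)⟩)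
  rw [h1, Nat.cast_sum]
  refine Finset.sum_congr rfl fun B _ => ?_
  split_ifs with h
  · obtain ⟨h4, h3⟩ := nil_none (finrank F V) V B h
    have h4 : 0 < dF none B := by exact_mod_cast h4
    rw [Nat.cast_mul, nil_prod h2 (finrank F V) 1 (Or.inl rfl) V B h, dF_cent B h4]
    congr 1
    refine Finset.prod_congr rfl fun i _ => ?_
    rcases Nat.even_or_odd i with hi | hi
    · rw [if_pos (Even.add_one hi), hfs, hi.neg_one_pow, mul_one]
    · rw [if_neg (by rw [Nat.not_odd_iff_even]; exact Odd.add_one hi), hfa, hi.neg_one_pow, mul_neg, mul_one]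
  · simp

end ycount
end SpFF


set_option linter.all false
namespace SpFF
open Module Polynomial

section fitting
variable {F : Type} [Field F]
variable {U V W U1 U2 : Type} [AddCommGroup V] [Module F V] [AddCommGroup U] [Module F U]
  [AddCommGroup W] [Module F W] [AddCommGroup U1] [Module F U1] [AddCommGroup U2] [Module F U2]

lemma comm_aeval {A B : End F V} (h : Commute A B) (p : F[X]) : Commute A (aeval B p) := by
  induction p using Polynomial.induction_on' with
  | add p q hp hq => rw [map_add]; exact hp.add_right hq
  | monomial n a =>
    rw [aeval_monomial]
    exact (show Commute A (algebraMap F _ a) from (Algebra.commutes a A).symm).mul_right (h.pow_right n)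

/-- transport of structure -/
noncomputable def tr (e : U ≃ₗ[F] V) (t : Tr F U) : Tr F V :=
  (e.conjAlgEquiv F t.1, e.conjAlgEquiv F t.2.1, pb e.symm t.2.2)

lemma tr_1 (e : U ≃ₗ[F] V) (t : Tr F U) (x : V) : (tr e t).1 x = e (t.1 (e.symm x)) := rfl
lemma tr_2 (e : U ≃ₗ[F] V) (t : Tr F U) (x : V) : (tr e t).2.1 x = e (t.2.1 (e.symm x)) := rfl
lemma tr_3 (e : U ≃ₗ[F] V) (t : Tr F U) (x y : V) : (tr e t).2.2 x y = t.2.2 (e.symm x) (e.symm y) := rfl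

lemma tr_ext {t t' : Tr F V} (h1 : ∀ x, t.1 x = t'.1 x) (h2 : ∀ x, t.2.1 x = t'.2.1 x)
    (h3 : ∀ x y, t.2.2 x y = t'.2.2 x y) : t = t' :=
  Prod.ext (LinearMap.ext h1) (Prod.ext (LinearMap.ext h2) (LinearMap.ext₂ h3))

lemma tr_tr (e : U ≃ₗ[F] V) (f : V ≃ₗ[F] W) (t : Tr F U) : tr f (tr e t) = tr (e.trans f) t := rfl

lemma tr_symm_tr (e : U ≃ₗ[F] V) (t : Tr F U) : tr e.symm (tr e t) = t := by
  apply tr_ext <;> intros <;> simp [tr_1, tr_2, tr_3]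
lemma tr_tr_symm (e : U ≃ₗ[F] V) (t : Tr F V) : tr e (tr e.symm t) = t := by
  apply tr_ext <;> intros <;> simp [tr_1, tr_2, tr_3]
lemma tr_inj (e : U ≃ₗ[F] V) : Function.Injective (tr e) :=
  Function.LeftInverse.injective (g := tr e.symm) (tr_symm_tr e)

lemma tr_aeval (e : U ≃ₗ[F] V) (t : Tr F U) (p : F[X]) (x : V) :
    aeval (tr e t).2.1 p x = e (aeval t.2.1 p (e.symm x)) := by
  have : (tr e t).2.1 = e.conjAlgEquiv F t.2.1 := rfl
  rw [this, aeval_algEquiv_apply]; rfl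
where aeval_algEquiv_apply : ∀ {a}, aeval (e.conjAlgEquiv F a) p = e.conjAlgEquiv F (aeval a p) := by
        intro a
        have := aeval_algHom_apply (e.conjAlgEquiv F).toAlgHom a p
        simpa using this

/-- direct sum of structures -/
noncomputable def sm (t1 : Tr F U1) (t2 : Tr F U2) : Tr F (U1 × U2) :=
  (t1.1.prodMap t2.1, t1.2.1.prodMap t2.2.1,
    t1.2.2.compl₁₂ (LinearMap.fst F U1 U2) (LinearMap.fst F U1 U2) +
    t2.2.2.compl₁₂ (LinearMap.snd F U1 U2) (LinearMap.snd F U1 U2))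

lemma sm_1 (t1 : Tr F U1) (t2 : Tr F U2) (x) : (sm t1 t2).1 x = (t1.1 x.1, t2.1 x.2) := rfl
lemma sm_2 (t1 : Tr F U1) (t2 : Tr F U2) (x) : (sm t1 t2).2.1 x = (t1.2.1 x.1, t2.2.1 x.2) := rfl
lemma sm_3 (t1 : Tr F U1) (t2 : Tr F U2) (x y) :
    (sm t1 t2).2.2 x y = t1.2.2 x.1 y.1 + t2.2.2 x.2 y.2 := rfl

lemma sm_aeval (t1 : Tr F U1) (t2 : Tr F U2) (p : F[X]) (x) :
    aeval (sm t1 t2).2.1 p x = (aeval t1.2.1 p x.1, aeval t2.2.1 p x.2) := by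
  have h := aeval_algHom_apply (LinearMap.prodMapAlgHom F U1 U2) (t1.2.1, t2.2.1) p
  have h2 : (sm t1 t2).2.1 = LinearMap.prodMapAlgHom F U1 U2 (t1.2.1, t2.2.1) := rfl
  rw [h2, h, aeval_prod_apply]; rfl

lemma sm_inj {t1 t1' : Tr F U1} {t2 t2' : Tr F U2} (h : sm t1 t2 = sm t1' t2') : t1 = t1' ∧ t2 = t2' := by
  constructor
  · apply tr_ext
    · intro x; have := congrArg (fun t : Tr F (U1 × U2) => (t.1 (x, 0)).1) h; simpa [sm_1] using this
    · intro x; have := congrArg (fun t : Tr F (U1 × U2) => (t.2.1 (x, 0)).1) h; simpa [sm_2] using this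
    · intro x y; have := congrArg (fun t : Tr F (U1 × U2) => (t.2.2 (x, 0) (y, 0))) h; simpa [sm_3] using this
  · apply tr_ext
    · intro x; have := congrArg (fun t : Tr F (U1 × U2) => (t.1 (0, x)).2) h; simpa [sm_1] using this
    · intro x; have := congrArg (fun t : Tr F (U1 × U2) => (t.2.1 (0, x)).2) h; simpa [sm_2] using this
    · intro x y; have := congrArg (fun t : Tr F (U1 × U2) => (t.2.2 (0, x) (0, y))) h; simpa [sm_3] using this

lemma tr_sm (g1 : U1 ≃ₗ[F] U1) (g2 : U2 ≃ₗ[F] U2) (t1 : Tr F U1) (t2 : Tr F U2) :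
    tr (g1.prodCongr g2) (sm t1 t2) = sm (tr g1 t1) (tr g2 t2) := by
  apply tr_ext <;> intros <;> rfl

/-- a family of structures with an orthogonal Fitting decomposition -/
structure Fam (F : Type) [Field F] where
  Pr : ∀ (V : Type) [AddCommGroup V] [Module F V], Tr F V → Prop
  p : F[X]
  htr : ∀ {U V : Type} [AddCommGroup V] [Module F V] [AddCommGroup U] [Module F U] (e : U ≃ₗ[F] V)
    (t : Tr F U), Pr U t → Pr V (tr e t)
  hsm : ∀ {U V : Type} [AddCommGroup V] [Module F V] [AddCommGroup U] [Module F U] (t : Tr F U) (t' : Tr F V),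
    Pr (U × V) (sm t t') ↔ Pr U t ∧ Pr V t'
  comm : ∀ {V : Type} [AddCommGroup V] [Module F V] [FiniteDimensional F V] (t : Tr F V), Pr V t → t.1 * t.2.1 = t.2.1 * t.1
  orth : ∀ {V : Type} [AddCommGroup V] [Module F V] [FiniteDimensional F V] (t : Tr F V), Pr V t → ∀ (k : ℕ) (x y : V),
    aeval t.2.1 (p ^ k) x = 0 → t.2.2 x (aeval t.2.1 (p ^ k) y) = 0 ∧ t.2.2 (aeval t.2.1 (p ^ k) y) x = 0

namespace Fam
variable (𝓕 : Fam F)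

noncomputable def tot (V : Type) [AddCommGroup V] [Module F V] : ℕ := Nat.card {t : Tr F V // 𝓕.Pr V t}
noncomputable def nil (V : Type) [AddCommGroup V] [Module F V] : ℕ :=
  Nat.card {t : Tr F V // 𝓕.Pr V t ∧ IsNilpotent (aeval t.2.1 𝓕.p)}
noncomputable def inv (V : Type) [AddCommGroup V] [Module F V] : ℕ :=
  Nat.card {t : Tr F V // 𝓕.Pr V t ∧ IsUnit (aeval t.2.1 𝓕.p)}

lemma split_aut {p : F[X]} {t1 t1' : Tr F U1} {t2 t2' : Tr F U2}
    (h1 : IsNilpotent (aeval t1.2.1 p)) (h1' : IsNilpotent (aeval t1'.2.1 p))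
    (h2 : IsUnit (aeval t2.2.1 p)) (h2' : IsUnit (aeval t2'.2.1 p))
    (f : (U1 × U2) ≃ₗ[F] (U1 × U2)) (hf : tr f (sm t1 t2) = sm t1' t2') :
    (∀ x, (f (x, 0)).2 = 0) ∧ (∀ y, (f (0, y)).1 = 0) := by
  obtain ⟨k, hk⟩ := h1
  obtain ⟨k', hk'⟩ := h1'
  have key : ∀ (n : ℕ) z, aeval (sm t1' t2').2.1 (p ^ n) (f z) = f (aeval (sm t1 t2).2.1 (p ^ n) z) := by
    intro n z
    rw [← hf, tr_aeval]; simp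
  constructor
  · intro x
    have := key k (x, 0)
    rw [sm_aeval, sm_aeval] at this
    simp only [map_pow, hk, map_zero, LinearMap.zero_apply] at this
    rw [Prod.mk_zero_zero, map_zero] at this
    have h3 := (Prod.ext_iff.1 this).2
    simp only [Prod.snd_zero] at h3
    have h4 := (Module.End.isUnit_iff _).1 (h2'.pow k)
    exact h4.1 (by rw [h3, map_zero])
  · intro y
    obtain ⟨y', rfl⟩ := ((Module.End.isUnit_iff _).1 (h2.pow k')).2 y
    have := key k' (0, y')
    rw [sm_aeval, sm_aeval] at this
    simp only [map_pow, hk', map_zero, LinearMap.zero_apply] at this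
    rw [← this]

lemma exists_split {p : F[X]} {t1 t1' : Tr F U1} {t2 t2' : Tr F U2}
    (h1 : IsNilpotent (aeval t1.2.1 p)) (h1' : IsNilpotent (aeval t1'.2.1 p))
    (h2 : IsUnit (aeval t2.2.1 p)) (h2' : IsUnit (aeval t2'.2.1 p))
    (f : (U1 × U2) ≃ₗ[F] (U1 × U2)) (hf : tr f (sm t1 t2) = sm t1' t2') :
    ∃ g1 : U1 ≃ₗ[F] U1, ∃ g2 : U2 ≃ₗ[F] U2, f = g1.prodCongr g2 := by
  obtain ⟨ha, hb⟩ := split_aut h1 h1' h2 h2' f hf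
  obtain ⟨ha', hb'⟩ := split_aut h1' h1 h2' h2 f.symm (by rw [← hf, tr_symm_tr])
  have e1 : ∀ x, f (x, 0) = ((f (x, 0)).1, 0) := fun x => Prod.ext rfl (ha x)
  have e2 : ∀ x, f (0, x) = (0, (f (0, x)).2) := fun x => Prod.ext (hb x) rfl
  have e1' : ∀ x, f.symm (x, 0) = ((f.symm (x, 0)).1, 0) := fun x => Prod.ext rfl (ha' x)
  have e2' : ∀ x, f.symm (0, x) = (0, (f.symm (0, x)).2) := fun x => Prod.ext (hb' x) rfl
  refine ⟨LinearEquiv.ofLinear ((LinearMap.fst F U1 U2).comp (f.toLinearMap.comp (LinearMap.inl F U1 U2)))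
    ((LinearMap.fst F U1 U2).comp (f.symm.toLinearMap.comp (LinearMap.inl F U1 U2))) ?_ ?_,
    LinearEquiv.ofLinear ((LinearMap.snd F U1 U2).comp (f.toLinearMap.comp (LinearMap.inr F U1 U2)))
    ((LinearMap.snd F U1 U2).comp (f.symm.toLinearMap.comp (LinearMap.inr F U1 U2))) ?_ ?_, ?_⟩
  · ext x; simp [← e1']
  · ext x; simp [← e1]
  · ext x; simp [← e2']
  · ext x; simp [← e2]
  · ext x : 1
    obtain ⟨x, y⟩ := x
    have : (x, y) = (x, (0 : U2)) + ((0 : U1), y) := by simp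
    rw [this, map_add, e1, e2]
    simp

variable [Fintype F] [FiniteDimensional F U1] [FiniteDimensional F U2] [FiniteDimensional F V]

lemma fit_one (hd : finrank F V = finrank F U1 + finrank F U2) :
    glc F V * (𝓕.nil U1 * 𝓕.inv U2) = glc F U1 * glc F U2 *
      Nat.card {t : Tr F V // 𝓕.Pr V t ∧ kd t.2.1 (𝓕.p ^ finrank F V) = finrank F U1} := by
  classical
  let E := (U1 × U2) ≃ₗ[F] V
  let X1 := {t : Tr F U1 // 𝓕.Pr U1 t ∧ IsNilpotent (aeval t.2.1 𝓕.p)}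
  let X2 := {t : Tr F U2 // 𝓕.Pr U2 t ∧ IsUnit (aeval t.2.1 𝓕.p)}
  let Φ : E × X1 × X2 → Tr F V := fun z => tr z.1 (sm z.2.1.1 z.2.2.1)
  have hnil : ∀ (g : U1 ≃ₗ[F] U1) (t : Tr F U1), IsNilpotent (aeval t.2.1 𝓕.p) → IsNilpotent (aeval (tr g t).2.1 𝓕.p) := by
    rintro g t ⟨k, hk⟩
    refine ⟨k, ?_⟩
    rw [← map_pow]
    ext x; rw [tr_aeval, map_pow, hk]; simp
  have hunit : ∀ (g : U2 ≃ₗ[F] U2) (t : Tr F U2), IsUnit (aeval t.2.1 𝓕.p) → IsUnit (aeval (tr g t).2.1 𝓕.p) := by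
    intro g t h
    rw [Module.End.isUnit_iff] at h ⊢
    have : (aeval (tr g t).2.1 𝓕.p : U2 → U2) = g ∘ (aeval t.2.1 𝓕.p) ∘ g.symm := by
      ext x; rw [tr_aeval]; rfl
    rw [this]
    exact g.bijective.comp (h.comp g.symm.bijective)
  let act : ((U1 ≃ₗ[F] U1) × (U2 ≃ₗ[F] U2)) → E × X1 × X2 → E × X1 × X2 := fun g z =>
    ((g.1.prodCongr g.2).symm.trans z.1, ⟨tr g.1 z.2.1.1, 𝓕.htr _ _ z.2.1.2.1, hnil _ _ z.2.1.2.2⟩,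
      ⟨tr g.2 z.2.2.1, 𝓕.htr _ _ z.2.2.2.1, hunit _ _ z.2.2.2.2⟩)
  have h := card_orbit act Φ ?_ ?_
  · have hE : Nat.card E = glc F V := by
      have e : (U1 × U2) ≃ₗ[F] V := LinearEquiv.ofFinrankEq _ _ (by rw [finrank_prod, hd])
      rw [card_equiv_eq e, glc_congr e]
    have hP : Nat.card (E × X1 × X2) = glc F V * (𝓕.nil U1 * 𝓕.inv U2) := by
      rw [Nat.card_prod, Nat.card_prod, hE]; rfl
    rw [← hP, h, Nat.card_prod]
    congr 1
    refine Nat.card_congr (Equiv.setCongr ?_)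
    ext t
    constructor
    · rintro ⟨⟨e, t1, t2⟩, rfl⟩
      refine ⟨𝓕.htr _ _ ((𝓕.hsm _ _).2 ⟨t1.2.1, t2.2.1⟩), ?_⟩
      change kd (tr e (sm t1.1 t2.1)).2.1 _ = _
      rw [← kd_conj e (A := (sm t1.1 t2.1).2.1) (fun x => by simp [tr_2])]
      have h1 : aeval t1.1.2.1 𝓕.p ^ finrank F V = 0 := by
        rw [hd, pow_add, (nilp_iff _).1 t1.2.2, zero_mul]
      have h2 := ((Module.End.isUnit_iff _).1 (t2.2.2.pow (finrank F V))).1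
      have : LinearMap.ker (aeval (sm t1.1 t2.1).2.1 (𝓕.p ^ finrank F V)) = LinearMap.range (LinearMap.inl F U1 U2) := by
        ext ⟨x, y⟩
        rw [LinearMap.mem_ker, sm_aeval, map_pow, map_pow, h1]
        simp only [LinearMap.zero_apply, LinearMap.mem_range, LinearMap.inl_apply, Prod.mk.injEq, Prod.mk_eq_zero, true_and, exists_eq_left]
        constructor
        · intro h; exact (h2 (by rw [h, map_zero])).symm
        · rintro rfl; simp
      rw [kd, this, LinearMap.finrank_range_of_inj LinearMap.inl_injective]
    · rintro ⟨hPr, hk⟩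
      set N := finrank F V
      set T := aeval t.2.1 (𝓕.p ^ N) with hT
      have hTp : T = (aeval t.2.1 𝓕.p) ^ N := by rw [hT, map_pow]
      have hdis : Disjoint (LinearMap.ker T) (LinearMap.range T) := by
        rw [Submodule.disjoint_def]
        rintro _ hx ⟨y, rfl⟩
        have h3 : y ∈ LinearMap.ker ((aeval t.2.1 𝓕.p) ^ (N + N)) := by
          rw [LinearMap.mem_ker, pow_add, ← hTp]; exact hx
        rw [Module.End.ker_pow_eq_ker_pow_finrank_of_le (by omega : finrank F V ≤ N + N)] at h3
        rw [hTp]; exact h3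
      have hfr : finrank F (LinearMap.range T) = finrank F U2 := by
        have := LinearMap.finrank_range_add_finrank_ker T
        change _ + kd t.2.1 _ = _ at this
        omega
      have hc : IsCompl (LinearMap.ker T) (LinearMap.range T) := by
        refine ⟨hdis, ?_⟩
        rw [codisjoint_iff]
        apply Submodule.eq_top_of_finrank_eq
        have := Submodule.finrank_sup_add_finrank_inf_eq (LinearMap.ker T) (LinearMap.range T)
        rw [hdis.eq_bot, finrank_bot, add_zero] at this
        rw [this, add_comm, LinearMap.finrank_range_add_finrank_ker]
      let e1 : U1 ≃ₗ[F] LinearMap.ker T := LinearEquiv.ofFinrankEq _ _ hk.symm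
      let e2 : U2 ≃ₗ[F] LinearMap.range T := LinearEquiv.ofFinrankEq _ _ hfr.symm
      let e : (U1 × U2) ≃ₗ[F] V := (e1.prodCongr e2).trans (Submodule.prodEquivOfIsCompl _ _ hc)
      have he : ∀ x y, e (x, y) = (e1 x : V) + e2 y := fun x y => rfl
      have hek : ∀ v, v ∈ LinearMap.ker T → (e.symm v).2 = 0 := by
        intro v hv
        have : v = e (e1.symm ⟨v, hv⟩, 0) := by rw [he]; simp
        rw [this]; simp
      have her : ∀ v, v ∈ LinearMap.range T → (e.symm v).1 = 0 := by
        intro v hv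
        have : v = e (0, e2.symm ⟨v, hv⟩) := by rw [he]; simp
        rw [this]; simp
      have hA := 𝓕.comm t hPr
      have hAT : Commute t.1 T := by
        rw [hT]
        have : Commute t.1 t.2.1 := hA
        exact comm_aeval this _
      have hBT : Commute t.2.1 T := by
        rw [hT]
        exact comm_aeval (Commute.refl _) _
      have ck : ∀ (D : End F V), Commute D T → ∀ v ∈ LinearMap.ker T, D v ∈ LinearMap.ker T := by
        intro D hD v hv
        have := LinearMap.congr_fun hD.eq v
        simp only [Module.End.mul_apply] at this
        rw [LinearMap.mem_ker, ← this, LinearMap.mem_ker.1 hv, map_zero]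
      have cr : ∀ (D : End F V), Commute D T → ∀ v ∈ LinearMap.range T, D v ∈ LinearMap.range T := by
        rintro D hD _ ⟨v, rfl⟩
        have := LinearMap.congr_fun hD.eq v
        simp only [Module.End.mul_apply] at this
        rw [this]; exact ⟨_, rfl⟩
      have ho := 𝓕.orth t hPr N
      set t' := tr e.symm t with ht'
      let i1 := LinearMap.inl F U1 U2
      let i2 := LinearMap.inr F U1 U2
      let t1 : Tr F U1 := ((LinearMap.fst F U1 U2).comp (t'.1.comp i1), (LinearMap.fst F U1 U2).comp (t'.2.1.comp i1), t'.2.2.compl₁₂ i1 i1)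
      let t2 : Tr F U2 := ((LinearMap.snd F U1 U2).comp (t'.1.comp i2), (LinearMap.snd F U1 U2).comp (t'.2.1.comp i2), t'.2.2.compl₁₂ i2 i2)
      have hend : ∀ (D : End F V), Commute D T → ∀ z : U1 × U2, e.symm (D (e z)) = ((e.symm (D (e (z.1, 0)))).1, (e.symm (D (e (0, z.2)))).2) := by
        intro D hD z
        obtain ⟨x, y⟩ := z
        have h1 : (e.symm (D (e (x, 0)))).2 = 0 := hek _ (ck D hD _ (by rw [he]; simp))
        have h2 : (e.symm (D (e (0, y)))).1 = 0 := her _ (cr D hD _ (by rw [he]; simp))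
        have : (x, y) = (x, (0 : U2)) + ((0 : U1), y) := by simp
        rw [this, map_add, map_add, map_add]
        ext
        · simp [h2]
        · simp [h1]
      have hsm : t' = sm t1 t2 := by
        apply tr_ext
        · intro z; exact hend _ hAT z
        · intro z; exact hend _ hBT z
        · rintro ⟨x, y⟩ ⟨x', y'⟩
          change t.2.2 (e (x, y)) (e (x', y')) = t.2.2 (e (x, 0)) (e (x', 0)) + t.2.2 (e (0, y)) (e (0, y'))
          simp only [he, map_zero, Submodule.coe_zero, add_zero, zero_add, map_add, LinearMap.add_apply]
          obtain ⟨w, hw⟩ := (e2 y).2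
          obtain ⟨w', hw'⟩ := (e2 y').2
          have := (ho (e1 x) w' (e1 x).2).1
          have := (ho (e1 x') w (e1 x').2).2
          rw [← hw, ← hw']
          simp_all
      have hPr' : 𝓕.Pr _ (sm t1 t2) := hsm ▸ 𝓕.htr e.symm t hPr
      rw [𝓕.hsm] at hPr'
      have hTT : ∀ (p : F[X]) z, aeval (sm t1 t2).2.1 p z = e.symm (aeval t.2.1 p (e z)) := by
        intro p z
        rw [← hsm, ht', tr_aeval]; rfl
      refine ⟨(e, ⟨t1, hPr'.1, ⟨N, ?_⟩⟩, ⟨t2, hPr'.2, ?_⟩), ?_⟩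
      · ext x
        have h4 := hTT (𝓕.p ^ N) (x, 0)
        rw [sm_aeval, ← hT, (LinearMap.mem_ker.1 (by rw [he]; simp) : T (e (x, 0)) = 0), map_zero] at h4
        have := (Prod.ext_iff.1 h4).1
        rw [map_pow] at this
        simpa using this
      · rw [LinearMap.isUnit_iff_ker_eq_bot, LinearMap.ker_eq_bot']
        intro y hy
        have h4 := hTT 𝓕.p (0, y)
        rw [sm_aeval] at h4
        simp only [hy, map_zero] at h4
        have h5 := (map_eq_zero_iff _ e.symm.injective).1 (h4.symm.trans Prod.mk_zero_zero)
        have h6 : e (0, y) ∈ LinearMap.ker T := by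
          rw [LinearMap.mem_ker, hTp]
          rcases Nat.eq_zero_or_pos N with h0 | h0
          · haveI : Subsingleton V := finrank_zero_iff.1 h0
            exact Subsingleton.elim _ _
          · obtain ⟨m, hm⟩ := Nat.exists_eq_succ_of_ne_zero h0.ne'
            rw [hm, pow_succ, Module.End.mul_apply, h5, map_zero]
        have := hek _ h6
        simpa using this
      · change tr e (sm t1 t2) = t
        rw [← hsm, ht', tr_tr_symm]
  · rintro ⟨e, t1, t2⟩ ⟨g1, g2⟩ ⟨g1', g2'⟩ h
    have h1 : ∀ z, e ((g1.prodCongr g2).symm z) = e ((g1'.prodCongr g2').symm z) := fun z =>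
      LinearEquiv.congr_fun (congrArg Prod.fst h) z
    have h2 : (g1.prodCongr g2).symm = (g1'.prodCongr g2').symm := LinearEquiv.ext fun z => e.injective (h1 z)
    have h3 : g1.prodCongr g2 = g1'.prodCongr g2' := by
      rw [← LinearEquiv.symm_symm (g1.prodCongr g2), h2, LinearEquiv.symm_symm]
    refine Prod.ext ?_ ?_
    · ext x; simpa using congrArg Prod.fst (LinearEquiv.congr_fun h3 (x, 0))
    · ext x; simpa using congrArg Prod.snd (LinearEquiv.congr_fun h3 (0, x))
  · rintro ⟨e, t1, t2⟩ ⟨e', t1', t2'⟩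
    constructor
    · intro h
      have hf : tr (e.trans e'.symm) (sm t1.1 t2.1) = sm t1'.1 t2'.1 := by
        rw [← tr_tr]
        have : tr e (sm t1.1 t2.1) = tr e' (sm t1'.1 t2'.1) := h
        rw [this, tr_symm_tr]
      obtain ⟨g1, g2, hg⟩ := exists_split t1.2.2 t1'.2.2 t2.2.2 t2'.2.2 _ hf
      rw [hg, tr_sm] at hf
      obtain ⟨ha, hb⟩ := sm_inj hf
      refine ⟨(g1, g2), ?_⟩
      refine Prod.ext ?_ (Prod.ext (Subtype.ext ha) (Subtype.ext hb))
      change (g1.prodCongr g2).symm.trans e = e'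
      rw [← hg]
      ext z; simp
    · rintro ⟨⟨g1, g2⟩, h⟩
      rw [← h]
      change tr e (sm t1.1 t2.1) = tr ((g1.prodCongr g2).symm.trans e) (sm (tr g1 t1.1) (tr g2 t2.1))
      rw [← tr_sm, tr_tr]
      congr 1
      ext z; simp

end Fam
end fitting
end SpFF


set_option linter.all false
namespace SpFF
open Module Polynomial

section fams
variable {F : Type} [Field F]
variable {V : Type} [AddCommGroup V] [Module F V]

/-- normalised generating function of a count -/
noncomputable def ser (F : Type) [Field F] (c : ℕ → ℕ) : PowerSeries ℝ :=
  PowerSeries.mk fun n => (c n : ℝ) / glc F (Fin n → F)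

lemma Fam.tot_eq [Fintype F] (𝓕 : Fam F) :
    ser F (fun n => 𝓕.tot (Fin n → F)) = ser F (fun n => 𝓕.nil (Fin n → F)) * ser F (fun n => 𝓕.inv (Fin n → F)) := by
  classical
  ext n
  rw [PowerSeries.coeff_mul]
  simp only [ser, PowerSeries.coeff_mk]
  have hg : ∀ m, (0 : ℝ) < glc F (Fin m → F) := fun m => by exact_mod_cast glc_pos
  rw [div_eq_iff (hg n).ne', Finset.sum_mul]
  haveI : Finite (End F (Fin n → F)) := end_finite
  have h1 : 𝓕.tot (Fin n → F) = ∑ a ∈ Finset.range (n + 1),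
      Nat.card {t : Tr F (Fin n → F) // 𝓕.Pr _ t ∧ kd t.2.1 (𝓕.p ^ finrank F (Fin n → F)) = a} := by
    haveI := Fintype.ofFinite (Tr F (Fin n → F))
    simp only [Fam.tot, Nat.card_eq_fintype_card, Fintype.card_subtype]
    rw [Finset.card_eq_sum_card_fiberwise (t := Finset.range (n + 1)) (f := fun t : Tr F (Fin n → F) => kd t.2.1 (𝓕.p ^ finrank F (Fin n → F)))]
    · simp only [Finset.filter_filter]
    · intro t _
      have := Submodule.finrank_le (LinearMap.ker (aeval t.2.1 (𝓕.p ^ finrank F (Fin n → F))))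
      simp only [Finset.coe_range, Set.mem_Iio]
      rw [kd]
      rw [finrank_fin_fun] at this
      rw [finrank_fin_fun]
      omega
  rw [h1, Nat.cast_sum, ← Finset.Nat.sum_antidiagonal_eq_sum_range_succ_mk (fun ab : ℕ × ℕ => ((Nat.card {t : Tr F (Fin n → F) // 𝓕.Pr _ t ∧ kd t.2.1 (𝓕.p ^ finrank F (Fin n → F)) = ab.1} : ℕ) : ℝ))]
  refine Finset.sum_congr rfl fun ab hab => ?_
  have hab : ab.1 + ab.2 = n := by simpa using hab
  have h2 := 𝓕.fit_one (U1 := Fin ab.1 → F) (U2 := Fin ab.2 → F) (V := Fin n → F) (by simp [hab])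
  have h2' := congrArg (Nat.cast : ℕ → ℝ) h2
  push_cast at h2'
  have e1 := (hg ab.1).ne'
  have e2 := (hg ab.2).ne'
  rw [finrank_fin_fun F (n := ab.1)] at h2'
  field_simp
  linarith

lemma ND.flip [FiniteDimensional F V] {β : Bil F V} (h : ND β) {y : V} (hy : ∀ x, β x y = 0) : y = 0 := by
  rw [← Module.forall_dual_apply_eq_zero_iff F]
  intro f
  obtain ⟨x, rfl⟩ := (bEq β h).surjective f
  exact hy x

lemma ND.ext [FiniteDimensional F V] {β : Bil F V} (h : ND β) {y z : V} (hy : ∀ x, β x y = β x z) : y = z := by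
  rw [← sub_eq_zero]
  exact h.flip fun x => by rw [map_sub, hy, sub_self]

/-- the family of commuting pairs in the symplectic (or orthogonal) Lie algebra -/
noncomputable def famL (ε : F) : Fam F where
  Pr V _ _ t := LP ε t.1 t.2.1 t.2.2
  p := 1 - X ^ 2
  htr := by
    intro U V _ _ _ _ e t h
    obtain ⟨h1, h2, h3, h4, h5⟩ := h
    refine ⟨?_, (pb_nd _ _).2 h2, (pb_typ _ _ _).2 h3, (pb_sk e.symm _ _ (fun x => by simp [tr_1]) _).2 h4, (pb_sk e.symm _ _ (fun x => by simp [tr_2]) _).2 h5⟩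
    change e.conjAlgEquiv F t.1 * e.conjAlgEquiv F t.2.1 = _
    rw [← map_mul, h1, map_mul]; rfl
  hsm := by
    intro U V _ _ _ _ t t'
    constructor
    · rintro ⟨h1, h2, h3, h4, h5⟩
      refine ⟨⟨?_, ?_, ?_, ?_, ?_⟩, ⟨?_, ?_, ?_, ?_, ?_⟩⟩
      · ext x; simpa [sm_1, sm_2] using congrArg (fun f : End F (U × V) => (f (x, 0)).1) h1
      · intro x hx
        have := h2 (x, 0) (fun y => by simp [sm_3, hx])
        simpa using this
      · intro ε hε x y
        simpa [sm_3] using h3 ε hε (x, 0) (y, 0)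
      · intro x y; simpa [sm_3, sm_1] using h4 (x, 0) (y, 0)
      · intro x y; simpa [sm_3, sm_2] using h5 (x, 0) (y, 0)
      · ext x; simpa [sm_1, sm_2] using congrArg (fun f : End F (U × V) => (f (0, x)).2) h1
      · intro x hx
        have := h2 (0, x) (fun y => by simp [sm_3, hx])
        simpa using this
      · intro ε hε x y
        simpa [sm_3] using h3 ε hε (0, x) (0, y)
      · intro x y; simpa [sm_3, sm_1] using h4 (0, x) (0, y)
      · intro x y; simpa [sm_3, sm_2] using h5 (0, x) (0, y)
    · rintro ⟨⟨h1, h2, h3, h4, h5⟩, ⟨g1, g2, g3, g4, g5⟩⟩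
      refine ⟨?_, ?_, ?_, ?_, ?_⟩
      · refine LinearMap.ext fun x => Prod.ext (LinearMap.congr_fun h1 x.1) (LinearMap.congr_fun g1 x.2)
      · rintro ⟨x, y⟩ hx
        refine Prod.ext (h2 _ fun z => ?_) (g2 _ fun z => ?_)
        · simpa [sm_3] using hx (z, 0)
        · simpa [sm_3] using hx (0, z)
      · intro ε hε x y
        simp only [sm_3]
        rw [h3 ε hε x.1, g3 ε hε x.2]; ring
      · intro x y
        simp only [sm_3, sm_1]
        rw [h4, g4]; ring
      · intro x y
        simp only [sm_3, sm_2]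
        rw [h5, g5]; ring
  comm := fun t h => h.1
  orth := by
    intro V _ _ _ t h k x y hx
    obtain ⟨h1, h2, h3, h4, h5⟩ := h
    have e1 : ∀ x y, t.2.2 (aeval t.2.1 (1 - X ^ 2 : F[X]) x) y = t.2.2 x (aeval t.2.1 (1 - X ^ 2 : F[X]) y) := by
      intro x y
      simp only [pow_two, map_sub, map_one, map_mul, aeval_X, LinearMap.sub_apply, Module.End.one_apply, Module.End.mul_apply]
      rw [h5, h5, neg_neg]
    have e2 : ∀ k x y, t.2.2 (aeval t.2.1 ((1 - X ^ 2 : F[X]) ^ k) x) y = t.2.2 x (aeval t.2.1 ((1 - X ^ 2 : F[X]) ^ k) y) := by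
      intro k
      induction k with
      | zero => simp
      | succ k ih =>
        intro x y
        rw [pow_succ, map_mul, Module.End.mul_apply, ih, e1, ← Module.End.mul_apply, ← map_mul, ← map_mul, mul_comm]
    exact ⟨by rw [← e2, hx]; simp, by rw [e2, hx]; simp⟩

lemma RP.iso {A C : End F V} {β : Bil F V} (h : ∀ x y, β x y = β y (C x)) (x y : V) : β (C x) (C y) = β x y := by
  rw [← h, ← h]

/-- the family of pairs of a nondegenerate form and a skew endomorphism -/
noncomputable def famR (F : Type) [Field F] : Fam F where
  Pr V _ _ t := RP t.1 t.2.1 t.2.2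
  p := X - 1
  htr := by
    intro U V _ _ _ _ e t h
    obtain ⟨h1, h2, h3, h4⟩ := h
    refine ⟨?_, (pb_nd _ _).2 h2, (pb_sk e.symm _ _ (fun x => by simp [tr_1]) _).2 h3, ?_⟩
    · change e.conjAlgEquiv F t.1 * e.conjAlgEquiv F t.2.1 = _
      rw [← map_mul, h1, map_mul]; rfl
    · intro x y
      rw [tr_3, tr_3, h4, tr_2]; simp
  hsm := by
    intro U V _ _ _ _ t t'
    constructor
    · rintro ⟨h1, h2, h4, h5⟩
      refine ⟨⟨?_, ?_, ?_, ?_⟩, ⟨?_, ?_, ?_, ?_⟩⟩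
      · ext x; simpa [sm_1, sm_2] using congrArg (fun f : End F (U × V) => (f (x, 0)).1) h1
      · intro x hx
        have := h2 (x, 0) (fun y => by simp [sm_3, hx])
        simpa using this
      · intro x y; simpa [sm_3, sm_1] using h4 (x, 0) (y, 0)
      · intro x y; simpa [sm_3, sm_2] using h5 (x, 0) (y, 0)
      · ext x; simpa [sm_1, sm_2] using congrArg (fun f : End F (U × V) => (f (0, x)).2) h1
      · intro x hx
        have := h2 (0, x) (fun y => by simp [sm_3, hx])
        simpa using this
      · intro x y; simpa [sm_3, sm_1] using h4 (0, x) (0, y)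
      · intro x y; simpa [sm_3, sm_2] using h5 (0, x) (0, y)
    · rintro ⟨⟨h1, h2, h4, h5⟩, ⟨g1, g2, g4, g5⟩⟩
      refine ⟨?_, ?_, ?_, ?_⟩
      · refine LinearMap.ext fun x => Prod.ext (LinearMap.congr_fun h1 x.1) (LinearMap.congr_fun g1 x.2)
      · rintro ⟨x, y⟩ hx
        refine Prod.ext (h2 _ fun z => ?_) (g2 _ fun z => ?_)
        · simpa [sm_3] using hx (z, 0)
        · simpa [sm_3] using hx (0, z)
      · intro x y
        simp only [sm_3, sm_1]
        rw [h4, g4]; ring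
      · intro x y
        simp only [sm_3, sm_2]
        rw [h5, g5]
  comm := fun t h => h.1
  orth := by
    intro V _ _ _ t h k x y hx
    obtain ⟨h1, h2, h4, h5⟩ := h
    have e1 : ∀ x y, t.2.2 (aeval t.2.1 (X - 1 : F[X]) x) (t.2.1 y) = - t.2.2 x (aeval t.2.1 (X - 1 : F[X]) y) := by
      intro x y
      simp only [map_sub, map_one, aeval_X, LinearMap.sub_apply, Module.End.one_apply]
      rw [RP.iso (A := t.1) h5]; ring
    have c0 : ∀ (k : ℕ), Commute t.2.1 (aeval t.2.1 ((X - 1 : F[X]) ^ k)) := fun k => comm_aeval (Commute.refl _) _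
    have c0' : ∀ (k : ℕ) y, aeval t.2.1 ((X - 1 : F[X]) ^ k) (t.2.1 y) = t.2.1 (aeval t.2.1 ((X - 1 : F[X]) ^ k) y) :=
      fun k y => (LinearMap.congr_fun (c0 k).eq y).symm
    have e2 : ∀ k x y, t.2.2 (aeval t.2.1 ((X - 1 : F[X]) ^ k) x) ((t.2.1 ^ k) y) = (-1) ^ k * t.2.2 x (aeval t.2.1 ((X - 1 : F[X]) ^ k) y) := by
      intro k
      induction k with
      | zero => simp
      | succ k ih =>
        intro x y
        have c1 := c0' 1 y
        rw [pow_one] at c1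
        rw [pow_succ, map_mul, Module.End.mul_apply, pow_succ, Module.End.mul_apply, ih, c0', e1, ← Module.End.mul_apply, ← map_mul, ← map_mul, mul_comm (X - 1 : F[X])]
        ring
    have e3 : ∀ y, t.2.2 x (aeval t.2.1 ((X - 1 : F[X]) ^ k) y) = 0 := by
      intro y
      have := e2 k x y
      rw [hx, map_zero, LinearMap.zero_apply] at this
      have h7 : ((-1 : F)) ^ k ≠ 0 := pow_ne_zero _ (by simp)
      exact (mul_eq_zero.1 this.symm).resolve_left h7
    refine ⟨e3 y, ?_⟩
    rw [h5, ← c0']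
    exact e3 _

variable [FiniteDimensional F V]

lemma RP.uniq {A A' C C' : End F V} {β : Bil F V} (h : RP A C β) (h' : RP A' C' β) : C = C' := by
  ext x
  refine h.2.1.ext fun y => ?_
  rw [← h.2.2.2, ← h'.2.2.2]

lemma ND.fl {β : Bil F V} (h : ND β) : ND β.flip := fun y hy => h.flip hy

lemma famR_tot [Fintype F] [Fintype (End F V)] : (famR F).tot V = ∑ A : End F V, dF none A := by
  haveI : Finite V := Module.finite_of_finite F
  haveI := Fintype.ofFinite (Bil F V)
  have e : (famR F).tot V = Nat.card (Σ A : End F V, {β : Bil F V // Sk A β ∧ Typ none β ∧ ND β}) := by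
    refine Nat.card_congr (Equiv.ofBijective (fun t => ⟨t.1.1, t.1.2.2, t.2.2.2.1, typ_none _, t.2.2.1⟩) ⟨?_, ?_⟩)
    · rintro ⟨⟨A, C, β⟩, h⟩ ⟨⟨A', C', β'⟩, h'⟩ hh
      simp only [Sigma.mk.injEq] at hh
      obtain ⟨rfl, hh⟩ := hh
      have hh := eq_of_heq hh
      simp only [Subtype.mk.injEq] at hh
      subst hh
      obtain rfl := RP.uniq h h'
      rfl
    · rintro ⟨A, β, hs, -, hn⟩
      have key : ∀ x y, β x y = β y ((bEq β.flip hn.fl).symm (β x)) := by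
        intro x y
        have := LinearMap.congr_fun ((bEq β.flip hn.fl).apply_symm_apply (β x)) y
        rw [bEq_apply, LinearMap.flip_apply] at this
        exact this.symm
      refine ⟨⟨(A, (bEq β.flip hn.fl).symm.toLinearMap.comp (β : V →ₗ[F] Dual F V), β), ?_, hn, hs, key⟩, rfl⟩
      ext x
      refine hn.ext fun y => ?_
      change β y (A ((bEq β.flip hn.fl).symm (β x))) = β y ((bEq β.flip hn.fl).symm (β (A x)))
      rw [← key, ← neg_eq_iff_eq_neg.2 (hs y _), ← key, hs, neg_inj]
  rw [e, Nat.card_sigma]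
  rfl

lemma cayley (h2 : (2 : F) ≠ 0) {ε : F} (hε : ε * ε = 1) (Q Q' : End F V → Prop)
    (hQ : ∀ B, Q B → IsUnit (1 + B)) (hQ' : ∀ C, Q' C → IsUnit (C + ε • (1 : End F V)))
    (hQQ : ∀ B C : End F V, (1 + B) * C = ε • (1 - B) → IsUnit (1 + B) → Commute B C → (Q B ↔ Q' C)) :
    Nat.card {t : Tr F V // LP ε t.1 t.2.1 t.2.2 ∧ Q t.2.1} = Nat.card {t : Tr F V // RP t.1 t.2.1 t.2.2 ∧ Q' t.2.1} := by
  have key : ∀ (A B : End F V) (γ : Bil F V), LP ε A B γ → ∀ h : IsUnit (1 + B),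
      RP A (ε • ((h.unit⁻¹ : (End F V)ˣ) * (1 - B) : End F V)) (γ.compl₂ (1 + B)) := by
    rintro A B γ ⟨h1, hn, ht, hA, hB⟩ h
    have ht := ht ε rfl
    have cA : Commute A (1 + B) := (Commute.one_right A).add_right h1
    have cA' : Commute A (h.unit⁻¹ : (End F V)ˣ) := (show Commute A (h.unit : (End F V)) from cA).units_inv_right
    have hu : ∀ x, (1 + B) (((h.unit⁻¹ : (End F V)ˣ) : End F V) x) = x := by
      intro x
      have : (1 + B) * ((h.unit⁻¹ : (End F V)ˣ) : End F V) = 1 := h.mul_val_inv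
      exact LinearMap.congr_fun this x
    refine ⟨?_, ?_, ?_, ?_⟩
    · have : Commute A (ε • ((h.unit⁻¹ : (End F V)ˣ) * (1 - B) : End F V)) :=
        (cA'.mul_right ((Commute.one_right A).sub_right h1)).smul_right ε
      exact this
    · intro x hx
      refine hn x fun y => ?_
      have := hx (((h.unit⁻¹ : (End F V)ˣ) : End F V) y)
      rwa [LinearMap.compl₂_apply, hu] at this
    · intro x y
      simp only [LinearMap.compl₂_apply]
      rw [hA]
      have := LinearMap.congr_fun cA.eq y
      simp only [Module.End.mul_apply] at this
      rw [this]
    · intro x y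
      simp only [LinearMap.compl₂_apply, LinearMap.smul_apply, Module.End.mul_apply, map_smul]
      rw [hu, smul_eq_mul, ← ht]
      simp only [LinearMap.sub_apply, LinearMap.add_apply, Module.End.one_apply, map_add, map_sub]
      rw [hB]; ring
  have hmul : ∀ (B : End F V) (h : IsUnit (1 + B)), (1 + B) * (ε • ((h.unit⁻¹ : (End F V)ˣ) * (1 - B) : End F V)) = ε • (1 - B) := by
    intro B h
    rw [mul_smul_comm, ← mul_assoc, h.mul_val_inv, one_mul]
  have hcm : ∀ (B : End F V) (h : IsUnit (1 + B)), Commute B (ε • ((h.unit⁻¹ : (End F V)ˣ) * (1 - B) : End F V)) := by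
    intro B h
    have cA : Commute B (1 + B) := (Commute.one_right B).add_right (Commute.refl B)
    have cA' : Commute B (h.unit⁻¹ : (End F V)ˣ) := (show Commute B (h.unit : (End F V)) from cA).units_inv_right
    exact (cA'.mul_right ((Commute.one_right B).sub_right (Commute.refl B))).smul_right ε
  refine Nat.card_congr (Equiv.ofBijective (fun t => ⟨(t.1.1, ε • (((hQ _ t.2.2).unit⁻¹ : (End F V)ˣ) * (1 - t.1.2.1) : End F V), t.1.2.2.compl₂ (1 + t.1.2.1)), key _ _ _ t.2.1 _, (hQQ _ _ (hmul _ _) (hQ _ t.2.2) (hcm _ _)).1 t.2.2⟩) ⟨?_, ?_⟩)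
  · rintro ⟨⟨A, B, γ⟩, ⟨h1, hn, ht, hA, hB⟩, h⟩ ⟨⟨A', B', γ'⟩, ⟨h1', hn', ht', hA', hB'⟩, h'⟩ hh
    have ht := ht ε rfl
    have ht' := ht' ε rfl
    simp only [Subtype.mk.injEq, Prod.mk.injEq] at hh
    obtain ⟨rfl, -, hh⟩ := hh
    have hβ : ∀ x y, γ x ((1 + B) y) = γ' x ((1 + B') y) := fun x y => LinearMap.congr_fun₂ hh x y
    have g1 : ∀ (γ : Bil F V) (B : End F V), (∀ x y, γ y x = ε * γ x y) → Sk B γ → ∀ x y, 2 * γ x y = γ x ((1 + B) y) + ε * γ y ((1 + B) x) := by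
      intro γ B ht hB x y
      simp only [LinearMap.add_apply, Module.End.one_apply, map_add]
      rw [ht x y, ht (B x) y, hB]
      linear_combination (-(γ x y) + γ x (B y)) * hε
    have hγ : γ = γ' := by
      ext x y
      apply mul_left_cancel₀ h2
      rw [g1 γ B ht hB, g1 γ' B' ht' hB', hβ, hβ]
    subst hγ
    have : B = B' := by
      ext x
      refine hn.ext fun y => ?_
      have := hβ y x
      simpa using this
    subst this
    rfl
  · rintro ⟨⟨A, C, β⟩, hR, h⟩
    obtain ⟨h1, hn, hA, hC⟩ := id hR
    simp only at h1 hn hA hC h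
    have hu := hQ' _ h
    set M : End F V := ((hu.unit⁻¹ : (End F V)ˣ) : End F V) with hM
    have m1 : M * (C + ε • (1 : End F V)) = 1 := hu.val_inv_mul
    have m2 : (C + ε • (1 : End F V)) * M = 1 := hu.mul_val_inv
    set D : End F V := (ε / 2) • (C + ε • (1 : End F V)) with hD
    set B : End F V := (2 * ε) • M - 1 with hB
    have hB1 : 1 + B = (2 * ε) • M := by rw [hB]; abel
    have b1 : (1 + B) * D = 1 := by
      rw [hB1, hD, smul_mul_smul_comm, m1]
      have : 2 * ε * (ε / 2) = 1 := by field_simp; rw [pow_two, hε]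
      rw [this, one_smul]
    have b2 : D * (1 + B) = 1 := by
      rw [hB1, hD, smul_mul_smul_comm, m2]
      have : (ε / 2) * (2 * ε) = 1 := by field_simp; rw [pow_two, hε]
      rw [this, one_smul]
    have b1' : ∀ x, (1 + B) (D x) = x := fun x => LinearMap.congr_fun b1 x
    have b2' : ∀ x, D ((1 + B) x) = x := fun x => LinearMap.congr_fun b2 x
    have hunit : IsUnit (1 + B) := ⟨⟨1 + B, D, b1, b2⟩, rfl⟩
    have cAC : Commute A C := h1
    have cu : Commute A (C + ε • (1 : End F V)) := cAC.add_right ((Commute.one_right A).smul_right ε)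
    have cM : Commute A M := (show Commute A (hu.unit : (End F V)) from cu).units_inv_right
    have cB : Commute A B := (cM.smul_right _).sub_right (Commute.one_right A)
    have cu' : Commute C (C + ε • (1 : End F V)) := (Commute.refl C).add_right ((Commute.one_right C).smul_right ε)
    have cM' : Commute C M := (show Commute C (hu.unit : (End F V)) from cu').units_inv_right
    have cB' : Commute C B := (cM'.smul_right _).sub_right (Commute.one_right C)
    have cD : Commute A D := cu.smul_right _
    have hγ : ∀ x y, (β.compl₂ D) x y = (1 / 2) * (β x y + ε * β y x) := by
      intro x y
      rw [LinearMap.compl₂_apply, hD]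
      simp only [LinearMap.smul_apply, LinearMap.add_apply, Module.End.one_apply, map_smul, map_add, smul_eq_mul]
      rw [← hC]
      linear_combination (1 / 2) * (β x y) * hε
    have hiso := RP.iso (A := A) hC
    have hLP : LP ε A B (β.compl₂ D) := by
      refine ⟨cB.eq, ?_, ?_, ?_, ?_⟩
      · intro x hx
        refine hn x fun y => ?_
        have := hx ((1 + B) y)
        rwa [LinearMap.compl₂_apply, b2'] at this
      · intro ε' he x y
        obtain rfl : ε = ε' := by simpa using he
        rw [hγ, hγ]
        linear_combination -(1 / 2) * (β y x) * hε
      · intro x y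
        rw [LinearMap.compl₂_apply, LinearMap.compl₂_apply, hA]
        have := LinearMap.congr_fun cD.eq y
        simp only [Module.End.mul_apply] at this
        rw [this]
      · have hBD : ∀ x, B (D x) = x - D x := by
          intro x
          have := b1' x
          rw [LinearMap.add_apply, Module.End.one_apply] at this
          exact eq_sub_of_add_eq' this
        intro x y
        rw [← b2' x, ← b2' y]
        generalize ((1 + B) x) = x
        generalize ((1 + B) y) = y
        rw [hBD, hBD, hγ, hγ]
        have hDx : ∀ x, D x = (ε / 2) • (C x + ε • x) := fun x => by simp [hD]
        simp only [hDx, map_sub, map_add, map_smul, LinearMap.sub_apply, LinearMap.add_apply, LinearMap.smul_apply, smul_eq_mul, hiso]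
        field_simp
        have : ε ^ 2 = 1 := by rw [pow_two, hε]
        ring_nf
        have e3 : ε ^ 3 = ε := by rw [pow_succ, this, one_mul]
        have e4 : ε ^ 4 = 1 := by rw [show 4 = 2 * 2 from rfl, pow_mul, this, one_pow]
        have e5 : ε ^ 5 = ε := by rw [pow_succ, e4, one_mul]
        simp only [e3, e4, e5, this]
        ring
    have hrel : (1 + B) * C = ε • (1 - B) := by
      have e1 : M * C = 1 - ε • M := by
        rw [← m1, mul_add, mul_smul_comm, mul_one]; abel
      rw [hB1, smul_mul_assoc, e1, hB, smul_sub, smul_sub, smul_sub, smul_smul, smul_smul]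
      have : (2 * ε * ε) = 2 := by rw [mul_assoc, hε, mul_one]
      have h3 : ε * (2 * ε) = 2 := by rw [mul_comm, this]
      rw [this, h3, mul_smul, two_smul, two_smul]; abel
    refine ⟨⟨(A, B, β.compl₂ D), hLP, (hQQ B C hrel hunit cB'.symm).2 h⟩, ?_⟩
    have hβ : (β.compl₂ D).compl₂ (1 + B) = β := by
      ext x y
      rw [LinearMap.compl₂_apply, LinearMap.compl₂_apply, b2']
    have := key A B _ hLP hunit
    rw [hβ] at this
    apply Subtype.ext
    refine Prod.ext rfl (Prod.ext ?_ hβ)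
    exact RP.uniq this hR

end fams
end SpFF


set_option linter.all false
namespace SpFF
open Module Polynomial

section apps
variable {F : Type} [Field F]
variable {U V : Type} [AddCommGroup V] [Module F V] [AddCommGroup U] [Module F U]

lemma famR_nil [FiniteDimensional F V] (h2 : (2 : F) ≠ 0) : (famR F).nil V = Yc F V := by
  have h2u : IsUnit (2 : F) := h2.isUnit
  have two : IsUnit (2 : End F V) := by
    have := h2u.map (algebraMap F (End F V))
    rwa [map_ofNat] at this
  have hX : ∀ C : End F V, aeval C (X - 1 : F[X]) = C - 1 := fun C => by simp
  symm
  refine cayley h2 (ε := 1) (by ring) (fun B => IsNilpotent B) (fun C => IsNilpotent (aeval C (X - 1 : F[X]))) ?_ ?_ ?_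
  · intro B h; exact h.isUnit_one_add
  · intro C h
    rw [hX] at h
    have := h.isUnit_add_left_of_commute two (Commute.ofNat_right _ _)
    have e : (2 : End F V) + (C - 1) = C + (1 : F) • 1 := by rw [one_smul, ← one_add_one_eq_two]; abel
    rwa [e] at this
  · intro B C h hu hc
    rw [hX]
    have e : (1 + B) * (C - 1) = -(2 * B) := by
      rw [mul_sub, h, one_smul, mul_one, two_mul]; abel
    have c1 : Commute (1 + B) (C - 1) := by
      refine (Commute.add_left (Commute.one_left C) hc).sub_right (Commute.one_right _)
    rw [← hu.isNilpotent_unit_mul_of_commute_iff (r := C - 1) c1.symm, e, isNilpotent_neg_iff, two.isNilpotent_unit_mul_of_commute_iff (Commute.ofNat_right _ _)]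

lemma famR_inv [FiniteDimensional F V] (h2 : (2 : F) ≠ 0) : (famR F).inv V = (famL (-1 : F)).inv V := by
  have h2u : IsUnit (2 : F) := h2.isUnit
  have two : IsUnit (2 : End F V) := by
    have := h2u.map (algebraMap F (End F V))
    rwa [map_ofNat] at this
  have hX : ∀ C : End F V, aeval C (X - 1 : F[X]) = C - 1 := fun C => by simp
  symm
  have e1 : (famL (-1 : F)).inv V = Nat.card {t : Tr F V // LP (-1 : F) t.1 t.2.1 t.2.2 ∧ IsUnit (1 + t.2.1)} := by
    refine Nat.card_congr (Equiv.subtypeEquivRight fun t => ?_)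
    refine and_congr_right fun h => ?_
    obtain ⟨A, B, γ⟩ := t
    obtain ⟨-, hn, -, -, hB⟩ := h
    change IsUnit (aeval B (1 - X ^ 2 : F[X])) ↔ IsUnit (1 + B)
    have e : aeval B (1 - X ^ 2 : F[X]) = (1 - B) * (1 + B) := by
      simp only [map_sub, map_one, map_pow, aeval_X]; noncomm_ring
    have c : Commute (1 - B) (1 + B) :=
      ((Commute.one_left _).sub_left ((Commute.one_right B).add_right (Commute.refl B)))
    rw [e, c.isUnit_mul_iff]
    refine ⟨fun h => h.2, fun h => ⟨?_, h⟩⟩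
    rw [LinearMap.isUnit_iff_ker_eq_bot, LinearMap.ker_eq_bot']
    intro x hx
    refine hn x fun y => ?_
    obtain ⟨z, rfl⟩ := ((Module.End.isUnit_iff _).1 h).2 y
    have : γ ((1 - B) x) z = γ x ((1 + B) z) := by
      simp only [LinearMap.sub_apply, LinearMap.add_apply, Module.End.one_apply, map_sub, map_add]
      rw [hB]; ring
    rw [← this, hx]; simp
  rw [e1]
  refine cayley h2 (ε := -1) (by ring) (fun B => IsUnit (1 + B)) (fun C => IsUnit (aeval C (X - 1 : F[X]))) ?_ ?_ ?_
  · intro B h; exact h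
  · intro C h
    rw [hX] at h
    rwa [neg_one_smul, ← sub_eq_add_neg]
  · intro B C h hu hc
    refine ⟨fun _ => ?_, fun _ => hu⟩
    rw [hX]
    have e : (1 + B) * (C - 1) = -2 := by
      rw [mul_sub, h, neg_one_smul, mul_one, ← one_add_one_eq_two]; abel
    have c1 : Commute (1 + B) (C - 1) := by
      refine (Commute.add_left (Commute.one_left C) hc).sub_right (Commute.one_right _)
    have : IsUnit ((1 + B) * (C - 1)) := by rw [e]; exact two.neg
    exact (c1.isUnit_mul_iff.1 this).2

/-- the standard symplectic structure on `U × U*` -/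
noncomputable def st (P : End F U × End F U) : Tr F (U × Dual F U) :=
  (P.1.prodMap (-P.1.dualMap), (1 + P.2).prodMap (-(1 + P.2).dualMap),
    LinearMap.mk₂ F (fun z w => w.2 z.1 - z.2 w.1)
      (fun _ _ _ => by simp; ring) (fun _ _ _ => by simp; ring) (fun _ _ _ => by simp; ring)
      (fun _ _ _ => by simp; ring))

lemma st_1 (P : End F U × End F U) (z) : (st P).1 z = (P.1 z.1, -P.1.dualMap z.2) := rfl
lemma st_2 (P : End F U × End F U) (z) : (st P).2.1 z = ((1 + P.2) z.1, -(1 + P.2).dualMap z.2) := rfl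
lemma st_3 (P : End F U × End F U) (z w) : (st P).2.2 z w = w.2 z.1 - z.2 w.1 := rfl

noncomputable def hd (g : U ≃ₗ[F] U) : (U × Dual F U) ≃ₗ[F] (U × Dual F U) := g.prodCongr g.symm.dualMap

def cj (g : U ≃ₗ[F] U) (P : End F U × End F U) : End F U × End F U :=
  (g.conjAlgEquiv F P.1, g.conjAlgEquiv F P.2)

lemma hd_apply (g : U ≃ₗ[F] U) (z) : hd g z = (g z.1, z.2.comp g.symm.toLinearMap) := rfl
lemma hd_symm_apply (g : U ≃ₗ[F] U) (z) : (hd g).symm z = (g.symm z.1, z.2.comp g.toLinearMap) := rfl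

lemma tr_hd (g : U ≃ₗ[F] U) (P : End F U × End F U) : tr (hd g) (st P) = st (cj g P) := by
  apply tr_ext
  · intro z
    rw [tr_1, st_1, st_1, hd_symm_apply, hd_apply]
    refine Prod.ext rfl ?_
    ext x; simp [cj]
  · intro z
    rw [tr_2, st_2, st_2, hd_symm_apply, hd_apply]
    refine Prod.ext ?_ ?_
    · simp [cj]
    · ext x; simp [cj]
  · intro z w
    rw [tr_3, st_3, st_3, hd_symm_apply, hd_symm_apply]; simp

lemma st_inj {P P' : End F U × End F U} (h : st P = st P') : P = P' := by
  refine Prod.ext ?_ ?_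
  · ext x; have := congrArg (fun t : Tr F (U × Dual F U) => (t.1 (x, 0)).1) h; simpa [st_1] using this
  · ext x; have := congrArg (fun t : Tr F (U × Dual F U) => (t.2.1 (x, 0)).1) h; simpa [st_2] using this

lemma dual_pow (B : End F U) (k : ℕ) : (B.dualMap : End F (Dual F U)) ^ k = (B ^ k).dualMap := by
  induction k with
  | zero => rfl
  | succ k ih => rw [pow_succ, ih, pow_succ']; rfl

lemma dual_nil {B : End F U} (h : IsNilpotent B) : IsNilpotent (B.dualMap : End F (Dual F U)) := by
  obtain ⟨k, hk⟩ := h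
  exact ⟨k, by rw [dual_pow, hk]; ext; simp⟩

lemma st_aut (h2 : (2 : F) ≠ 0) {P P' : End F U × End F U} (h : IsNilpotent P.2) (h' : IsNilpotent P'.2)
    (f : (U × Dual F U) ≃ₗ[F] (U × Dual F U)) (hf : tr f (st P) = st P') : ∃ g, f = hd g := by
  have two : IsUnit (2 : End F (Dual F U)) := by
    have := h2.isUnit.map (algebraMap F (End F (Dual F U)))
    rwa [map_ofNat] at this
  let t1 : End F U × End F U → Tr F U := fun P => (P.1, 1 + P.2, 0)
  let t2 : End F U × End F U → Tr F (Dual F U) := fun P => (-P.1.dualMap, -(1 + P.2).dualMap, 0)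
  have hn : ∀ P, IsNilpotent P.2 → IsNilpotent (aeval (t1 P).2.1 (X - 1 : F[X])) := by
    intro P h
    have : aeval (t1 P).2.1 (X - 1 : F[X]) = P.2 := by simp [t1]
    rwa [this]
  have hu : ∀ P, IsNilpotent P.2 → IsUnit (aeval (t2 P).2.1 (X - 1 : F[X])) := by
    intro P h
    have e : aeval (t2 P).2.1 (X - 1 : F[X]) = -(2 + P.2.dualMap) := by
      simp only [t2, map_sub, map_one, aeval_X]
      ext φ x
      simp only [LinearMap.sub_apply, LinearMap.neg_apply, LinearMap.add_apply, LinearMap.dualMap_apply, Module.End.one_apply, map_add, ← one_add_one_eq_two]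
      ring
    rw [e]
    have h5 := (dual_nil h).isUnit_add_left_of_commute two (Commute.ofNat_right _ _)
    rw [Module.End.isUnit_iff] at h5 ⊢
    exact (Equiv.neg (Dual F U)).bijective.comp h5
  have hf' : tr f (sm (t1 P) (t2 P)) = sm (t1 P') (t2 P') := by
    apply tr_ext
    · intro z; have h5 := congrArg (fun t : Tr F (U × Dual F U) => t.1 z) hf; exact h5
    · intro z; have h5 := congrArg (fun t : Tr F (U × Dual F U) => t.2.1 z) hf; exact h5
    · intro z w; rw [tr_3, sm_3, sm_3]; simp [t1, t2]
  obtain ⟨g1, g2, hg⟩ := Fam.exists_split (hn P h) (hn P' h') (hu P h) (hu P' h') f hf'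
  refine ⟨g1, ?_⟩
  have h3 : ∀ x φ, (g2 φ) (g1 x) = φ x := by
    intro x φ
    have := congrArg (fun t : Tr F (U × Dual F U) => t.2.2 (f (x, 0)) (f (0, φ))) hf
    simp only [tr_3, st_3, LinearEquiv.symm_apply_apply] at this
    rw [hg] at this
    simpa using this.symm
  rw [hg]
  ext z : 1
  refine Prod.ext rfl ?_
  change g2 z.2 = z.2.comp g1.symm.toLinearMap
  ext x
  have := h3 (g1.symm x) z.2
  simpa using this

end apps
end SpFF


set_option linter.all false
namespace SpFF
open Module Polynomial

section lagr
variable {F : Type} [Field F]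
variable {U V : Type} [AddCommGroup V] [Module F V] [AddCommGroup U] [Module F U]
variable [FiniteDimensional F V] [FiniteDimensional F U]

lemma iso_half (B : End F V) (γ : Bil F V) (hB : Sk B γ) (c : F) (k : ℕ) (x y : V) :
    γ (aeval B ((X - C c) ^ k) x) y = (-1) ^ k * γ x (aeval B ((X + C c) ^ k) y) := by
  induction k generalizing x y with
  | zero => simp
  | succ k ih =>
    have e1 : ∀ x y, γ (aeval B (X - C c) x) y = - γ x (aeval B (X + C c) y) := by
      intro x y
      simp only [map_sub, map_add, aeval_X, aeval_C, LinearMap.sub_apply, LinearMap.add_apply, Module.algebraMap_end_apply, map_smul, LinearMap.smul_apply, smul_eq_mul]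
      rw [hB]; ring
    rw [pow_succ, map_mul, Module.End.mul_apply, ih, e1, pow_succ, ← Module.End.mul_apply, ← map_mul, mul_comm (X + C c)]
    ring

lemma lagr (h2 : (2 : F) ≠ 0) (t : Tr F V) (h : LP (-1 : F) t.1 t.2.1 t.2.2)
    (hN : IsNilpotent (aeval t.2.1 (1 - X ^ 2 : F[X]))) :
    ∃ K R : Submodule F V, IsCompl K R ∧ (∀ x ∈ K, ∀ y ∈ K, t.2.2 x y = 0) ∧ (∀ x ∈ R, ∀ y ∈ R, t.2.2 x y = 0) ∧
      (∀ x ∈ K, t.1 x ∈ K) ∧ (∀ x ∈ R, t.1 x ∈ R) ∧ (∀ x ∈ K, t.2.1 x ∈ K) ∧ (∀ x ∈ R, t.2.1 x ∈ R) ∧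
      ∃ k, ∀ x ∈ K, ((t.2.1 - 1 : End F V) ^ k) x = 0 := by
  obtain ⟨A, B, γ⟩ := t
  obtain ⟨hAB, hn, ht, hA, hB⟩ := h
  simp only at hAB hn ht hA hB hN ⊢
  obtain ⟨k, hk⟩ := hN
  have hcop : IsCoprime ((X - C (1 : F)) ^ k) ((X + C (1 : F)) ^ k) := by
    apply IsCoprime.pow
    refine ⟨C (-(2 : F)⁻¹), C ((2 : F)⁻¹), ?_⟩
    have : C ((2 : F)⁻¹) * C 2 = 1 := by rw [← C_mul, inv_mul_cancel₀ h2, C_1]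
    rw [C_neg, C_1]
    have e : (C 2 : F[X]) = 2 := map_ofNat C 2
    rw [e] at this
    linear_combination this
  have hprod : aeval B ((X - C (1 : F)) ^ k * (X + C (1 : F)) ^ k) = 0 := by
    rw [← mul_pow, map_pow]
    have : aeval B ((X - C (1 : F)) * (X + C (1 : F))) = - aeval B (1 - X ^ 2 : F[X]) := by
      rw [← map_neg]; congr 1; rw [C_1]; ring
    rw [this, neg_pow, hk, mul_zero]
  have cA : ∀ p, ∀ x, aeval B p (A x) = A (aeval B p x) := fun p x =>
    (LinearMap.congr_fun (comm_aeval (show Commute A B from hAB) p).eq x).symm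
  have cB : ∀ p, ∀ x, aeval B p (B x) = B (aeval B p x) := fun p x =>
    (LinearMap.congr_fun (comm_aeval (Commute.refl B) p).eq x).symm
  have half : ∀ c : F, IsCoprime ((X - C c) ^ k) ((X + C c) ^ k) → ∀ x, aeval B ((X - C c) ^ k) x = 0 → ∀ y, aeval B ((X - C c) ^ k) y = 0 → γ x y = 0 := by
    rintro c ⟨a, b, hab⟩ x hx y hy
    have : y = aeval B ((X + C c) ^ k) (aeval B b y) := by
      have := congrArg (fun p => aeval B p y) hab
      simp only [map_add (aeval B), map_mul (aeval B), LinearMap.add_apply, Module.End.mul_apply, map_one (aeval B), Module.End.one_apply, hy, LinearMap.map_zero, zero_add] at this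
      rw [← Module.End.mul_apply, ← map_mul, mul_comm, map_mul, Module.End.mul_apply]
      exact this.symm
    have h3 := iso_half B γ hB c k x (aeval B b y)
    rw [hx, map_zero, LinearMap.zero_apply, ← this] at h3
    exact (mul_eq_zero.1 h3.symm).resolve_left (pow_ne_zero _ (by simp))
  refine ⟨LinearMap.ker (aeval B ((X - C (1 : F)) ^ k)), LinearMap.ker (aeval B ((X + C (1 : F)) ^ k)), ⟨disjoint_ker_aeval_of_isCoprime B hcop, ?_⟩, ?_, ?_, ?_, ?_, ?_, ?_, k, ?_⟩
  · rw [codisjoint_iff, sup_ker_aeval_eq_ker_aeval_mul_of_coprime B hcop, hprod, LinearMap.ker_zero]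
  · intro x hx y hy; exact half 1 hcop x hx y hy
  · intro x hx y hy
    refine half (-1) ?_ x ?_ y ?_
    · simpa [sub_eq_add_neg] using hcop.symm
    · simpa using hx
    · simpa using hy
  · intro x hx; rw [LinearMap.mem_ker, cA, LinearMap.mem_ker.1 hx, map_zero]
  · intro x hx; rw [LinearMap.mem_ker, cA, LinearMap.mem_ker.1 hx, map_zero]
  · intro x hx; rw [LinearMap.mem_ker, cB, LinearMap.mem_ker.1 hx, map_zero]
  · intro x hx; rw [LinearMap.mem_ker, cB, LinearMap.mem_ker.1 hx, map_zero]
  · intro x hx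
    have := LinearMap.mem_ker.1 hx
    simpa using this

lemma lagr_dim {γ : Bil F V} (hn : ND γ) {K R : Submodule F V} (hc : IsCompl K R)
    (hK : ∀ x ∈ K, ∀ y ∈ K, γ x y = 0) (hR : ∀ x ∈ R, ∀ y ∈ R, γ x y = 0) :
    ∃ ρ : R ≃ₗ[F] Dual F K, ∀ r k, ρ r k = γ k r := by
  have hsplit : ∀ v : V, ∃ k ∈ K, ∃ r ∈ R, v = k + r := fun v => by
    obtain ⟨k, hk, r, hr, h⟩ := Submodule.mem_sup.1 (hc.sup_eq_top ▸ Submodule.mem_top : v ∈ K ⊔ R)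
    exact ⟨k, hk, r, hr, h.symm⟩
  let ρ : R →ₗ[F] Dual F K := (γ.flip.compl₁₂ R.subtype K.subtype)
  let κ : K →ₗ[F] Dual F R := (γ.compl₁₂ K.subtype R.subtype)
  have hρ : Function.Injective ρ := by
    rw [← LinearMap.ker_eq_bot, LinearMap.ker_eq_bot']
    intro r hr
    apply Subtype.ext
    refine hn.flip fun v => ?_
    obtain ⟨k, hk, r', hr', rfl⟩ := hsplit v
    rw [map_add, LinearMap.add_apply, hR _ hr' _ r.2, add_zero]
    exact LinearMap.congr_fun hr ⟨k, hk⟩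
  have hκ : Function.Injective κ := by
    rw [← LinearMap.ker_eq_bot, LinearMap.ker_eq_bot']
    intro k hk
    apply Subtype.ext
    refine hn _ fun v => ?_
    obtain ⟨k', hk', r', hr', rfl⟩ := hsplit v
    rw [map_add, hK _ k.2 _ hk', zero_add]
    exact LinearMap.congr_fun hk ⟨r', hr'⟩
  have h1 := LinearMap.finrank_le_finrank_of_injective hρ
  have h2 := LinearMap.finrank_le_finrank_of_injective hκ
  rw [Subspace.dual_finrank_eq] at h1 h2
  have h3 : finrank F R = finrank F (Dual F K) := by rw [Subspace.dual_finrank_eq]; omega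
  exact ⟨LinearEquiv.ofBijective ρ ⟨hρ, (LinearMap.injective_iff_surjective_of_finrank_eq_finrank h3).1 hρ⟩, fun r k => rfl⟩

lemma lagr_exists (h2 : (2 : F) ≠ 0) (t : Tr F V) (h : LP (-1 : F) t.1 t.2.1 t.2.2)
    (hN : IsNilpotent (aeval t.2.1 (1 - X ^ 2 : F[X]))) :
    Even (finrank F V) ∧ (finrank F V = 2 * finrank F U → ∃ (e : (U × Dual F U) ≃ₗ[F] V) (P : End F U × End F U),
      (P.1 * P.2 = P.2 * P.1 ∧ IsNilpotent P.2) ∧ tr e (st P) = t) := by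
  obtain ⟨K, R, hc, hK, hR, hAK, hAR, hBK, hBR, k, hk⟩ := lagr h2 t h hN
  obtain ⟨hAB, hn, ht, hA, hB⟩ := h
  have ht : ∀ x y, t.2.2 y x = - t.2.2 x y := fun x y => by simpa using ht (-1) rfl x y
  obtain ⟨ρ, hρ⟩ := lagr_dim hn hc hK hR
  have hd : finrank F V = finrank F K + finrank F K := by
    rw [← Submodule.finrank_add_eq_of_isCompl hc, ρ.finrank_eq, Subspace.dual_finrank_eq]
  refine ⟨⟨_, hd⟩, fun hU => ?_⟩
  let e1 : U ≃ₗ[F] K := LinearEquiv.ofFinrankEq _ _ (by omega)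
  let ψ : Dual F U ≃ₗ[F] R := e1.symm.dualMap.trans ρ.symm
  have hψ : ∀ φ x, t.2.2 (e1 x) (ψ φ) = φ x := by
    intro φ x
    rw [← hρ]; simp [ψ]
  have hRext : ∀ r r' : V, r ∈ R → r' ∈ R → (∀ x, t.2.2 (e1 x) r = t.2.2 (e1 x) r') → r = r' := by
    intro r r' hr hr' hh
    have : ρ ⟨r, hr⟩ = ρ ⟨r', hr'⟩ := by
      ext x
      rw [hρ, hρ]
      have := hh (e1.symm x)
      simpa using this
    exact congrArg Subtype.val (ρ.injective this)
  let e : (U × Dual F U) ≃ₗ[F] V := (e1.prodCongr ψ).trans (Submodule.prodEquivOfIsCompl _ _ hc)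
  have he : ∀ x y, e (x, y) = (e1 x : V) + ψ y := fun x y => rfl
  let A' : End F U := e1.symm.conjAlgEquiv F (t.1.restrict hAK)
  let B' : End F U := e1.symm.conjAlgEquiv F (t.2.1.restrict hBK)
  have hA' : ∀ x, (e1 (A' x) : V) = t.1 (e1 x) := fun x => by simp [A']
  have hB' : ∀ x, (e1 (B' x) : V) = t.2.1 (e1 x) := fun x => by simp [B']
  have dual : ∀ (D : End F V) (D' : End F U), Sk D t.2.2 → (∀ x, (e1 (D' x) : V) = D (e1 x)) → (∀ x ∈ R, D x ∈ R) →
      ∀ z, D (e z) = e (D' z.1, - D'.dualMap z.2) := by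
    rintro D D' hs hD' hDR ⟨x, φ⟩
    rw [he, map_add, he, hD']
    congr 1
    refine hRext _ _ (hDR _ (ψ φ).2) (ψ _).2 fun y => ?_
    rw [hψ, ← neg_eq_iff_eq_neg.2 (hs _ _), ← hD', hψ]
    simp
  refine ⟨e, (A', B' - 1), ⟨?_, k, ?_⟩, ?_⟩
  · have : A' * B' = B' * A' := by
      simp only [A', B', ← map_mul]
      congr 1
      ext x
      exact LinearMap.congr_fun hAB x
    simp only [mul_sub, sub_mul, this, mul_one, one_mul]
  · have : ∀ k x, (e1 (((B' - 1 : End F U) ^ k) x) : V) = ((t.2.1 - 1 : End F V) ^ k) (e1 x) := by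
      intro k
      induction k with
      | zero => simp
      | succ k ih =>
        intro x
        rw [pow_succ, Module.End.mul_apply, ih, pow_succ, Module.End.mul_apply]
        congr 1
        simp [hB']
    ext x
    apply e1.injective
    apply Subtype.ext
    rw [this, hk _ (e1 x).2]; simp
  · apply tr_ext
    · intro v
      obtain ⟨z, rfl⟩ := e.surjective v
      rw [tr_1, LinearEquiv.symm_apply_apply, dual _ A' hA hA' hAR]; rfl
    · intro v
      obtain ⟨z, rfl⟩ := e.surjective v
      rw [tr_2, LinearEquiv.symm_apply_apply, dual _ B' hB hB' hBR, st_2]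
      congr 2 <;> simp
    · intro v w
      obtain ⟨⟨x, φ⟩, rfl⟩ := e.surjective v
      obtain ⟨⟨y, χ⟩, rfl⟩ := e.surjective w
      rw [tr_3, LinearEquiv.symm_apply_apply, LinearEquiv.symm_apply_apply, st_3, he, he]
      simp only [map_add, LinearMap.add_apply]
      rw [hK _ (e1 x).2 _ (e1 y).2, hR _ (ψ φ).2 _ (ψ χ).2, hψ, ht (e1 y), hψ]
      simp; ring

lemma st_mem (h2 : (2 : F) ≠ 0) (P : End F U × End F U) (h : P.1 * P.2 = P.2 * P.1) (hn : IsNilpotent P.2) :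
    LP (-1 : F) (st P).1 (st P).2.1 (st P).2.2 ∧ IsNilpotent (aeval (st P).2.1 (1 - X ^ 2 : F[X])) := by
  have h' : ∀ x, P.1 (P.2 x) = P.2 (P.1 x) := fun x => LinearMap.congr_fun h x
  refine ⟨⟨?_, ?_, ?_, ?_, ?_⟩, ?_⟩
  · refine LinearMap.ext fun z => ?_
    simp only [Module.End.mul_apply, st_1, st_2]
    refine Prod.ext ?_ ?_
    · simp [h']
    · ext x; simp [h']
  · rintro ⟨x, φ⟩ hx
    refine Prod.ext ?_ ?_
    · change x = 0
      rw [← Module.forall_dual_apply_eq_zero_iff F]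
      intro χ
      simpa [st_3] using hx (0, χ)
    · ext y
      simpa [st_3] using hx (y, 0)
  · intro ε hε z w
    obtain rfl : -1 = ε := by simpa using hε
    rw [st_3, st_3]; ring
  · intro z w
    simp only [st_3, st_1]; simp; ring
  · intro z w
    simp only [st_3, st_2]; simp; ring
  · obtain ⟨k, hk⟩ := hn
    refine ⟨k, ?_⟩
    have e : ∀ z, aeval (st P).2.1 (1 - X ^ 2 : F[X]) z = ((-(P.2 * (2 + P.2))) z.1, ((-(P.2 * (2 + P.2)) : End F U).dualMap) z.2) := by
      intro z
      have e0 : (1 : End F U) - (1 + P.2) * (1 + P.2) = -(P.2 * (2 + P.2)) := by noncomm_ring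
      rw [← e0]
      simp only [pow_two, map_sub, map_one, map_mul, aeval_X, LinearMap.sub_apply, Module.End.one_apply, Module.End.mul_apply, st_2]
      refine Prod.ext ?_ ?_
      · simp
      · ext x; simp
    have e' : ∀ k z, ((aeval (st P).2.1 (1 - X ^ 2 : F[X])) ^ k) z = (((-(P.2 * (2 + P.2))) ^ k) z.1, (((-(P.2 * (2 + P.2)) : End F U) ^ k).dualMap) z.2) := by
      intro k
      induction k with
      | zero => intro z; simp; rfl
      | succ k ih =>
        intro z
        rw [pow_succ, Module.End.mul_apply, ih, e, pow_succ]
        refine Prod.ext rfl ?_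
        rw [← pow_succ, pow_succ']; rfl
    have h0 : (-(P.2 * (2 + P.2)) : End F U) ^ k = 0 := by
      have c : Commute P.2 (2 + P.2) := (Commute.ofNat_right _ _).add_right (Commute.refl _)
      rw [neg_pow, c.mul_pow, hk, zero_mul, mul_zero]
    refine LinearMap.ext fun z => ?_
    rw [e', h0]
    refine Prod.ext rfl ?_
    ext; simp

lemma nil_count [Fintype F] (h2 : (2 : F) ≠ 0) (hdim : finrank F V = 2 * finrank F U) :
    glc F V * Pc F U = glc F U * (famL (-1 : F)).nil V := by
  let E := (U × Dual F U) ≃ₗ[F] V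
  let X1 := {P : End F U × End F U // P.1 * P.2 = P.2 * P.1 ∧ IsNilpotent P.2}
  let Φ : E × X1 → Tr F V := fun z => tr z.1 (st z.2.1)
  let act : (U ≃ₗ[F] U) → E × X1 → E × X1 := fun g z => ((hd g).symm.trans z.1, ⟨cj g z.2.1, by
    constructor
    · simp only [cj, ← map_mul, z.2.2.1]
    · exact z.2.2.2.map (g.conjAlgEquiv F)⟩)
  have h := card_orbit act Φ ?_ ?_
  · have hE : Nat.card E = glc F V := by
      have e : (U × Dual F U) ≃ₗ[F] V := LinearEquiv.ofFinrankEq _ _ (by rw [finrank_prod, Subspace.dual_finrank_eq, hdim, two_mul])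
      rw [card_equiv_eq e, glc_congr e]
    have hP : Nat.card (E × X1) = glc F V * Pc F U := by
      rw [Nat.card_prod, hE]; rfl
    rw [← hP, h]
    congr 1
    refine Nat.card_congr (Equiv.setCongr ?_)
    ext t
    constructor
    · rintro ⟨⟨e, P⟩, rfl⟩
      obtain ⟨g1, k, hk⟩ := st_mem h2 P.1 P.2.1 P.2.2
      refine ⟨(famL (-1 : F)).htr e _ g1, k, ?_⟩
      ext x
      rw [← map_pow, tr_aeval]
      change e (aeval (st P.1).2.1 ((1 - X ^ 2 : F[X]) ^ k) (e.symm x)) = 0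
      rw [map_pow, hk]; simp
    · rintro ⟨g1, g2⟩
      obtain ⟨e, P, hP, rfl⟩ := (lagr_exists (U := U) h2 t g1 g2).2 hdim
      exact ⟨(e, ⟨P, hP⟩), rfl⟩
  · rintro ⟨e, P⟩ g g' h
    have h1 : ∀ z, e ((hd g).symm z) = e ((hd g').symm z) := fun z =>
      LinearEquiv.congr_fun (congrArg Prod.fst h) z
    have h3 : g.symm = g'.symm := by
      ext x
      have := e.injective (h1 (x, 0))
      exact congrArg Prod.fst this
    rw [← LinearEquiv.symm_symm g, h3, LinearEquiv.symm_symm]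
  · rintro ⟨e, P⟩ ⟨e', P'⟩
    constructor
    · intro h
      have hf : tr (e.trans e'.symm) (st P.1) = st P'.1 := by
        rw [← tr_tr]
        have : tr e (st P.1) = tr e' (st P'.1) := h
        rw [this, tr_symm_tr]
      obtain ⟨g, hg⟩ := st_aut h2 P.2.2 P'.2.2 _ hf
      rw [hg, tr_hd] at hf
      refine ⟨g, Prod.ext ?_ (Subtype.ext (st_inj hf))⟩
      change (SpFF.hd g).symm.trans e = e'
      rw [← hg]
      ext z; simp
    · rintro ⟨g, h⟩
      rw [← h]
      change tr e (st P.1) = tr ((SpFF.hd g).symm.trans e) (st (cj g P.1))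
      rw [← tr_hd, tr_tr]
      congr 1
      ext z; simp

lemma nil_odd (h2 : (2 : F) ≠ 0) (hd : ¬ Even (finrank F V)) : (famL (-1 : F)).nil V = 0 :=
  Nat.card_eq_zero.2 (Or.inl ⟨fun t => hd (lagr_exists (U := F) h2 t.1 t.2.1 t.2.2).1⟩)

end lagr
end SpFF


set_option linter.all false
namespace SpFF

section formal
open PowerSeries
open scoped PowerSeries.WithPiTopology

/-- substitution of the `(i+1)`-st power of the variable -/
noncomputable def ex (i : ℕ) : ℝ⟦X⟧ →ₐ[ℝ] ℝ⟦X⟧ := expand (i + 1) i.succ_ne_zero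

lemma ex_X (i : ℕ) : ex i X = X ^ (i + 1) := expand_X _ _

lemma ex_ex (i j : ℕ) (f : ℝ⟦X⟧) : ex i (ex j f) = ex j (ex i f) := by
  rw [ex, ex, ← expand_mul, ← expand_mul]
  congr 2
  exact mul_comm _ _

lemma gf_prod (φ : ℕ → ℝ⟦X⟧) (h0 : ∀ i, coeff 0 (φ i) = 1) :
    HasProd (fun i => ex i (φ (i + 1))) (Nat.Partition.genFun fun i c => coeff c (φ i)) := by
  have hfun : (fun i => ex i (φ (i + 1))) = fun i => 1 + ∑' j, coeff (j + 1) (φ (i + 1)) • (X : ℝ⟦X⟧) ^ ((i + 1) * (j + 1)) := ?_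
  · rw [hfun]
    exact Nat.Partition.hasProd_genFun (fun i c => coeff c (φ i))
  funext i
  ext n
  rw [map_add, (Nat.Partition.summable_genFun_term (fun i c => coeff c (φ i)) i).map_tsum _ (WithPiTopology.continuous_coeff ℝ n)]
  simp only [map_smul, coeff_X_pow, smul_eq_mul, mul_ite, mul_one, mul_zero]
  rw [ex, coeff_expand]
  split_ifs with h
  · obtain ⟨m, rfl⟩ := h
    rw [Nat.mul_div_cancel_left _ i.succ_pos]
    cases m with
    | zero =>
      rw [tsum_congr (g := fun _ => (0 : ℝ)) (fun j => if_neg (by simp)), tsum_zero, h0]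
      simp
    | succ k =>
      rw [tsum_eq_single k, if_pos rfl, coeff_one, if_neg (by simp), zero_add]
      intro j hj
      rw [if_neg]
      intro h
      have := Nat.eq_of_mul_eq_mul_left i.succ_pos h
      omega
  · rw [tsum_congr (g := fun _ => (0 : ℝ)) (fun j => if_neg ?_), tsum_zero, coeff_one, if_neg, add_zero]
    · rintro rfl; exact h (dvd_zero _)
    · rintro rfl; exact h (dvd_mul_right _ _)

lemma ex_cont (k : ℕ) : Continuous (ex k) := by
  rw [continuous_iff_continuousAt]
  intro f
  rw [ContinuousAt, WithPiTopology.tendsto_iff_coeff_tendsto]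
  intro d
  simp only [ex, coeff_expand]
  split_ifs with h
  · exact (WithPiTopology.continuous_coeff ℝ _).continuousAt
  · exact tendsto_const_nhds

lemma ex_prod {f : ℕ → ℝ⟦X⟧} {a : ℝ⟦X⟧} (k : ℕ) (h : HasProd f a) : HasProd (fun i => ex k (f i)) (ex k a) :=
  h.map (ex k) (ex_cont k)

/-- the local factor of the final product -/
noncomputable def gq (r : ℕ) : ℝ⟦X⟧ := (1 + X) * rescale (r : ℝ) (hs r)

lemma gq_zero (r : ℕ) : coeff 0 (gq r) = 1 := by
  have := hs_zero r
  rw [coeff_zero_eq_constantCoeff_apply] at this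
  rw [gq, coeff_zero_eq_constantCoeff_apply, map_mul, cc_rescale, this]
  simp

variable {F : Type} [Field F] [Fintype F]

lemma h2s_ex (r : ℕ) : h2s r = ex 1 (hs r) := by
  ext n
  rw [ex, coeff_expand, h2s, coeff_mk, hs, coeff_mk]
  simp only [even_iff_two_dvd]
  rfl

lemma formal_id (h2 : (2 : F) ≠ 0) :
    Nat.Partition.genFun (fun _ c => (Fintype.card F : ℝ) ^ (c / 2)) * ex 1 (Nat.Partition.genFun (fun _ c => (fg F).coeff c)) =
    ex 1 (Nat.Partition.genFun fun _ c => (gq (Fintype.card F)).coeff c) *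
      Nat.Partition.genFun (fun i c => if Odd i then (fs F).coeff c else (fa F).coeff c) := by
  set q := Fintype.card F with hq
  set rr : ℝ⟦X⟧ := PowerSeries.mk fun c => (q : ℝ) ^ (c / 2) with hrr
  have h0a : coeff 0 (fa F) = 1 := by
    rw [fa_eq h2, h2s_ex, ex, coeff_expand, if_pos (dvd_zero _)]; exact hs_zero _
  have h0s : coeff 0 (fs F) = 1 := by
    rw [fs_eq h2, coeff_zero_eq_constantCoeff_apply, map_mul, ← coeff_zero_eq_constantCoeff_apply, ← coeff_zero_eq_constantCoeff_apply, h0a]; simp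
  have hR := gf_prod (fun _ => rr) (fun i => by simp [rr])
  have hP := ex_prod 1 (gf_prod (fun _ => fg F) (fun _ => fg_zero))
  have hW := ex_prod 1 (gf_prod (fun _ => gq q) (fun _ => gq_zero q))
  have hY := gf_prod (fun i => if Odd i then fs F else fa F) (fun i => by split_ifs <;> assumption)
  have hA := gf_prod (fun _ => h2s q * ex 1 (rescale (q : ℝ) (hs q))) (fun _ => by
    have := hs_zero q
    rw [coeff_zero_eq_constantCoeff_apply] at this
    rw [h2s_ex, ← map_mul, ex, coeff_expand, if_pos (dvd_zero _), Nat.zero_div, coeff_zero_eq_constantCoeff_apply, map_mul, cc_rescale, this, mul_one])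
  have hB := gf_prod (fun i => if Odd i then 1 + X else 1) (fun i => by split_ifs <;> simp)
  have hC := ex_prod 1 (gf_prod (fun i => 1 + X) (fun i => by simp))
  set B := Nat.Partition.genFun (fun i c => coeff c (if Odd i then 1 + X else 1 : ℝ⟦X⟧))
  set Cc := ex 1 (Nat.Partition.genFun (fun i c => coeff c (1 + X : ℝ⟦X⟧)))
  have hC' : HasProd (fun i => if Odd (i + 1) then (1 : ℝ⟦X⟧) else 1 + X ^ (i + 1)) (1 * Cc) := by
    refine HasProd.even_mul_odd ?_ ?_
    · convert hasProd_one using 2 with k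
      rw [if_pos ⟨k, rfl⟩]
    · convert hC using 2 with k
      rw [if_neg (by rw [Nat.not_odd_iff_even]; exact ⟨k + 1, by ring⟩)]
      simp only [map_add, map_one, ex_X, map_pow, ← pow_mul]
      congr 2
  have hcomm : ∀ i (f : ℝ⟦X⟧), ex i (ex 1 f) = ex 1 (ex i f) := fun i f => ex_ex i 1 f
  have hrr1 : (1 - C (q : ℝ) * X ^ 2) * rr = 1 + X := by
    ext n
    rw [sub_mul, one_mul, mul_assoc, map_sub, coeff_C_mul, coeff_X_pow_mul', coeff_mk, map_add, coeff_one, coeff_X]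
    rcases n with _ | _ | n
    · simp
    · simp
    · rw [if_pos (by omega), hrr, coeff_mk, if_neg (by omega), if_neg (by omega)]
      have : (n + 1 + 1) / 2 = (n + 1 + 1 - 2) / 2 + 1 := by omega
      rw [this, pow_succ]; ring
  have hkey : rr * ex 1 (fg F) = (1 + X) * (h2s q * ex 1 (rescale (q : ℝ) (hs q))) := by
    rw [fg_h, ← hs_q, map_mul, map_mul, h2s_ex, ← hrr1]
    have : ex 1 (1 - C (q : ℝ) * X) = 1 - C (q : ℝ) * X ^ 2 := by
      rw [map_sub, map_one, map_mul, ex_X]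
      congr 2
      exact expand_C _ _ _
    rw [this]; ring
  have e1 := hR.mul hP
  have e2 := hW.mul hY
  have e3 := hA.mul (hB.mul hC')
  have e4 := (hA.mul hB).mul hC
  have g1 : (fun i => ex i rr * ex 1 (ex i (fg F))) = fun i => ex i (h2s q * ex 1 (rescale (q : ℝ) (hs q))) *
      (ex i (if Odd (i + 1) then 1 + X else 1) * if Odd (i + 1) then (1 : ℝ⟦X⟧) else 1 + X ^ (i + 1)) := by
    funext i
    rw [← hcomm, ← map_mul, hkey, map_mul, mul_comm]
    congr 1
    split_ifs <;> simp [ex_X]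
  have g2 : (fun i => ex 1 (ex i (gq q)) * ex i (if Odd (i + 1) then fs F else fa F)) = fun i =>
      ex i (h2s q * ex 1 (rescale (q : ℝ) (hs q))) * ex i (if Odd (i + 1) then 1 + X else 1) * ex 1 (ex i (1 + X)) := by
    funext i
    rw [← hcomm, ← hcomm, ← map_mul, ← map_mul, ← map_mul]
    congr 1
    rw [gq, map_mul, fs_eq h2, fa_eq h2]
    split_ifs <;> ring
  rw [← g1] at e3
  rw [← g2] at e4
  have f1 := e1.unique e3
  have f2 := e2.unique e4
  have hi : (fun (i c : ℕ) => coeff c (if Odd i then fs F else fa F)) = fun i c => if Odd i then (fs F).coeff c else (fa F).coeff c := by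
    funext i c; split_ifs <;> rfl
  rw [hi] at f2
  have hi2 : (fun (i c : ℕ) => coeff c rr) = fun i c => (q : ℝ) ^ (c / 2) := by
    funext i c; simp [rr]
  rw [hi2] at f1
  rw [f1, f2]; ring

lemma Z_eq (h2 : (2 : F) ≠ 0) : ser F (fun n => (famL (-1 : F)).tot (Fin n → F)) =
    ex 1 (Nat.Partition.genFun fun _ c => (gq (Fintype.card F)).coeff c) := by
  classical
  have hg : ∀ m, (0 : ℝ) < glc F (Fin m → F) := fun m => by exact_mod_cast glc_pos
  set Y := Nat.Partition.genFun (fun i c => if Odd i then (fs F).coeff c else (fa F).coeff c) with hY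
  have hY0 : Y ≠ 0 := by
    intro h
    have := congrArg (coeff 0) h
    rw [hY, Nat.Partition.coeff_genFun] at this
    simp at this
  have h1 := Fam.tot_eq (famL (-1 : F))
  have h3 := Fam.tot_eq (famR F)
  have e1 : ser F (fun n => (famR F).tot (Fin n → F)) = Nat.Partition.genFun (fun _ c => (Fintype.card F : ℝ) ^ (c / 2)) := by
    ext n
    haveI : Finite (Module.End F (Fin n → F)) := end_finite
    haveI := Fintype.ofFinite (Module.End F (Fin n → F))
    rw [ser, coeff_mk, famR_tot, Nat.cast_sum, R_eq h2, Module.finrank_fin_fun, mul_div_cancel_left₀ _ (hg n).ne']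
  have e2 : ser F (fun n => (famR F).nil (Fin n → F)) = Y := by
    ext n
    rw [ser, coeff_mk, famR_nil h2, Yc_eq h2, Module.finrank_fin_fun, mul_div_cancel_left₀ _ (hg n).ne']
  have e3 : ser F (fun n => (famR F).inv (Fin n → F)) = ser F (fun n => (famL (-1 : F)).inv (Fin n → F)) := by
    congr 1; funext n; exact famR_inv h2
  have e4 : ser F (fun n => (famL (-1 : F)).nil (Fin n → F)) = ex 1 (Nat.Partition.genFun (fun _ c => (fg F).coeff c)) := by
    ext n
    rw [ser, coeff_mk, ex, coeff_expand]
    split_ifs with h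
    · obtain ⟨m, rfl⟩ := h
      have hm := nil_count (F := F) (U := Fin m → F) (V := Fin (2 * m) → F) h2 (by simp)
      have hm' := congrArg (Nat.cast : ℕ → ℝ) hm
      push_cast at hm'
      rw [Pc_eq, Module.finrank_fin_fun] at hm'
      rw [Nat.mul_div_cancel_left _ (by norm_num), div_eq_iff (hg _).ne']
      apply mul_left_cancel₀ (hg m).ne'
      linarith
    · rw [nil_odd h2, Nat.cast_zero, zero_div]
      rwa [Module.finrank_fin_fun, even_iff_two_dvd]
  apply mul_right_cancel₀ hY0
  rw [← formal_id h2, ← e1, ← e4, h1, h3, e2, e3]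
  ring

end formal
end SpFF


set_option linter.all false
namespace SpFF

section analytic
open PowerSeries Filter Topology
open scoped PowerSeries.WithPiTopology

/-- absolute summability of a power series at a point -/
def AS (f : ℝ⟦X⟧) (u : ℝ) : Prop := Summable fun n => ‖coeff n f * u ^ n‖
/-- value of a power series at a point -/
noncomputable def ev (f : ℝ⟦X⟧) (u : ℝ) : ℝ := ∑' n, coeff n f * u ^ n

lemma mul_term (f g : ℝ⟦X⟧) (u : ℝ) (n : ℕ) : coeff n (f * g) * u ^ n =
    ∑ kl ∈ Finset.HasAntidiagonal.antidiagonal n, (coeff kl.1 f * u ^ kl.1) * (coeff kl.2 g * u ^ kl.2) := by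
  rw [coeff_mul, Finset.sum_mul]
  refine Finset.sum_congr rfl fun kl h => ?_
  rw [← Finset.HasAntidiagonal.mem_antidiagonal.1 h, pow_add]; ring

lemma AS.mul {f g : ℝ⟦X⟧} {u : ℝ} (hf : AS f u) (hg : AS g u) : AS (f * g) u := by
  have := summable_norm_sum_mul_antidiagonal_of_summable_norm hf hg
  simp only [AS, mul_term]
  exact this

lemma ev_mul {f g : ℝ⟦X⟧} {u : ℝ} (hf : AS f u) (hg : AS g u) : ev (f * g) u = ev f u * ev g u := by
  have := tsum_mul_tsum_eq_tsum_sum_antidiagonal_of_summable_norm hf hg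
  simp only [ev, mul_term]
  exact this.symm

lemma fin_term (f : ℝ⟦X⟧) (u : ℝ) (N : ℕ) (h : ∀ n, N ≤ n → coeff n f = 0) :
    AS f u ∧ ev f u = ∑ n ∈ Finset.range N, coeff n f * u ^ n := by
  have h0 : ∀ n ∉ Finset.range N, coeff n f * u ^ n = 0 := fun n hn => by
    rw [h n (by simpa using hn), zero_mul]
  refine ⟨summable_of_ne_finset_zero (s := Finset.range N) fun n hn => by rw [h0 n hn, norm_zero], tsum_eq_sum h0⟩

lemma ex_term (f : ℝ⟦X⟧) (u : ℝ) (i n : ℕ) : coeff ((i + 1) * n) (ex i f) * u ^ ((i + 1) * n) = coeff n f * (u ^ (i + 1)) ^ n := by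
  rw [ex, coeff_expand_mul, pow_mul]

lemma ex_off (f : ℝ⟦X⟧) (u : ℝ) (i n : ℕ) (h : n ∉ Set.range fun m => (i + 1) * m) : coeff n (ex i f) * u ^ n = 0 := by
  rw [ex, coeff_expand_of_not_dvd, zero_mul]
  rintro ⟨m, rfl⟩
  exact h ⟨m, rfl⟩

lemma inj_mul (i : ℕ) : Function.Injective fun m : ℕ => (i + 1) * m :=
  fun a b h => Nat.eq_of_mul_eq_mul_left i.succ_pos h

lemma AS_ex {f : ℝ⟦X⟧} {u : ℝ} {i : ℕ} (h : AS f (u ^ (i + 1))) : AS (ex i f) u := by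
  refine ((inj_mul i).summable_iff fun n hn => ?_).1 ?_
  · rw [ex_off f u i n hn, norm_zero]
  · refine h.congr fun n => ?_
    rw [Function.comp, ex_term]

lemma ev_ex {f : ℝ⟦X⟧} {u : ℝ} {i : ℕ} : ev (ex i f) u = ev f (u ^ (i + 1)) := by
  rw [ev, ev, ← (inj_mul i).tsum_eq]
  · exact tsum_congr fun n => ex_term f u i n
  · intro n hn
    by_contra h
    exact hn (ex_off f u i n h)

lemma prod_ev {g : ℝ⟦X⟧} {u : ℝ} (h : ∀ i : ℕ, AS g (u ^ (i + 1))) (s : ℕ) :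
    AS (∏ i ∈ Finset.range s, ex i g) u ∧ ev (∏ i ∈ Finset.range s, ex i g) u = ∏ i ∈ Finset.range s, ev g (u ^ (i + 1)) := by
  induction s with
  | zero =>
    obtain ⟨h1, h3⟩ := fin_term (1 : ℝ⟦X⟧) u 1 (fun n hn => by rw [coeff_one, if_neg (by omega)])
    refine ⟨by simpa using h1, ?_⟩
    simpa using h3
  | succ s ih =>
    rw [Finset.prod_range_succ, Finset.prod_range_succ]
    exact ⟨ih.1.mul (AS_ex (h s)), by rw [ev_mul ih.1 (AS_ex (h s)), ih.2, ev_ex]⟩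

lemma mul_nn {f g : ℝ⟦X⟧} (hf : ∀ n, 0 ≤ coeff n f) (hg : ∀ n, 0 ≤ coeff n g) (n : ℕ) : 0 ≤ coeff n (f * g) := by
  rw [coeff_mul]
  exact Finset.sum_nonneg fun x _ => mul_nonneg (hf _) (hg _)

lemma ex_nn {f : ℝ⟦X⟧} (hf : ∀ n, 0 ≤ coeff n f) (i n : ℕ) : 0 ≤ coeff n (ex i f) := by
  rw [ex, coeff_expand]
  split_ifs
  · exact hf _
  · exact le_rfl

lemma an_prod (g : ℝ⟦X⟧) (hg : ∀ n, 0 ≤ coeff n g) (hg0 : coeff 0 g = 1) (u T M : ℝ)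
    (hu : ∀ i : ℕ, AS g (u ^ (i + 1))) (hu' : ∀ i : ℕ, AS g (|u| ^ (i + 1)))
    (hM : ∀ s, ∏ i ∈ Finset.range s, ev g (|u| ^ (i + 1)) ≤ M)
    (hT : Tendsto (fun s => ∏ i ∈ Finset.range s, ev g (u ^ (i + 1))) atTop (𝓝 T)) :
    HasSum (fun n => coeff n (Nat.Partition.genFun fun _ c => coeff c g) * u ^ n) T := by
  set W := Nat.Partition.genFun fun _ c => coeff c g with hW
  let c : ℕ → ℝ⟦X⟧ := fun s => ∏ i ∈ Finset.range s, ex i g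
  have hcW : ∀ n, Tendsto (fun s => coeff n (c s)) atTop (𝓝 (coeff n W)) := by
    intro n
    have h := (gf_prod (fun _ => g) (fun _ => hg0)).tendsto_prod_nat
    exact ((WithPiTopology.continuous_coeff ℝ n).tendsto _).comp h
  have hc0 : ∀ s n, 0 ≤ coeff n (c s) := by
    intro s
    induction s with
    | zero => intro n; simp only [c, Finset.prod_range_zero, coeff_one]; split_ifs <;> norm_num
    | succ s ih => intro n; simp only [c]; rw [Finset.prod_range_succ]; exact mul_nn ih (ex_nn hg s) n
  have hmono : ∀ n, Monotone fun s => coeff n (c s) := by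
    intro n
    refine monotone_nat_of_le_succ fun s => ?_
    have e : c (s + 1) = c s + c s * (ex s g - 1) := by
      simp only [c]; rw [Finset.prod_range_succ]; ring
    simp only [e, map_add]
    refine le_add_of_nonneg_right (mul_nn (hc0 s) ?_ n)
    intro m
    rw [map_sub, coeff_one]
    split_ifs with h
    · subst h
      rw [ex, coeff_expand, if_pos (dvd_zero _), Nat.zero_div, hg0, sub_self]
    · rw [sub_zero]; exact ex_nn hg s m
  have hle : ∀ s n, coeff n (c s) ≤ coeff n W := fun s n => (hmono n).ge_of_tendsto (hcW n) s
  have hW0 : ∀ n, 0 ≤ coeff n W := fun n => (hc0 0 n).trans (hle 0 n)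
  have hsumM : ∀ N, ∑ n ∈ Finset.range N, coeff n W * |u| ^ n ≤ M := by
    intro N
    refine le_of_tendsto (f := fun s => ∑ n ∈ Finset.range N, coeff n (c s) * |u| ^ n) (x := atTop)
      (tendsto_finset_sum _ fun n _ => (hcW n).mul_const _) (Eventually.of_forall fun s => ?_)
    obtain ⟨h1, h3⟩ := prod_ev hu' s
    refine le_trans ?_ (hM s)
    rw [← h3]
    refine Summable.sum_le_tsum _ (fun n _ => mul_nonneg (hc0 s n) (by positivity)) h1.of_norm
  have hS : Summable fun n => coeff n W * |u| ^ n :=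
    summable_of_sum_range_le (fun n => mul_nonneg (hW0 n) (by positivity)) hsumM
  have hS' : Summable fun n => coeff n W * u ^ n := by
    refine Summable.of_norm (hS.congr fun n => ?_)
    rw [norm_mul, norm_pow, Real.norm_of_nonneg (hW0 n), Real.norm_eq_abs]
  have hlim : Tendsto (fun s => ∑' n, coeff n (c s) * u ^ n) atTop (𝓝 (∑' n, coeff n W * u ^ n)) := by
    refine tendsto_tsum_of_dominated_convergence hS (fun n => (hcW n).mul_const _) (Eventually.of_forall fun s n => ?_)
    rw [norm_mul, norm_pow, Real.norm_of_nonneg (hc0 s n), Real.norm_eq_abs]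
    exact mul_le_mul_of_nonneg_right (hle s n) (by positivity)
  have : T = ∑' n, coeff n W * u ^ n := by
    refine tendsto_nhds_unique hT (hlim.congr fun s => ?_)
    exact (prod_ev hu s).2
  rw [this]
  exact hS'.hasSum

lemma hs_AS {r : ℕ} (hr : 1 < r) {x : ℝ} (hx : |x| < 1) : AS (hs r) x := by
  rcases eq_or_ne x 0 with rfl | h0
  · refine summable_of_ne_finset_zero (s := {0}) fun n hn => ?_
    rw [zero_pow (by simpa using hn), mul_zero, norm_zero]
  refine Summable.norm ?_
  refine summable_of_ratio_test_tendsto_lt_one (l := |x|) hx (Eventually.of_forall fun n => ?_) ?_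
  · rw [hs, coeff_mk]
    exact mul_ne_zero (hc_pos hr n).ne' (pow_ne_zero _ h0)
  · have hp0 : (0 : ℝ) ≤ ((r : ℝ)⁻¹) ^ 2 := by positivity
    have hp1 : ((r : ℝ)⁻¹) ^ 2 < 1 := p_pow hr 1
    have ht : Tendsto (fun k : ℕ => (1 - ((r : ℝ)⁻¹) ^ (2 * (k + 1)))⁻¹ * |x|) atTop (𝓝 ((1 - 0)⁻¹ * |x|)) := by
      refine Tendsto.mul_const _ (Tendsto.inv₀ (tendsto_const_nhds.sub ?_) (by norm_num))
      have := (tendsto_pow_atTop_nhds_zero_of_lt_one hp0 hp1).comp (tendsto_add_atTop_nat 1)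
      refine this.congr fun k => ?_
      simp [pow_mul]
    rw [sub_zero, inv_one, one_mul] at ht
    refine ht.congr fun k => ?_
    have h1 := hc_succ hr k
    have h3 : 1 - ((r : ℝ)⁻¹) ^ (2 * (k + 1)) ≠ 0 := (sub_pos.2 (p_pow hr (2 * k + 1))).ne'
    have h4 := hc_pos hr (k + 1)
    simp only [hs, coeff_mk, norm_mul, norm_pow, Real.norm_eq_abs]
    rw [abs_of_pos h4, abs_of_pos (hc_pos hr k), ← h1]
    have h5 : |x| ≠ 0 := abs_ne_zero.2 h0
    have h6 := h4.ne'
    rw [pow_succ]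
    field_simp

lemma one_sub_X (x : ℝ) (a : ℝ) : AS (1 + C a * X) x ∧ ev (1 + C a * X) x = 1 + a * x := by
  obtain ⟨h1, h3⟩ := fin_term (1 + C a * X) x 2 (fun n hn => by
    rw [map_add, coeff_one, coeff_C_mul, coeff_X, if_neg (by omega), if_neg (by omega)]; simp)
  refine ⟨h1, h3.trans ?_⟩
  simp [Finset.sum_range_succ, coeff_one, coeff_X]

lemma rescale_term (a x : ℝ) (f : ℝ⟦X⟧) (n : ℕ) : coeff n (rescale a f) * x ^ n = coeff n f * (a * x) ^ n := by
  rw [coeff_rescale, mul_pow]; ring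

lemma AS_rescale {a x : ℝ} {f : ℝ⟦X⟧} (h : AS f (a * x)) : AS (rescale a f) x := by
  simp only [AS, rescale_term]; exact h

lemma ev_rescale {a x : ℝ} {f : ℝ⟦X⟧} : ev (rescale a f) x = ev f (a * x) := by
  simp only [ev, rescale_term]

lemma hs_ev {r : ℕ} (hr : 1 < r) {x : ℝ} (hx : |x| < 1) : (1 - x) * ev (hs r) x = ev (hs r) (((r : ℝ)⁻¹) ^ 2 * x) := by
  have h := hs_fun hr
  rw [← ev_rescale, ← h]
  have e : (1 - X : ℝ⟦X⟧) = 1 + C (-1) * X := by rw [map_neg, map_one]; ring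
  rw [e, ev_mul (one_sub_X x (-1)).1 (hs_AS hr hx), (one_sub_X x (-1)).2]; ring

lemma inv_mult {ι : Type} (a : ι → ℝ) (ρ : ℝ) (hρ : ρ < 1) (ha : ∀ i, |a i| ≤ ρ) (hs : Summable fun i => |a i|) :
    Multipliable fun i => (1 - a i)⁻¹ := by
  have h : ∀ i, (1 - a i)⁻¹ = 1 + a i / (1 - a i) := by
    intro i
    have : 1 - a i ≠ 0 := by linarith [le_abs_self (a i), ha i]
    field_simp; ring
  simp only [h]
  refine multipliable_one_add_of_summable ?_
  refine Summable.of_nonneg_of_le (fun _ => norm_nonneg _) (fun i => ?_) (hs.mul_right (1 - ρ)⁻¹)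
  rw [norm_div, Real.norm_eq_abs, Real.norm_eq_abs, div_eq_mul_inv]
  refine mul_le_mul_of_nonneg_left ?_ (abs_nonneg _)
  refine inv_anti₀ (by linarith) ?_
  refine le_trans ?_ (le_abs_self _)
  linarith [le_abs_self (a i), ha i]

lemma euler {r : ℕ} (hr : 1 < r) {x : ℝ} (hx : |x| < 1) :
    HasProd (fun l : ℕ => (1 - x * (((r : ℝ)⁻¹) ^ 2) ^ l)⁻¹) (ev (hs r) x) := by
  set p := ((r : ℝ)⁻¹) ^ 2 with hp
  have hp0 : (0 : ℝ) ≤ p := by positivity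
  have hp1 : p < 1 := p_pow hr 1
  have hb : ∀ l : ℕ, |x * p ^ l| ≤ |x| := fun l => by
    rw [abs_mul, abs_of_nonneg (pow_nonneg hp0 l)]
    exact mul_le_of_le_one_right (abs_nonneg _) (pow_le_one₀ hp0 hp1.le)
  have hm : Multipliable (fun l : ℕ => (1 - x * p ^ l)⁻¹) := by
    refine inv_mult _ |x| hx hb ?_
    simp only [abs_mul, abs_pow, abs_of_nonneg hp0]
    exact (summable_geometric_of_lt_one hp0 hp1).mul_left _
  have hlim := hm.hasProd.tendsto_prod_nat
  have hid : ∀ L : ℕ, (∏ l ∈ Finset.range L, (1 - x * p ^ l)⁻¹) * ev (hs r) (p ^ L * x) = ev (hs r) x := by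
    intro L
    induction L with
    | zero => simp
    | succ L ih =>
      rw [Finset.prod_range_succ, ← ih, pow_succ', mul_assoc p, ← hs_ev hr (x := p ^ L * x) (by rw [mul_comm]; exact (hb L).trans_lt hx)]
      have : 1 - x * p ^ L ≠ 0 := by
        have := (le_abs_self _).trans (hb L)
        linarith
      rw [mul_comm (p ^ L) x]
      field_simp
  have h1 : Tendsto (fun L : ℕ => ev (hs r) (p ^ L * x)) atTop (𝓝 1) := by
    have : Tendsto (fun L : ℕ => ∑' n, coeff n (hs r) * (p ^ L * x) ^ n) atTop (𝓝 (∑' n, if n = 0 then (1 : ℝ) else 0)) := by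
      refine tendsto_tsum_of_dominated_convergence (hs_AS hr hx) (fun n => ?_) (Eventually.of_forall fun L n => ?_)
      · split_ifs with h
        · subst h
          simp only [pow_zero, hs_zero, mul_one]
          exact tendsto_const_nhds
        · have h3 : Tendsto (fun L : ℕ => coeff n (hs r) * (p ^ L * x) ^ n) atTop (𝓝 (coeff n (hs r) * (0 * x) ^ n)) :=
            (((tendsto_pow_atTop_nhds_zero_of_lt_one hp0 hp1).mul_const x).pow n).const_mul _
          rwa [zero_mul, zero_pow h, mul_zero] at h3
      · rw [norm_mul, norm_mul, norm_pow, norm_pow]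
        refine mul_le_mul_of_nonneg_left (pow_le_pow_left₀ (norm_nonneg _) ?_ n) (norm_nonneg _)
        rw [mul_comm]; exact hb L
    rwa [tsum_ite_eq] at this
  have h3 := hlim.mul h1
  simp only [hid, mul_one] at h3
  rw [← tendsto_nhds_unique h3 tendsto_const_nhds]
  exact hm.hasProd

lemma gq_nn {r : ℕ} (hr : 1 < r) (n : ℕ) : 0 ≤ coeff n (gq r) := by
  refine mul_nn ?_ ?_ n
  · intro m; rw [map_add, coeff_one, coeff_X]; split_ifs <;> norm_num
  · intro m
    rw [coeff_rescale, hs, coeff_mk]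
    exact mul_nonneg (by positivity) (hc_pos hr m).le

lemma gq_AS {r : ℕ} (hr : 1 < r) {x : ℝ} (hx : |r * x| < 1) : AS (gq r) x ∧ ev (gq r) x = (1 + x) * ev (hs r) (r * x) := by
  have e : (1 + X : ℝ⟦X⟧) = 1 + C 1 * X := by rw [map_one, one_mul]
  have h1 := AS_rescale (f := hs r) (a := r) (x := x) (hs_AS hr hx)
  rw [gq, e]
  exact ⟨(one_sub_X x 1).1.mul h1, by rw [ev_mul (one_sub_X x 1).1 h1, (one_sub_X x 1).2, ev_rescale, one_mul]⟩

lemma final_an {r : ℕ} (hr : 1 < r) {u : ℝ} (hu : |u| < 1 / r) :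
    Multipliable (fun i : ℕ => 1 + u ^ (i + 1)) ∧
    Multipliable (fun il : ℕ × ℕ => (1 - u ^ (il.1 + 1) * (r : ℝ) ^ ((1 : ℤ) - 2 * il.2))⁻¹) ∧
    HasProd (fun i : ℕ => ev (gq r) (u ^ (i + 1))) ((∏' i : ℕ, (1 + u ^ (i + 1))) *
        ∏' il : ℕ × ℕ, (1 - u ^ (il.1 + 1) * (r : ℝ) ^ ((1 : ℤ) - 2 * il.2))⁻¹) ∧
    ∀ i : ℕ, AS (gq r) (u ^ (i + 1)) := by
  have hr0 : (0 : ℝ) < r := by positivity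
  have hr1 : (1 : ℝ) < r := by exact_mod_cast hr
  have hru : r * |u| < 1 := by rwa [lt_div_iff₀ hr0, mul_comm] at hu
  have hu1 : |u| < 1 := lt_of_le_of_lt (le_mul_of_one_le_left (abs_nonneg u) hr1.le) hru
  set p := ((r : ℝ)⁻¹) ^ 2 with hp
  have hp0 : (0 : ℝ) ≤ p := by positivity
  have hp1 : p < 1 := p_pow hr 1
  have hz : ∀ l : ℕ, (r : ℝ) ^ ((1 : ℤ) - 2 * l) = r * p ^ l := by
    intro l
    rw [zpow_sub₀ hr0.ne', zpow_one, hp, ← pow_mul, inv_pow, div_eq_mul_inv]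
    norm_cast
  have hm1 : Multipliable (fun i : ℕ => 1 + u ^ (i + 1)) := by
    refine multipliable_one_add_of_summable ?_
    simp only [pow_succ, norm_mul, norm_pow]
    exact (summable_geometric_of_lt_one (norm_nonneg u) hu1).mul_right _
  have hx : ∀ i : ℕ, |r * u ^ (i + 1)| ≤ r * |u| := fun i => by
    rw [abs_mul, abs_pow, abs_of_pos hr0, pow_succ]
    exact mul_le_mul_of_nonneg_left (mul_le_of_le_one_left (abs_nonneg _) (pow_le_one₀ (abs_nonneg _) hu1.le)) hr0.le
  have hm2 : Multipliable (fun il : ℕ × ℕ => (1 - u ^ (il.1 + 1) * (r : ℝ) ^ ((1 : ℤ) - 2 * il.2))⁻¹) := by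
    refine inv_mult _ (r * |u|) hru ?_ ?_
    · rintro ⟨i, l⟩
      simp only [hz]
      rw [← mul_assoc, mul_comm (u ^ (i + 1)), abs_mul, abs_of_nonneg (pow_nonneg hp0 l)]
      exact (mul_le_of_le_one_right (abs_nonneg _) (pow_le_one₀ hp0 hp1.le)).trans (hx i)
    · have s1 : Summable fun i : ℕ => |u| ^ (i + 1) := by
        simp only [pow_succ]
        exact (summable_geometric_of_lt_one (abs_nonneg u) hu1).mul_right _
      have s2 : Summable fun l : ℕ => r * p ^ l := (summable_geometric_of_lt_one hp0 hp1).mul_left _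
      refine (s1.mul_of_nonneg s2 (fun i => by positivity) (fun i => by positivity)).congr fun il => ?_
      rw [hz, abs_mul, abs_pow, abs_of_nonneg (a := r * p ^ il.2) (by positivity)]
  have hgq : ∀ i : ℕ, AS (gq r) (u ^ (i + 1)) ∧ _ := fun i => gq_AS hr ((hx i).trans_lt hru)
  refine ⟨hm1, hm2, ?_, fun i => (hgq i).1⟩
  simp only [fun i => (hgq i).2]
  refine hm1.hasProd.mul ?_
  refine hm2.hasProd.prod_fiberwise fun i => ?_
  have := euler hr ((hx i).trans_lt hru)
  convert this using 3 with l
  rw [hz]; ring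

lemma final_sum {r : ℕ} (hr : 1 < r) {u : ℝ} (hu : |u| < 1 / r) :
    HasSum (fun n => coeff n (Nat.Partition.genFun fun _ c => coeff c (gq r)) * u ^ n)
      ((∏' i : ℕ, (1 + u ^ (i + 1))) * ∏' il : ℕ × ℕ, (1 - u ^ (il.1 + 1) * (r : ℝ) ^ ((1 : ℤ) - 2 * il.2))⁻¹) := by
  obtain ⟨_, _, h3, h4⟩ := final_an hr hu
  obtain ⟨_, _, h5, h6⟩ := final_an hr (u := |u|) (by rwa [abs_abs])
  obtain ⟨M, hM⟩ := h5.tendsto_prod_nat.bddAbove_range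
  exact an_prod (gq r) (gq_nn hr) (gq_zero r) u _ M h4 h6 (fun s => hM ⟨s, rfl⟩) h3.tendsto_prod_nat

end analytic
end SpFF


set_option linter.all false
namespace SpFF

section symp
open Module Polynomial
variable {F : Type} [Field F]

lemma inv_exists (h2 : (2 : F) ≠ 0) (d : ℕ) : ∀ (V : Type) [AddCommGroup V] [Module F V] [FiniteDimensional F V] (γ : Bil F V),
    finrank F V = d → ND γ → Typ (some (-1)) γ → ∃ B : End F V, Sk B γ ∧ B * B = 1 := by
  induction d using Nat.strong_induction_on with
  | _ d ih =>
  intro V _ _ _ γ hd hn ht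
  have ht : ∀ x y, γ y x = - γ x y := fun x y => by simpa using ht (-1) rfl x y
  have hself : ∀ x, γ x x = 0 := fun x => by
    have h := ht x x
    have : 2 * γ x x = 0 := by linear_combination h
    exact (mul_eq_zero.1 this).resolve_left h2
  by_cases hV : ∀ x : V, x = 0
  · exact ⟨0, sk_zero _, LinearMap.ext fun x => by rw [hV x]; simp⟩
  push Not at hV
  obtain ⟨x, hx⟩ := hV
  obtain ⟨y, hxy⟩ : ∃ y, γ x y = 1 := by
    by_contra hcon
    push Not at hcon
    refine hx (hn x fun y => ?_)
    by_contra h0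
    refine hcon ((γ x y)⁻¹ • y) ?_
    rw [map_smul, smul_eq_mul, inv_mul_cancel₀ h0]
  have hyx : γ y x = -1 := by rw [ht x y, hxy]
  let V' : Submodule F V := LinearMap.ker (γ x) ⊓ LinearMap.ker (γ y)
  let p0 : V →ₗ[F] V := LinearMap.id - (γ.flip y).smulRight x + (γ.flip x).smulRight y
  have hp0 : ∀ v, p0 v = v - γ v y • x + γ v x • y := fun v => rfl
  let π : V →ₗ[F] V' := p0.codRestrict V' fun v => by
    constructor
    · rw [SetLike.mem_coe, LinearMap.mem_ker, hp0]
      simp only [map_add, map_sub, map_smul, smul_eq_mul, hself, hxy]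
      rw [ht v x]; ring
    · rw [SetLike.mem_coe, LinearMap.mem_ker, hp0]
      simp only [map_add, map_sub, map_smul, smul_eq_mul, hself, hyx]
      rw [ht v y]; ring
  have hπ : ∀ v, v = γ v y • x - γ v x • y + (π v : V) := fun v => by
    change v = γ v y • x - γ v x • y + (v - γ v y • x + γ v x • y)
    abel
  have hx' : ∀ w : V', γ x w = 0 := fun w => w.2.1
  have hy' : ∀ w : V', γ y w = 0 := fun w => w.2.2
  have hx'' : ∀ w : V', γ w x = 0 := fun w => by rw [ht x, hx', neg_zero]
  have hy'' : ∀ w : V', γ w y = 0 := fun w => by rw [ht y, hy', neg_zero]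
  let γ' : Bil F V' := γ.compl₁₂ V'.subtype V'.subtype
  have hγ' : ∀ v w, γ' v w = γ v w := fun _ _ => rfl
  have hlt : finrank F V' < d := by
    rw [← hd]
    refine Submodule.finrank_lt fun h => ?_
    have : x ∈ V' := h ▸ Submodule.mem_top
    have h3 : γ y x = 0 := this.2
    rw [hyx] at h3
    exact one_ne_zero (neg_eq_zero.1 h3)
  obtain ⟨B', hB', hBB⟩ := ih _ hlt V' γ' rfl (by
    intro w hw
    apply Subtype.ext
    refine hn _ fun v => ?_
    rw [hπ v, map_add, map_sub, map_smul, map_smul, hx'', hy'', ← hγ', hw]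
    simp) (by
    intro ε hε v w
    obtain rfl : -1 = ε := by simpa using hε
    rw [hγ', hγ', ht]; ring)
  let B : End F V := (γ.flip y).smulRight x + (γ.flip x).smulRight y + V'.subtype ∘ₗ B' ∘ₗ π
  have hB : ∀ v, B v = γ v y • x + γ v x • y + (B' (π v) : V) := fun v => rfl
  have e1 : ∀ v, γ (B v) y = γ v y := fun v => by
    rw [hB]; simp [hxy, hself, hy'']
  have e2 : ∀ v, γ (B v) x = - γ v x := fun v => by
    rw [hB]; simp [hyx, hself, hx'']
  have e3 : ∀ v, π (B v) = B' (π v) := fun v => by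
    apply Subtype.ext
    have h := hπ (B v)
    rw [e1, e2, hB] at h
    have h' : (B' (π v) : V) = π (B v) := by
      have h4 := sub_eq_zero.2 h
      rw [hB, ← sub_eq_zero, ← h4]
      module
    exact h'.symm
  refine ⟨B, ?_, ?_⟩
  · intro v w
    have hv : γ (B v) w = γ (B v) (γ w y • x - γ w x • y + (π w : V)) := by rw [← hπ w]
    have hw : γ v (B w) = γ (γ v y • x - γ v x • y + (π v : V)) (B w) := by rw [← hπ v]
    rw [hv, hw, hB v, hB w]
    have hs := hB' (π v) (π w)
    rw [hγ', hγ'] at hs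
    simp only [map_add, map_sub, map_smul, LinearMap.add_apply, LinearMap.sub_apply, LinearMap.smul_apply, smul_eq_mul, hself, hxy, hyx, hx', hy', hx'', hy'', hs]
    ring
  · refine LinearMap.ext fun v => ?_
    rw [Module.End.mul_apply, hB (B v), e1, e2, e3]
    have : B' (B' (π v)) = π v := LinearMap.congr_fun hBB (π v)
    rw [this, Module.End.one_apply]
    conv_rhs => rw [hπ v]
    module

section cnt
variable {U V : Type} [AddCommGroup V] [Module F V] [AddCommGroup U] [Module F U]
variable [FiniteDimensional F V] [FiniteDimensional F U]

lemma std_form (h2 : (2 : F) ≠ 0) (hdim : finrank F V = 2 * finrank F U) (γ : Bil F V) (hn : ND γ) (ht : Typ (some (-1)) γ) :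
    ∃ e : (U × Dual F U) ≃ₗ[F] V, ∀ z w, γ (e z) (e w) = w.2 z.1 - z.2 w.1 := by
  obtain ⟨B, hB, hBB⟩ := inv_exists h2 _ V γ rfl hn ht
  obtain ⟨e, P, _, h⟩ := (lagr_exists (U := U) h2 (0, B, γ) ⟨by simp, hn, ht, sk_zero _, hB⟩ (by
    have : aeval B (1 - X ^ 2 : F[X]) = 0 := by
      rw [map_sub, map_one, map_pow, aeval_X, pow_two, hBB, sub_self]
    simp only [this]
    exact IsNilpotent.zero)).2 hdim
  refine ⟨e, fun z w => ?_⟩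
  have h3 : (tr e (st P)).2.2 = γ := by rw [h]
  rw [← h3, tr_3, LinearEquiv.symm_apply_apply, LinearEquiv.symm_apply_apply, st_3]

/-- number of commuting pairs in the Lie algebra of a form -/
noncomputable def SS (γ : Bil F V) : ℕ := Nat.card {P : End F V × End F V // Sk P.1 γ ∧ Sk P.2 γ ∧ P.1 * P.2 = P.2 * P.1}

lemma SS_congr (e : V ≃ₗ[F] V) (γ : Bil F V) : SS (pb e γ) = SS γ := by
  let E := (e.conjAlgEquiv F).toEquiv
  refine Nat.card_congr ((Equiv.prodCongr E E).subtypeEquiv fun P => ?_)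
  have h : ∀ A : End F V, Sk A (pb e γ) ↔ Sk (e.conjAlgEquiv F A) γ := fun A => pb_sk e A _ (fun x => by simp) γ
  change _ ↔ Sk (e.conjAlgEquiv F P.1) γ ∧ Sk (e.conjAlgEquiv F P.2) γ ∧ e.conjAlgEquiv F P.1 * e.conjAlgEquiv F P.2 = e.conjAlgEquiv F P.2 * e.conjAlgEquiv F P.1
  rw [← h, ← h, ← map_mul, ← map_mul, (e.conjAlgEquiv F).injective.eq_iff]

lemma SS_const (h2 : (2 : F) ≠ 0) (hdim : finrank F V = 2 * finrank F U) (γ γ' : Bil F V) (hn : ND γ) (ht : Typ (some (-1)) γ)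
    (hn' : ND γ') (ht' : Typ (some (-1)) γ') : SS γ = SS γ' := by
  obtain ⟨e, he⟩ := std_form (U := U) h2 hdim γ hn ht
  obtain ⟨e', he'⟩ := std_form (U := U) h2 hdim γ' hn' ht'
  rw [← SS_congr (e.symm.trans e') γ']
  congr 1
  ext x y
  obtain ⟨z, rfl⟩ := e.surjective x
  obtain ⟨w, rfl⟩ := e.surjective y
  rw [pb_apply, LinearEquiv.trans_apply, LinearEquiv.trans_apply, LinearEquiv.symm_apply_apply, LinearEquiv.symm_apply_apply, he, he']

lemma tot_SS [Fintype F] (h2 : (2 : F) ≠ 0) (hdim : finrank F V = 2 * finrank F U) (γ : Bil F V) (hn : ND γ) (ht : Typ (some (-1)) γ) :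
    (famL (-1 : F)).tot V = dF (some (-1)) (0 : End F V) * SS γ := by
  classical
  haveI : Finite V := Module.finite_of_finite F
  haveI : Finite (End F V) := end_finite
  let T := {β : Bil F V // Sk 0 β ∧ Typ (some (-1 : F)) β ∧ ND β}
  let E : {t : Tr F V // LP (-1 : F) t.1 t.2.1 t.2.2} ≃ Σ β : T, {P : End F V × End F V // Sk P.1 β.1 ∧ Sk P.2 β.1 ∧ P.1 * P.2 = P.2 * P.1} :=
    { toFun := fun t => ⟨⟨t.1.2.2, sk_zero _, t.2.2.2.1, t.2.2.1⟩, ⟨(t.1.1, t.1.2.1), t.2.2.2.2.1, t.2.2.2.2.2, t.2.1⟩⟩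
      invFun := fun s => ⟨(s.2.1.1, s.2.1.2, s.1.1), s.2.2.2.2, s.1.2.2.2, s.1.2.2.1, s.2.2.1, s.2.2.2.1⟩
      left_inv := fun t => rfl
      right_inv := fun s => rfl }
  have h1 : (famL (-1 : F)).tot V = Nat.card (Σ β : T, {P : End F V × End F V // Sk P.1 β.1 ∧ Sk P.2 β.1 ∧ P.1 * P.2 = P.2 * P.1}) :=
    Nat.card_congr E
  haveI := Fintype.ofFinite T
  rw [h1, Nat.card_sigma, Finset.sum_congr rfl (fun β _ => show _ = SS γ from SS_const (U := U) h2 hdim β.1 γ β.2.2.2 β.2.2.1 hn ht)]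
  rw [Finset.sum_const, smul_eq_mul, Finset.card_univ, ← Nat.card_eq_fintype_card]
  rfl

lemma tot_congr {W : Type} [AddCommGroup W] [Module F W] (𝓕 : Fam F) (e : V ≃ₗ[F] W) : 𝓕.tot V = 𝓕.tot W := by
  refine Nat.card_congr ⟨fun t => ⟨tr e t.1, 𝓕.htr e _ t.2⟩, fun t => ⟨tr e.symm t.1, 𝓕.htr e.symm _ t.2⟩, fun t => Subtype.ext (tr_symm_tr e _), fun t => Subtype.ext (tr_tr_symm e _)⟩

end cnt

section mat
open Matrix

lemma J_T (n : ℕ) : (sympJ F n)ᵀ = - sympJ F n := by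
  rw [sympJ, Matrix.fromBlocks_transpose, Matrix.fromBlocks_neg]; simp

lemma J_J (n : ℕ) : sympJ F n * sympJ F n = -1 := by
  rw [sympJ, Matrix.fromBlocks_multiply, ← Matrix.fromBlocks_one, Matrix.fromBlocks_neg]; simp

/-- the standard symplectic form -/
noncomputable def gJ (F : Type) [Field F] (n : ℕ) : Bil F (Fin n ⊕ Fin n → F) := Matrix.toLinearMap₂' F (sympJ F n)

lemma gJ_apply (n : ℕ) (x y : Fin n ⊕ Fin n → F) : gJ F n x y = x ⬝ᵥ (sympJ F n) *ᵥ y :=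
  Matrix.toLinearMap₂'_apply' _ _ _

lemma gJ_typ (n : ℕ) : Typ (some (-1)) (gJ F n) := by
  intro ε hε x y
  obtain rfl : -1 = ε := by simpa using hε
  rw [gJ_apply, gJ_apply, Matrix.dotProduct_mulVec, ← Matrix.mulVec_transpose, J_T, Matrix.neg_mulVec, dotProduct_comm]
  simp

lemma gJ_nd (n : ℕ) : ND (gJ F n) := by
  intro x hx
  have h1 : x ᵥ* sympJ F n = 0 := by
    apply dotProduct_eq
    intro y
    rw [← Matrix.dotProduct_mulVec, ← gJ_apply, hx, zero_dotProduct]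
  have h3 := congrArg (fun z => z ᵥ* sympJ F n) h1
  simp only [Matrix.vecMul_vecMul, J_J, Matrix.zero_vecMul] at h3
  rw [Matrix.vecMul_neg, Matrix.vecMul_one, neg_eq_zero] at h3
  exact h3

lemma gJ_sk (n : ℕ) (A : Matrix (Fin n ⊕ Fin n) (Fin n ⊕ Fin n) F) :
    A * sympJ F n = (A * sympJ F n)ᵀ ↔ Sk (Matrix.toLin' Aᵀ) (gJ F n) := by
  have e1 : ∀ x y, gJ F n (Matrix.toLin' Aᵀ x) y = Matrix.toLinearMap₂' F (A * sympJ F n) x y := by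
    intro x y
    rw [gJ_apply, Matrix.toLin'_apply, Matrix.mulVec_transpose, Matrix.toLinearMap₂'_apply', ← Matrix.mulVec_mulVec, Matrix.dotProduct_mulVec x A]
  have e2 : ∀ x y, - gJ F n x (Matrix.toLin' Aᵀ y) = Matrix.toLinearMap₂' F ((A * sympJ F n)ᵀ) x y := by
    intro x y
    rw [gJ_apply, Matrix.toLin'_apply, Matrix.toLinearMap₂'_apply', Matrix.transpose_mul, J_T, Matrix.mulVec_mulVec, Matrix.neg_mul, Matrix.neg_mulVec, dotProduct_neg]
  constructor
  · intro h x y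
    rw [e1, e2, ← h]
  · intro h
    apply LinearEquiv.injective (Matrix.toLinearMap₂' F : Matrix (Fin n ⊕ Fin n) (Fin n ⊕ Fin n) F ≃ₗ[F] Bil F (Fin n ⊕ Fin n → F))
    refine LinearMap.ext fun x => LinearMap.ext fun y => ?_
    rw [← e1, ← e2, h]

lemma SS_gJ [Fintype F] (n : ℕ) : SS (gJ F n) = spCommPairs F n := by
  symm
  let E : Matrix (Fin n ⊕ Fin n) (Fin n ⊕ Fin n) F ≃ End F (Fin n ⊕ Fin n → F) :=
    (Matrix.transposeAddEquiv _ _ F).toEquiv.trans Matrix.toLin'.toEquiv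
  have hE : ∀ A, E A = Matrix.toLin' Aᵀ := fun A => rfl
  refine Nat.card_congr ((Equiv.prodCongr E E).subtypeEquiv fun P => ?_)
  change _ ↔ Sk (E P.1) (gJ F n) ∧ Sk (E P.2) (gJ F n) ∧ E P.1 * E P.2 = E P.2 * E P.1
  rw [gJ_sk, gJ_sk, hE, hE]
  refine and_congr Iff.rfl (and_congr Iff.rfl ?_)
  rw [Module.End.mul_eq_comp, Module.End.mul_eq_comp, ← Matrix.toLin'_mul, ← Matrix.toLin'_mul, Matrix.toLin'.injective.eq_iff, ← Matrix.transpose_mul, ← Matrix.transpose_mul, Matrix.transpose_inj]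
  exact eq_comm

end mat

lemma sp_order {q : ℕ} (hq : 1 < q) (n : ℕ) : hc q n * spOrder q n = (q : ℝ) ^ ((2 * n + 1).choose 2) := by
  have hq0 : (q : ℝ) ≠ 0 := by positivity
  induction n with
  | zero => simp [hc, spOrder]
  | succ n ih =>
    have e1 : (2 * (n + 1) + 1).choose 2 = (2 * n + 1).choose 2 + (4 * n + 3) := by
      have : 2 * (n + 1) + 1 = (2 * n + 1) + 1 + 1 := by ring
      rw [this, ch_succ, ch_succ]; ring
    have e2 : spOrder q (n + 1) = spOrder q n * ((q : ℝ) ^ (2 * n + 1) * ((q : ℝ) ^ (2 * (n + 1)) - 1)) := by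
      rw [spOrder, spOrder, Finset.prod_range_succ, show (n + 1) ^ 2 = n ^ 2 + (2 * n + 1) by ring, pow_add]; ring
    have e3 : (q : ℝ) ^ (2 * (n + 1)) - 1 = (1 - ((q : ℝ)⁻¹) ^ (2 * (n + 1))) * (q : ℝ) ^ (2 * (n + 1)) := by
      rw [sub_mul, ← mul_pow, inv_mul_cancel₀ hq0]; simp
    rw [e1, e2, e3, pow_add _ ((2 * n + 1).choose 2), ← ih, ← hc_succ hq n, show 4 * n + 3 = (2 * n + 1) + 2 * (n + 1) by ring, pow_add _ (2 * n + 1) (2 * (n + 1))]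
    ring

lemma coeff_S [Fintype F] (h2 : (2 : F) ≠ 0) (n : ℕ) :
    (spCommPairs F n : ℝ) / spOrder (Fintype.card F) n =
      (Nat.Partition.genFun fun _ c => (gq (Fintype.card F)).coeff c).coeff n := by
  set q := Fintype.card F with hq
  have hq1 : 1 < q := Fintype.one_lt_card
  have hq0 : (0 : ℝ) < q := by positivity
  have hZ := congrArg (PowerSeries.coeff (2 * n)) (Z_eq h2)
  rw [ser, PowerSeries.coeff_mk, ex, PowerSeries.coeff_expand_mul] at hZ
  rw [← hZ]
  let e : (Fin (2 * n) → F) ≃ₗ[F] (Fin n ⊕ Fin n → F) := LinearEquiv.ofFinrankEq _ _ (by simp; ring)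
  have h1 : (famL (-1 : F)).tot (Fin (2 * n) → F) = DD F (some (-1)) (2 * n) * spCommPairs F n := by
    rw [tot_congr _ e, tot_SS (U := Fin n → F) h2 (by simp; ring) (gJ F n) (gJ_nd n) (gJ_typ n), SS_gJ, DD,
      dF_congr e _ (0 : End F (Fin (2 * n) → F)) (0 : End F (Fin n ⊕ Fin n → F)) (fun x => by simp)]
  have h3 := congrArg (PowerSeries.coeff (2 * n)) (fa_eq h2)
  rw [fa, h2s, PowerSeries.coeff_mk, PowerSeries.coeff_mk, if_pos (even_two_mul n), Nat.mul_div_cancel_left _ (by norm_num), NN_one] at h3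
  have hG : (glc F (Fin (2 * n) → F) : ℝ) = Gl q (2 * n) := by
    rw [glc_eq, finrank_fin_fun]; rfl
  have hG0 := Gl_pos hq1 (2 * n)
  have hs := sp_order hq1 n
  have hp : (0 : ℝ) < (q : ℝ) ^ ((2 * n + 1).choose 2) := by positivity
  have hso : spOrder q n ≠ 0 := by
    intro h0; rw [h0, mul_zero] at hs; exact hp.ne hs
  rw [h1, hG, Nat.cast_mul, div_eq_div_iff hso hG0.ne']
  push_cast at h3
  rw [div_eq_iff hG0.ne', ← hs] at h3
  have hc0 := hc_pos hq1 n
  have h4 : (DD F (some (-1)) (2 * n) : ℝ) * spOrder q n = Gl q (2 * n) := by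
    apply mul_left_cancel₀ hc0.ne'
    rw [← h3]; ring
  rw [← h4]; ring

end symp

end SpFF

theorem feit_fine_symplectic
    (q : ℕ) (hq : ∃ p m : ℕ, p.Prime ∧ 0 < m ∧ q = p ^ m) (hodd : Odd q)
    (F : Type) [Field F] [Fintype F] (hF : Fintype.card F = q)
    (u : ℝ) (hu : |u| < 1 / q) :
    Summable (fun n : ℕ => (spCommPairs F n : ℝ) * u ^ n / spOrder q n) ∧
    Multipliable (fun i : ℕ => 1 + u ^ (i + 1)) ∧
    Multipliable (fun il : ℕ × ℕ =>
      (1 - u ^ (il.1 + 1) * (q : ℝ) ^ ((1 : ℤ) - 2 * il.2))⁻¹) ∧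
    ∑' n : ℕ, (spCommPairs F n : ℝ) * u ^ n / spOrder q n =
      (∏' i : ℕ, (1 + u ^ (i + 1))) *
        ∏' il : ℕ × ℕ, (1 - u ^ (il.1 + 1) * (q : ℝ) ^ ((1 : ℤ) - 2 * il.2))⁻¹ := by
  subst hF
  have h2 : (2 : F) ≠ 0 := SpFF.char_ne hodd
  have hq1 : 1 < Fintype.card F := Fintype.one_lt_card
  have hs := SpFF.final_sum hq1 hu
  obtain ⟨m1, m2, _, _⟩ := SpFF.final_an hq1 hu
  have he : (fun n : ℕ => (spCommPairs F n : ℝ) * u ^ n / spOrder (Fintype.card F) n) =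
      fun n => PowerSeries.coeff n (Nat.Partition.genFun fun _ c => PowerSeries.coeff c (SpFF.gq (Fintype.card F))) * u ^ n := by
    funext n
    rw [← SpFF.coeff_S h2]; ring
  rw [he]
  exact ⟨hs.summable, m1, m2, hs.tsum_eq⟩
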